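/- arXiv:2002.01569 — 2 statements merged into one kernel-verified Lean document; each statement's English description precedes it below -/
import Mathlib

section
/- Let (X_n)_{n≥1} be a sequence of random batches of input points in Ω with corresponding observations Y_n = Z(X_n), let F_n be the σ-algebra generated by (X_1,Y_1,…,X_n,Y_n) (with F_0 trivial), and assume that conditional on F_{n−1}, X_n and the process Z are independent for every n ≥ 1. Let T be a stopping time with respect to (F_n) satisfying 1 ≤ T < ∞ almost surely. For each n let μ_n(x) = r_n(x)ᵀ K_n⁻¹ Y_{1:n} and σ_n(x)² = σ²(1 − r_n(x)ᵀ K_n⁻¹ r_n(x)) be the kriging mean and variance based on all points x₁,…,x_{m_n} sampled through iteration n (with K_n = (Ψ(x_j − x_k))_{jk} invertible a.s.), and let M_n = sup_{x∈Ω} (Z(x) − μ_n(x)) / (σ_n(x) log^{1/2}(eσ/σ_n(x))) with the convention 0/0 = 0. If C is a constant such that for every fixed (deterministic) design the fixed-design bound E[M] ≤ C √(p (1 ∨ log(A₀ D_Ω))) holds, then for every t > 0, P(M_T − C √(p (1 ∨ log(A₀ D_Ω))) > t) ≤ e^{−t²/2}. -/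
open MeasureTheory ProbabilityTheory
open scoped RealInnerProductSpace

noncomputable def kmat {p n : ℕ} (Ψ : EuclideanSpace ℝ (Fin p) → ℝ)
    (xs : Fin n → EuclideanSpace ℝ (Fin p)) : Matrix (Fin n) (Fin n) ℝ :=
  Matrix.of fun j k => Ψ (xs j - xs k)

noncomputable def kinterp {p n : ℕ} (Ψ : EuclideanSpace ℝ (Fin p) → ℝ)
    (xs : Fin n → EuclideanSpace ℝ (Fin p)) (f : EuclideanSpace ℝ (Fin p) → ℝ)
    (v : EuclideanSpace ℝ (Fin p)) : ℝ :=
  ∑ j, ∑ k, Ψ (v - xs j) * (kmat Ψ xs)⁻¹ j k * f (xs k)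

noncomputable def krigSd {p n : ℕ} (Ψ : EuclideanSpace ℝ (Fin p) → ℝ)
    (xs : Fin n → EuclideanSpace ℝ (Fin p)) (σ : ℝ)
    (v : EuclideanSpace ℝ (Fin p)) : ℝ :=
  σ * Real.sqrt (1 - ∑ j, ∑ k, Ψ (v - xs j) * (kmat Ψ xs)⁻¹ j k * Ψ (v - xs k))

noncomputable def krigRatio {p n : ℕ} (Ψ : EuclideanSpace ℝ (Fin p) → ℝ)
    (xs : Fin n → EuclideanSpace ℝ (Fin p)) (σ : ℝ)
    (f : EuclideanSpace ℝ (Fin p) → ℝ) (v : EuclideanSpace ℝ (Fin p)) : ℝ :=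
  (f v - kinterp Ψ xs f v) /
    (krigSd Ψ xs σ v * Real.sqrt (Real.log (Real.exp 1 * σ / krigSd Ψ xs σ v)))

def GaussCov {p : ℕ} {Ω' : Type*} [MeasurableSpace Ω'] (P : Measure Ω')
    (Z : EuclideanSpace ℝ (Fin p) → Ω' → ℝ) (σ : ℝ)
    (Ψ : EuclideanSpace ℝ (Fin p) → ℝ) : Prop :=
  ∀ (m : ℕ) (c : Fin m → ℝ) (y : Fin m → EuclideanSpace ℝ (Fin p)),
    Measure.map (fun ω' => ∑ i, c i * Z (y i) ω') P =
      gaussianReal 0 (∑ i, ∑ j, c i * c j * (σ ^ 2 * Ψ (y i - y j))).toNNReal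

def IsSpectralDensity {p : ℕ} (Ψ Ψt : EuclideanSpace ℝ (Fin p) → ℝ) : Prop :=
  (∀ ω, 0 ≤ Ψt ω) ∧ Integrable Ψt ∧ ((∫ ω, Ψt ω) = 1) ∧
    ∀ v, Ψ v = ∫ ω, Real.cos ⟪ω, v⟫ * Ψt ω

noncomputable def A0 {p : ℕ} (Ψt : EuclideanSpace ℝ (Fin p) → ℝ) : ℝ :=
  ∫ ω, (∑ i, |ω i|) * Ψt ω

/-- The data collected after the first `k` sampled points: the points and the
corresponding observed values of the process. -/
noncomputable def seqInfo {p : ℕ} {Ω' : Type} (pts : ℕ → Ω' → EuclideanSpace ℝ (Fin p))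
    (Z : EuclideanSpace ℝ (Fin p) → Ω' → ℝ) (k : ℕ) (ω' : Ω') :
    Fin k → EuclideanSpace ℝ (Fin p) × ℝ :=
  fun i => (pts i ω', Z (pts i ω') ω')

/-- The σ-algebra `F_n` generated by the data `(X_{1:n}, Y_{1:n})` collected after `n`
iterations, when `m n` points have been sampled in total (with `m 0 = 0`, `F_0` is the
trivial σ-algebra). -/
noncomputable def seqFilt {p : ℕ} {Ω' : Type} [MeasurableSpace Ω']
    (pts : ℕ → Ω' → EuclideanSpace ℝ (Fin p)) (Z : EuclideanSpace ℝ (Fin p) → Ω' → ℝ)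
    (m : ℕ → ℕ) (n : ℕ) : MeasurableSpace Ω' :=
  MeasurableSpace.comap (seqInfo pts Z (m n)) inferInstance

/-! ### Gaussian concentration -/

theorem gc_exp_taylor (w : ℝ) :
    Real.exp w ≤ 1 + w + w ^ 2 / 2 + |w| ^ 3 * Real.exp |w| := by
  have h := Complex.norm_exp_sub_sum_le_norm_mul_exp (w : ℂ) 3
  have h2 : (Complex.exp (w : ℂ) - ∑ m ∈ Finset.range 3, (w : ℂ) ^ m / (m.factorial : ℂ))
      = ((Real.exp w - (1 + w + w ^ 2 / 2) : ℝ) : ℂ) := by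
    simp [Finset.sum_range_succ, Nat.factorial]
  rw [h2, Complex.norm_real, Complex.norm_real] at h
  simp only [Real.norm_eq_abs] at h
  have := le_abs_self (Real.exp w - (1 + w + w ^ 2 / 2))
  linarith

theorem gc_integrable_exp {E : Type*} [NormedAddCommGroup E] [NormedSpace ℝ E]
    [MeasurableSpace E] [BorelSpace E] [SecondCountableTopology E] [CompleteSpace E]
    (ν : Measure E) [IsGaussian ν] (a : ℝ) :
    Integrable (fun y => Real.exp (a * ‖y‖)) ν := by
  obtain ⟨c, hc, hi⟩ := IsGaussian.exists_integrable_exp_sq ν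
  refine (hi.const_mul (Real.exp (a ^ 2 / (4 * c)))).mono' (by fun_prop) ?_
  filter_upwards with y
  rw [Real.norm_eq_abs, abs_of_pos (Real.exp_pos _), ← Real.exp_add]
  apply Real.exp_le_exp.mpr
  have : a ^ 2 / (4 * c) + c * ‖y‖ ^ 2 - a * ‖y‖ = (a - 2 * c * ‖y‖) ^ 2 / (4 * c) := by
    field_simp; ring
  have h2 : 0 ≤ (a - 2 * c * ‖y‖) ^ 2 / (4 * c) := by positivity
  linarith

theorem gc_integrable_norm_pow {E : Type*} [NormedAddCommGroup E] [NormedSpace ℝ E]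
    [MeasurableSpace E] [BorelSpace E] [SecondCountableTopology E] [CompleteSpace E]
    (ν : Measure E) [IsGaussian ν] (n : ℕ) :
    Integrable (fun y => ‖y‖ ^ n) ν := by
  refine ((gc_integrable_exp ν 1).const_mul (n.factorial : ℝ)).mono' (by fun_prop) ?_
  filter_upwards with y
  have := Real.pow_div_factorial_le_exp ‖y‖ (norm_nonneg _) n
  rw [div_le_iff₀ (by positivity)] at this
  rw [Real.norm_eq_abs, abs_of_nonneg (by positivity), one_mul]
  linarith

section conc
variable {ι : Type} [Fintype ι]

theorem gc_lin_bound (w : ι → ℝ) (hw0 : ∀ i, 0 ≤ w i) (hw1 : ∑ i, w i = 1) (y : ι → ℝ) :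
    |∑ i, w i * y i| ≤ ‖y‖ := by
  calc |∑ i, w i * y i| ≤ ∑ i, |w i * y i| := Finset.abs_sum_le_sum_abs _ _
    _ ≤ ∑ i, w i * ‖y‖ := by
        apply Finset.sum_le_sum
        intro i _
        rw [abs_mul, abs_of_nonneg (hw0 i)]
        exact mul_le_mul_of_nonneg_left (by simpa using norm_le_pi_norm y i) (hw0 i)
    _ = ‖y‖ := by rw [← Finset.sum_mul, hw1, one_mul]

theorem gc_lin_sq (w : ι → ℝ) (hw0 : ∀ i, 0 ≤ w i) (hw1 : ∑ i, w i = 1) (y : ι → ℝ) :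
    (∑ i, w i * y i) ^ 2 ≤ ∑ i, w i * (y i) ^ 2 := by
  have h := (even_two.convexOn_pow (𝕜 := ℝ)).map_sum_le (t := Finset.univ) (w := w) (p := y)
    (fun i _ => hw0 i) hw1 (fun i _ => Set.mem_univ _)
  simpa using h

variable (ν : Measure (ι → ℝ)) [IsGaussian ν]

set_option maxHeartbeats 1000000 in
/-- one step of the discretised heat flow -/
theorem gc_step (hν0 : ∀ i, ∫ y, y i ∂ν = 0) (hν1 : ∀ i, ∫ y, (y i) ^ 2 ∂ν ≤ 1)
    (l K : ℝ) (hK : 0 ≤ K) :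
    ∃ B : ℝ, 0 ≤ B ∧ ∀ (f : (ι → ℝ) → ℝ) (x : ι → ℝ) (w : ι → ℝ) (e : ℝ),
      Measurable f → 0 ≤ e → e ≤ 1 → (∀ x y, |f (x + y) - f x| ≤ ‖y‖) →
      (∀ i, 0 ≤ w i) → ∑ i, w i = 1 →
      (∀ y, |f (x + y) - f x - ∑ i, w i * y i| ≤ K * ‖y‖ ^ 2) →
      ∫ y, Real.exp (l * f (x + e • y)) ∂ν ≤
        Real.exp (l * (∫ y, f (x + e • y) ∂ν) + l ^ 2 * e ^ 2 / 2 + e ^ 3 * B) := by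
  set m1 := ∫ y, ‖y‖ ∂ν with hm1
  set m2 := ∫ y, ‖y‖ ^ 2 ∂ν with hm2
  have hm1n : 0 ≤ m1 := integral_nonneg fun _ => norm_nonneg _
  have hm2n : 0 ≤ m2 := integral_nonneg fun _ => by positivity
  let N : (ι → ℝ) → ℝ := fun y => 1 + ‖y‖ + m1 + m2
  set B0 := (l ^ 2 / 2 * (2 * K + K ^ 2) + |l| ^ 3) * 24 with hB0
  have hB0n : 0 ≤ B0 := by positivity
  have hI1 : Integrable (fun y : ι → ℝ => ‖y‖) ν := by
    simpa using gc_integrable_norm_pow ν 1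
  have hI2 : Integrable (fun y : ι → ℝ => ‖y‖ ^ 2) ν := gc_integrable_norm_pow ν 2
  have hHint : Integrable (fun y => B0 * Real.exp ((|l| + 1) * N y)) ν := by
    have := (gc_integrable_exp ν (|l| + 1)).const_mul
      (B0 * Real.exp ((|l| + 1) * (1 + m1 + m2)))
    refine this.congr ?_
    filter_upwards with y
    simp only [N]
    rw [mul_assoc, ← Real.exp_add]
    ring_nf
  refine ⟨∫ y, B0 * Real.exp ((|l| + 1) * N y) ∂ν, integral_nonneg fun _ => by positivity, ?_⟩
  intro f x w e hf he0 he1 hlip hw0 hw1 hsec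
  set a : (ι → ℝ) → ℝ := fun y => f (x + e • y) - f x with ha
  have hameas : Measurable a := by
    apply Measurable.sub_const
    exact hf.comp (by fun_prop)
  have ha_le : ∀ y, |a y| ≤ e * ‖y‖ := by
    intro y
    have := hlip x (e • y)
    rwa [norm_smul, Real.norm_eq_abs, abs_of_nonneg he0] at this
  have haint : Integrable a ν := by
    refine (hI1.const_mul e).mono' hameas.aestronglyMeasurable ?_
    filter_upwards with y using ha_le y
  set A := ∫ y, a y ∂ν with hA
  have hA_le : |A| ≤ e * m1 := by
    calc |A| ≤ ∫ y, |a y| ∂ν := abs_integral_le_integral_abs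
      _ ≤ ∫ y, e * ‖y‖ ∂ν := integral_mono haint.abs (hI1.const_mul e) ha_le
      _ = e * m1 := by rw [integral_const_mul]
  have hcoord : ∀ i, Integrable (fun y : ι → ℝ => y i) ν := fun i =>
    hI1.mono' (measurable_pi_apply i).aestronglyMeasurable (by filter_upwards with y using norm_le_pi_norm y i)
  have hcoord2 : ∀ i, Integrable (fun y : ι → ℝ => (y i) ^ 2) ν := fun i =>
    hI2.mono' ((measurable_pi_apply i).pow_const 2).aestronglyMeasurable (by
      filter_upwards with y
      rw [Real.norm_eq_abs, abs_pow]
      exact pow_le_pow_left₀ (abs_nonneg _) (norm_le_pi_norm y i) 2)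
  let L : (ι → ℝ) → ℝ := fun y => ∑ i, w i * y i
  have hLint : Integrable L ν := integrable_finsetSum _ fun i _ => (hcoord i).const_mul _
  have hL0 : ∫ y, L y ∂ν = 0 := by
    simp only [L]
    rw [integral_finsetSum _ fun i _ => (hcoord i).const_mul _]
    simp [integral_const_mul, hν0]
  have hL2le : ∀ y, (L y) ^ 2 ≤ ∑ i, w i * (y i) ^ 2 := gc_lin_sq w hw0 hw1
  have hS2int : Integrable (fun y : ι → ℝ => ∑ i, w i * (y i) ^ 2) ν :=
    integrable_finsetSum _ fun i _ => (hcoord2 i).const_mul _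
  have hS2 : ∫ y, ∑ i, w i * (y i) ^ 2 ∂ν ≤ 1 := by
    rw [integral_finsetSum _ fun i _ => (hcoord2 i).const_mul _, ← hw1]
    apply Finset.sum_le_sum
    intro i _
    rw [integral_const_mul]
    nlinarith [hν1 i, hw0 i]
  have hrho : ∀ y, |a y - e * L y| ≤ K * e ^ 2 * ‖y‖ ^ 2 := by
    intro y
    have := hsec (e • y)
    rw [norm_smul, Real.norm_eq_abs, abs_of_nonneg he0] at this
    have h2 : ∑ i, w i * (e • y) i = e * L y := by
      simp only [L, Pi.smul_apply, smul_eq_mul, Finset.mul_sum]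
      exact Finset.sum_congr rfl fun i _ => by ring
    rw [h2] at this
    simp only [ha]
    refine this.trans (le_of_eq (by ring))
  have hA_le2 : |A| ≤ K * e ^ 2 * m2 := by
    have : A = ∫ y, (a y - e * L y) ∂ν := by
      rw [integral_sub haint (hLint.const_mul e), integral_const_mul, hL0]; simp [hA]
    rw [this]
    calc |∫ y, (a y - e * L y) ∂ν| ≤ ∫ y, |a y - e * L y| ∂ν := abs_integral_le_integral_abs
      _ ≤ ∫ y, K * e ^ 2 * ‖y‖ ^ 2 ∂ν :=
        integral_mono (haint.sub (hLint.const_mul e)).abs (hI2.const_mul _) hrho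
      _ = _ := by rw [integral_const_mul]
  have hpt : ∀ y, Real.exp (l * (a y - A)) ≤
      1 + l * (a y - A) + l ^ 2 * e ^ 2 / 2 * (∑ i, w i * (y i) ^ 2)
        + e ^ 3 * (B0 * Real.exp ((|l| + 1) * N y)) := by
    intro y
    have hy := norm_nonneg y
    have hN1 : 1 ≤ N y := by simp only [N]; linarith
    have hWabs : |l * (a y - A)| ≤ |l| * e * N y := by
      rw [abs_mul, mul_assoc]
      apply mul_le_mul_of_nonneg_left _ (abs_nonneg _)
      calc |a y - A| ≤ |a y| + |A| := abs_sub _ _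
        _ ≤ e * ‖y‖ + e * m1 := add_le_add (ha_le y) hA_le
        _ ≤ e * N y := by simp only [N]; nlinarith
    have hcube : |l * (a y - A)| ^ 3 * Real.exp |l * (a y - A)| ≤
        e ^ 3 * (|l| ^ 3 * (N y ^ 4 * Real.exp (|l| * N y))) := by
      calc |l * (a y - A)| ^ 3 * Real.exp |l * (a y - A)|
          ≤ (|l| * e * N y) ^ 3 * Real.exp (|l| * N y) := by
            gcongr
            refine hWabs.trans ?_
            calc |l| * e * N y ≤ |l| * 1 * N y := by gcongr
              _ = _ := by ring
        _ = e ^ 3 * (|l| ^ 3 * (N y ^ 3 * Real.exp (|l| * N y))) := by ring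
        _ ≤ _ := by
            gcongr
            norm_num
    have hq : |a y - A - e * L y| ≤ K * e ^ 2 * N y ^ 2 := by
      have h1 : a y - A - e * L y = (a y - e * L y) - A := by ring
      rw [h1]
      calc _ ≤ |a y - e * L y| + |A| := abs_sub _ _
        _ ≤ K * e ^ 2 * ‖y‖ ^ 2 + K * e ^ 2 * m2 := add_le_add (hrho y) hA_le2
        _ = K * e ^ 2 * (‖y‖ ^ 2 + m2) := by ring
        _ ≤ _ := by
            gcongr
            simp only [N]; nlinarith
    have hLle : |L y| ≤ N y :=
      (gc_lin_bound w hw0 hw1 y).trans (by simp only [N]; linarith)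
    have hsq : (a y - A) ^ 2 ≤ e ^ 2 * (∑ i, w i * (y i) ^ 2) +
        e ^ 3 * ((2 * K + K ^ 2) * N y ^ 4) := by
      set r := a y - A - e * L y with hr
      have h1 : a y - A = e * L y + r := by rw [hr]; ring
      rw [h1]
      have h2 : (e * L y + r) ^ 2 = e ^ 2 * (L y) ^ 2 + 2 * e * (L y * r) + r ^ 2 := by ring
      rw [h2]
      have h3 : L y * r ≤ N y * (K * e ^ 2 * N y ^ 2) := by
        calc L y * r ≤ |L y * r| := le_abs_self _
          _ = |L y| * |r| := abs_mul _ _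
          _ ≤ _ := by gcongr
      have h4 : r ^ 2 ≤ (K * e ^ 2 * N y ^ 2) ^ 2 := by
        rw [← sq_abs r]; gcongr
      have h5 : e ^ 2 * (L y) ^ 2 ≤ e ^ 2 * (∑ i, w i * (y i) ^ 2) := by
        gcongr; exact hL2le y
      have h6 : 2 * e * (L y * r) ≤ e ^ 3 * (2 * K * N y ^ 4) := by
        calc 2 * e * (L y * r) ≤ 2 * e * (N y * (K * e ^ 2 * N y ^ 2)) := by gcongr
          _ = e ^ 3 * (2 * K * N y ^ 3) := by ring
          _ ≤ _ := by 
            gcongr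
            norm_num
      have h7 : (K * e ^ 2 * N y ^ 2) ^ 2 ≤ e ^ 3 * (K ^ 2 * N y ^ 4) := by
        calc (K * e ^ 2 * N y ^ 2) ^ 2 = e ^ 4 * (K ^ 2 * N y ^ 4) := by ring
          _ ≤ _ := by
            gcongr ?_ * _
            exact pow_le_pow_of_le_one he0 he1 (by norm_num)
      linarith
    have hN4 : N y ^ 4 ≤ 24 * Real.exp (N y) := by
      have := Real.pow_div_factorial_le_exp (N y) (by linarith) 4
      rw [div_le_iff₀ (by positivity)] at this
      norm_num [Nat.factorial] at this
      linarith
    have hexp1 : 1 ≤ Real.exp (|l| * N y) := Real.one_le_exp (by positivity)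
    have hexpadd : Real.exp ((|l| + 1) * N y) = Real.exp (|l| * N y) * Real.exp (N y) := by
      rw [← Real.exp_add]; ring_nf
    have hT := gc_exp_taylor (l * (a y - A))
    have h8 : (l * (a y - A)) ^ 2 / 2 ≤ l ^ 2 * e ^ 2 / 2 * (∑ i, w i * (y i) ^ 2) +
        e ^ 3 * (l ^ 2 / 2 * (2 * K + K ^ 2) * (N y ^ 4 * Real.exp (|l| * N y))) := by
      have : (l * (a y - A)) ^ 2 / 2 = l ^ 2 / 2 * (a y - A) ^ 2 := by ring
      rw [this]
      calc _ ≤ l ^ 2 / 2 * (e ^ 2 * (∑ i, w i * (y i) ^ 2) +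
        e ^ 3 * ((2 * K + K ^ 2) * N y ^ 4)) := by gcongr
        _ = l ^ 2 * e ^ 2 / 2 * (∑ i, w i * (y i) ^ 2) +
          e ^ 3 * (l ^ 2 / 2 * (2 * K + K ^ 2) * (N y ^ 4 * 1)) := by ring
        _ ≤ _ := by gcongr
    have h9 : e ^ 3 * ((l ^ 2 / 2 * (2 * K + K ^ 2) + |l| ^ 3) *
        (N y ^ 4 * Real.exp (|l| * N y))) ≤ e ^ 3 * (B0 * Real.exp ((|l| + 1) * N y)) := by
      rw [hexpadd, hB0]
      have : (l ^ 2 / 2 * (2 * K + K ^ 2) + |l| ^ 3) * 24 *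
        (Real.exp (|l| * N y) * Real.exp (N y)) = (l ^ 2 / 2 * (2 * K + K ^ 2) + |l| ^ 3) *
        ((24 * Real.exp (N y)) * Real.exp (|l| * N y)) := by ring
      rw [this]
      gcongr
    have h10 : e ^ 3 * ((l ^ 2 / 2 * (2 * K + K ^ 2) + |l| ^ 3) *
        (N y ^ 4 * Real.exp (|l| * N y))) =
        e ^ 3 * (l ^ 2 / 2 * (2 * K + K ^ 2) * (N y ^ 4 * Real.exp (|l| * N y))) +
        e ^ 3 * (|l| ^ 3 * (N y ^ 4 * Real.exp (|l| * N y))) := by ring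
    linarith [hT, h8, h9, hcube, h10]
  have hIaA : Integrable (fun y => l * (a y - A)) ν := (haint.sub (integrable_const A)).const_mul l
  have hIall : Integrable (fun y => 1 + l * (a y - A) +
      l ^ 2 * e ^ 2 / 2 * (∑ i, w i * (y i) ^ 2)
        + e ^ 3 * (B0 * Real.exp ((|l| + 1) * N y))) ν :=
    (((integrable_const 1).add hIaA).add (hS2int.const_mul _)).add (hHint.const_mul _)
  have hmain : ∫ y, Real.exp (l * (a y - A)) ∂ν ≤
      1 + l ^ 2 * e ^ 2 / 2 + e ^ 3 * ∫ y, B0 * Real.exp ((|l| + 1) * N y) ∂ν := by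
    calc ∫ y, Real.exp (l * (a y - A)) ∂ν ≤ ∫ y, (1 + l * (a y - A) +
      l ^ 2 * e ^ 2 / 2 * (∑ i, w i * (y i) ^ 2)
        + e ^ 3 * (B0 * Real.exp ((|l| + 1) * N y))) ∂ν :=
          integral_mono_of_nonneg (by filter_upwards with y; positivity) hIall
            (by filter_upwards with y using hpt y)
      _ = 1 + l * (A - A) + l ^ 2 * e ^ 2 / 2 * (∫ y, ∑ i, w i * (y i) ^ 2 ∂ν) +
          e ^ 3 * ∫ y, B0 * Real.exp ((|l| + 1) * N y) ∂ν := by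
          have i1 : Integrable (fun y => 1 + l * (a y - A)) ν := (integrable_const 1).add hIaA
          have i2 : Integrable (fun y => 1 + l * (a y - A) +
            l ^ 2 * e ^ 2 / 2 * (∑ i, w i * (y i) ^ 2)) ν := i1.add (hS2int.const_mul _)
          rw [integral_add i2 (hHint.const_mul _), integral_add i1
            (hS2int.const_mul _), integral_add (integrable_const 1) hIaA,
            integral_const_mul, integral_const_mul, integral_const_mul,
            integral_sub haint (integrable_const A)]
          simp [hA]
      _ ≤ _ := by
          have : l ^ 2 * e ^ 2 / 2 * (∫ y, ∑ i, w i * (y i) ^ 2 ∂ν) ≤ l ^ 2 * e ^ 2 / 2 * 1 := by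
            gcongr
          linarith
  have hfint : ∫ y, f (x + e • y) ∂ν = f x + A := by
    have : ∀ y, f (x + e • y) = f x + a y := fun y => by simp [ha]
    simp_rw [this]
    rw [integral_add (integrable_const _) haint]; simp [hA]
  have hE : ∀ y, Real.exp (l * f (x + e • y)) =
      Real.exp (l * (f x + A)) * Real.exp (l * (a y - A)) := by
    intro y
    rw [← Real.exp_add]; congr 1; simp only [ha]; ring
  simp_rw [hE]
  rw [integral_const_mul, hfint, add_assoc, Real.exp_add]
  gcongr
  refine hmain.trans ?_
  have := Real.add_one_le_exp (l ^ 2 * e ^ 2 / 2 + e ^ 3 * ∫ y, B0 * Real.exp ((|l| + 1) * N y) ∂ν)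
  linarith

end conc

section conc2
variable {ι : Type} [Fintype ι]

theorem gc_integral_id (ν : Measure (ι → ℝ)) [IsGaussian ν] (hν0 : ∀ i, ∫ y, y i ∂ν = 0) :
    ∫ y, id y ∂ν = 0 := by
  funext i
  have hintg : Integrable (id : (ι → ℝ) → (ι → ℝ)) ν := IsGaussian.integrable_id
  have := (ContinuousLinearMap.proj (R := ℝ) (φ := fun _ : ι => ℝ) i).integral_comp_comm hintg
  simp only [ContinuousLinearMap.proj_apply, id] at this
  simp only [id]
  rw [← this, hν0 i]; rfl

theorem gc_rot (ν : Measure (ι → ℝ)) [IsGaussian ν] (hν0 : ∀ i, ∫ y, y i ∂ν = 0)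
    (a b : ℝ) (ha : 0 < a) (hb : 0 ≤ b) :
    (ν.prod ν).map (fun q => a • q.1 + b • q.2) = ν.map (fun y => Real.sqrt (a ^ 2 + b ^ 2) • y) := by
  set c := Real.sqrt (a ^ 2 + b ^ 2) with hc
  have hcpos : 0 < c := Real.sqrt_pos.mpr (by positivity)
  have hc2 : c ^ 2 = a ^ 2 + b ^ 2 := Real.sq_sqrt (by positivity)
  have hac : a ≤ c := by nlinarith [sq_nonneg b]
  set θ := Real.arccos (a / c) with hθ
  have hcos : Real.cos θ = a / c := Real.cos_arccos
    (by have : 0 ≤ a / c := by positivity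
        linarith) (by rw [div_le_one hcpos]; exact hac)
  have hsin : Real.sin θ = b / c := by
    rw [hθ, Real.sin_arccos]
    have : 1 - (a / c) ^ 2 = (b / c) ^ 2 := by
      field_simp; linarith
    rw [this, Real.sqrt_sq (by positivity)]
  have hrot := IsGaussian.map_rotation_eq_self (gc_integral_id ν hν0) θ
  have h1 : (fun q : (ι → ℝ) × (ι → ℝ) => a • q.1 + b • q.2) =
      (fun q : (ι → ℝ) × (ι → ℝ) => c • q.1) ∘ (ContinuousLinearMap.rotation θ) := by
    funext q
    simp only [Function.comp, ContinuousLinearMap.rotation_apply, hcos, hsin, smul_add, smul_smul]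
    congr 2 <;> field_simp
  rw [h1, ← Measure.map_map (by fun_prop) (by fun_prop), hrot]
  have h2 : (fun q : (ι → ℝ) × (ι → ℝ) => c • q.1) = (fun y => c • y) ∘ Prod.fst := rfl
  rw [h2, ← Measure.map_map (by fun_prop) (by fun_prop)]
  simp

theorem gc_semigroup (ν : Measure (ι → ℝ)) [IsGaussian ν] (hν0 : ∀ i, ∫ y, y i ∂ν = 0)
    (a b : ℝ) (ha : 0 < a) (hb : 0 ≤ b) (g : (ι → ℝ) → ℝ) (hg : Measurable g) (x : ι → ℝ)
    (hintg : Integrable (fun y => g (x + Real.sqrt (a ^ 2 + b ^ 2) • y)) ν) :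
    ∫ y, g (x + Real.sqrt (a ^ 2 + b ^ 2) • y) ∂ν = ∫ y, ∫ z, g (x + a • y + b • z) ∂ν ∂ν ∧
    Integrable (fun y => ∫ z, g (x + a • y + b • z) ∂ν) ν := by
  have hg' : Measurable (fun u => g (x + u)) := hg.comp (by fun_prop)
  have h1 : Integrable (fun u => g (x + u)) (ν.map (fun y => Real.sqrt (a ^ 2 + b ^ 2) • y)) :=
    (integrable_map_measure hg'.aestronglyMeasurable (by fun_prop)).mpr hintg
  rw [← gc_rot ν hν0 a b ha hb] at h1
  have h2 := (integrable_map_measure hg'.aestronglyMeasurable (by fun_prop)).mp h1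
  have h3 : Integrable (fun q : (ι → ℝ) × (ι → ℝ) => g (x + a • q.1 + b • q.2)) (ν.prod ν) := by
    refine h2.congr ?_
    filter_upwards with q
    simp [add_assoc]
  refine ⟨?_, h3.integral_prod_left⟩
  rw [← integral_prod _ h3]
  have h4 : ∫ y, g (x + Real.sqrt (a ^ 2 + b ^ 2) • y) ∂ν =
      ∫ u, g (x + u) ∂(ν.map (fun y => Real.sqrt (a ^ 2 + b ^ 2) • y)) :=
    (integral_map (by fun_prop) hg'.aestronglyMeasurable).symm
  rw [h4, ← gc_rot ν hν0 a b ha hb, integral_map (by fun_prop) hg'.aestronglyMeasurable]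
  simp [add_assoc]

theorem gc_lip_int (ν : Measure (ι → ℝ)) [IsGaussian ν] (F : (ι → ℝ) → ℝ) (hF : Measurable F)
    (hlip : ∀ x y, |F (x + y) - F x| ≤ ‖y‖) (x : ι → ℝ) (c : ℝ) :
    Integrable (fun y => F (x + c • y)) ν := by
  have hI1 : Integrable (fun y : ι → ℝ => ‖y‖) ν := by
    simpa using gc_integrable_norm_pow ν 1
  refine ((integrable_const |F x|).add (hI1.const_mul |c|)).mono'
    (hF.comp (by fun_prop)).aestronglyMeasurable ?_
  filter_upwards with y
  have := hlip x (c • y)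
  rw [norm_smul, Real.norm_eq_abs] at this
  have h2 := abs_sub_abs_le_abs_sub (F (x + c • y)) (F x)
  simp only [Real.norm_eq_abs, Pi.add_apply]
  linarith

theorem gc_lip_expint (ν : Measure (ι → ℝ)) [IsGaussian ν] (F : (ι → ℝ) → ℝ) (hF : Measurable F)
    (hlip : ∀ x y, |F (x + y) - F x| ≤ ‖y‖) (l : ℝ) (x : ι → ℝ) (c : ℝ) :
    Integrable (fun y => Real.exp (l * F (x + c • y))) ν := by
  refine ((gc_integrable_exp ν (|l| * |c|)).const_mul (Real.exp (|l| * |F x|))).mono'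
    (Real.measurable_exp.comp ((hF.comp (by fun_prop)).const_mul l)).aestronglyMeasurable ?_
  filter_upwards with y
  have := hlip x (c • y)
  rw [norm_smul, Real.norm_eq_abs] at this
  have h2 := abs_sub_abs_le_abs_sub (F (x + c • y)) (F x)
  rw [Real.norm_eq_abs, abs_of_pos (Real.exp_pos _), ← Real.exp_add]
  apply Real.exp_le_exp.mpr
  calc l * F (x + c • y) ≤ |l * F (x + c • y)| := le_abs_self _
    _ = |l| * |F (x + c • y)| := abs_mul _ _
    _ ≤ |l| * (|F x| + |c| * ‖y‖) := by gcongr; linarith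
    _ = _ := by ring

theorem gc_smooth_mgf (ν : Measure (ι → ℝ)) [IsGaussian ν]
    (hν0 : ∀ i, ∫ y, y i ∂ν = 0) (hν1 : ∀ i, ∫ y, (y i) ^ 2 ∂ν ≤ 1)
    (F : (ι → ℝ) → ℝ) (hF : Measurable F) (w : (ι → ℝ) → ι → ℝ) (hw : Measurable w)
    (hw0 : ∀ x i, 0 ≤ w x i) (hw1 : ∀ x, ∑ i, w x i = 1)
    (hlip : ∀ x y, |F (x + y) - F x| ≤ ‖y‖) (K : ℝ) (hK : 0 ≤ K)
    (hsec : ∀ x y, |F (x + y) - F x - ∑ i, w x i * y i| ≤ K * ‖y‖ ^ 2) (l : ℝ) :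
    ∫ y, Real.exp (l * F y) ∂ν ≤ Real.exp (l * (∫ y, F y ∂ν) + l ^ 2 / 2) := by
  obtain ⟨B, hB, hstep⟩ := gc_step ν hν0 hν1 l K hK
  have hwi : ∀ (x : ι → ℝ) (c : ℝ) i, Integrable (fun y => w (x + c • y) i) ν := by
    intro x c i
    refine (integrable_const (1 : ℝ)).mono' ?_ ?_
    · exact ((measurable_pi_apply i).comp (hw.comp (by fun_prop))).aestronglyMeasurable
    · filter_upwards with y
      rw [Real.norm_eq_abs, abs_of_nonneg (hw0 _ _), ← hw1 (x + c • y)]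
      exact Finset.single_le_sum (f := fun i => w (x + c • y) i)
        (fun i _ => hw0 _ i) (Finset.mem_univ i)
  have hUlip : ∀ (c : ℝ) (x y : ι → ℝ), |(∫ z, F (x + y + c • z) ∂ν) - ∫ z, F (x + c • z) ∂ν| ≤ ‖y‖ := by
    intro c x y
    rw [← integral_sub (gc_lip_int ν F hF hlip _ _) (gc_lip_int ν F hF hlip _ _)]
    refine abs_integral_le_integral_abs.trans ?_
    calc _ ≤ ∫ z, ‖y‖ ∂ν := by
          refine integral_mono ((gc_lip_int ν F hF hlip _ _).sub (gc_lip_int ν F hF hlip _ _)).abs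
            (integrable_const _) ?_
          intro z
          have := hlip (x + c • z) y
          simp only
          rwa [show x + y + c • z = x + c • z + y by abel]
      _ = ‖y‖ := by simp
  have hUmeas : ∀ c : ℝ, Measurable (fun x => ∫ z, F (x + c • z) ∂ν) := by
    intro c
    have : LipschitzWith 1 (fun x => ∫ z, F (x + c • z) ∂ν) := by
      refine LipschitzWith.of_dist_le_mul ?_
      intro u v
      have := hUlip c v (u - v)
      rw [show v + (u - v) = u by abel] at this
      rw [Real.dist_eq, dist_eq_norm]
      simpa using this
    exact this.continuous.measurable
  have hUsec : ∀ (c : ℝ) (x y : ι → ℝ), |(∫ z, F (x + y + c • z) ∂ν) - (∫ z, F (x + c • z) ∂ν) -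
      ∑ i, (∫ z, w (x + c • z) i ∂ν) * y i| ≤ K * ‖y‖ ^ 2 := by
    intro c x y
    have h1 : ∑ i, (∫ z, w (x + c • z) i ∂ν) * y i = ∫ z, ∑ i, w (x + c • z) i * y i ∂ν := by
      rw [integral_finsetSum _ fun i _ => (hwi x c i).mul_const _]
      simp [integral_mul_const]
    have h2 : Integrable (fun z => ∑ i, w (x + c • z) i * y i) ν :=
      integrable_finsetSum _ fun i _ => (hwi x c i).mul_const _
    have h3 : Integrable (fun z => F (x + y + c • z) - F (x + c • z)) ν :=
      (gc_lip_int ν F hF hlip (x + y) c).sub (gc_lip_int ν F hF hlip x c)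
    rw [h1, ← integral_sub (gc_lip_int ν F hF hlip _ _) (gc_lip_int ν F hF hlip _ _),
      ← integral_sub h3 h2]
    refine abs_integral_le_integral_abs.trans ?_
    calc _ ≤ ∫ z, K * ‖y‖ ^ 2 ∂ν := by
          refine integral_mono (h3.sub h2).abs (integrable_const _) ?_
          intro z
          have := hsec (x + c • z) y
          simp only
          rwa [show x + y + c • z = x + c • z + y by abel]
      _ = _ := by simp
  have hUw1 : ∀ (c : ℝ) (x : ι → ℝ), ∑ i, (∫ z, w (x + c • z) i ∂ν) = 1 := by
    intro c x
    rw [← integral_finsetSum _ fun i _ => hwi x c i]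
    simp [hw1]
  have key : ∀ N : ℕ, 0 < N → ∫ y, Real.exp (l * F y) ∂ν ≤
      Real.exp (l * (∫ y, F y ∂ν) + l ^ 2 / 2 + B * (1 / Real.sqrt N)) := by
    intro N hN
    set e : ℝ := 1 / Real.sqrt N with he
    have hNr : (1 : ℝ) ≤ N := by exact_mod_cast hN
    have hsN : 1 ≤ Real.sqrt N := Real.one_le_sqrt.mpr hNr
    have he0 : 0 < e := by positivity
    have he1 : e ≤ 1 := by rw [he, div_le_one (by positivity)]; exact hsN
    have hNe : N * e ^ 2 = 1 := by
      rw [he, div_pow, one_pow, Real.sq_sqrt (by positivity)]; field_simp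
    set δ := l ^ 2 * e ^ 2 / 2 + e ^ 3 * B with hδ
    have ind : ∀ j : ℕ, ∀ x, ∫ y, Real.exp (l * F (x + (Real.sqrt j * e) • y)) ∂ν ≤
        Real.exp (l * (∫ y, F (x + (Real.sqrt j * e) • y) ∂ν) + j * δ) := by
      intro j
      induction j with
      | zero => intro x; simp
      | succ j ih =>
        intro x
        have hcj : Real.sqrt ((j + 1 : ℕ) : ℝ) * e =
            Real.sqrt (e ^ 2 + (Real.sqrt j * e) ^ 2) := by
          rw [mul_pow, Real.sq_sqrt (by positivity)]
          have : e ^ 2 + j * e ^ 2 = ((j + 1 : ℕ) : ℝ) * e ^ 2 := by push_cast; ring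
          rw [this, Real.sqrt_mul (by positivity), Real.sqrt_sq he0.le]
        have hb : 0 ≤ Real.sqrt j * e := by positivity
        rw [hcj]
        obtain ⟨s1, i1⟩ := gc_semigroup ν hν0 e (Real.sqrt j * e) he0 hb
          (fun u => Real.exp (l * F u)) (by fun_prop) x (gc_lip_expint ν F hF hlip l x _)
        obtain ⟨s2, i2⟩ := gc_semigroup ν hν0 e (Real.sqrt j * e) he0 hb
          F hF x (gc_lip_int ν F hF hlip x _)
        rw [s1, s2]
        set U := fun x => ∫ z, F (x + (Real.sqrt j * e) • z) ∂ν with hU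
        have hUm : Measurable U := hUmeas _
        have hUl : ∀ x y, |U (x + y) - U x| ≤ ‖y‖ := fun x y => hUlip _ x y
        calc ∫ y, ∫ z, Real.exp (l * F (x + e • y + (Real.sqrt j * e) • z)) ∂ν ∂ν
            ≤ ∫ y, Real.exp (l * U (x + e • y)) * Real.exp (j * δ) ∂ν := by
              refine integral_mono i1 ((gc_lip_expint ν U hUm hUl l x e).mul_const _) ?_
              intro y
              simp only
              rw [← Real.exp_add]
              exact ih (x + e • y)
          _ = (∫ y, Real.exp (l * U (x + e • y)) ∂ν) * Real.exp (j * δ) := integral_mul_const _ _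
          _ ≤ Real.exp (l * (∫ y, U (x + e • y) ∂ν) + l ^ 2 * e ^ 2 / 2 + e ^ 3 * B) *
                Real.exp (j * δ) := by
              gcongr
              exact hstep U x (fun i => ∫ z, w (x + (Real.sqrt j * e) • z) i ∂ν) e hUm he0.le he1
                hUl (fun i => integral_nonneg fun _ => hw0 _ _) (hUw1 _ _)
                (fun y => hUsec _ x y)
          _ = _ := by
              rw [← Real.exp_add]
              congr 1
              simp only [hU, hδ]
              push_cast
              ring
    have h := ind N 0
    have hone : Real.sqrt N * e = 1 := by rw [he]; field_simp
    simp only [hone, one_smul, zero_add] at h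
    refine h.trans (le_of_eq ?_)
    congr 1
    rw [hδ]
    have : (N : ℝ) * (l ^ 2 * e ^ 2 / 2 + e ^ 3 * B) = (N * e ^ 2) * (l ^ 2 / 2) +
      (N * e ^ 2) * (B * e) := by ring
    rw [this, hNe]; ring
  have hlim : Filter.Tendsto (fun N : ℕ =>
      Real.exp (l * (∫ y, F y ∂ν) + l ^ 2 / 2 + B * (1 / Real.sqrt N))) Filter.atTop
      (nhds (Real.exp (l * (∫ y, F y ∂ν) + l ^ 2 / 2))) := by
    have h1 : Filter.Tendsto (fun N : ℕ => 1 / Real.sqrt (N : ℝ)) Filter.atTop (nhds 0) := by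
      simp only [one_div]
      exact (Real.tendsto_sqrt_atTop.comp tendsto_natCast_atTop_atTop).inv_tendsto_atTop
    have h2 := (h1.const_mul B).const_add (l * (∫ y, F y ∂ν) + l ^ 2 / 2)
    rw [mul_zero, add_zero] at h2
    exact (Real.continuous_exp.tendsto _).comp h2
  exact ge_of_tendsto hlim (Filter.eventually_atTop.mpr ⟨1, fun N hN => key N hN⟩)

end conc2

section conc3
variable {ι : Type} [Fintype ι] [Nonempty ι]

noncomputable def gcSum (b : ℝ) (x : ι → ℝ) : ℝ := ∑ i, Real.exp (b * x i)

noncomputable def gcSoft (b : ℝ) (x : ι → ℝ) : ℝ := b⁻¹ * Real.log (gcSum b x)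

theorem gcSum_pos (b : ℝ) (x : ι → ℝ) : 0 < gcSum b x :=
  Finset.sum_pos (fun i _ => Real.exp_pos _) Finset.univ_nonempty

theorem gcSum_cont (b : ℝ) : Continuous (gcSum b : (ι → ℝ) → ℝ) := by
  unfold gcSum; fun_prop

theorem gcSoft_le (b : ℝ) (hb : 0 < b) (x y : ι → ℝ) :
    gcSoft b (x + y) ≤ gcSoft b x + ‖y‖ := by
  have h : gcSum b (x + y) ≤ Real.exp (b * ‖y‖) * gcSum b x := by
    unfold gcSum
    rw [Finset.mul_sum]
    apply Finset.sum_le_sum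
    intro i _
    rw [← Real.exp_add]
    apply Real.exp_le_exp.mpr
    have := (le_abs_self (y i)).trans (norm_le_pi_norm y i)
    simp only [Pi.add_apply]
    nlinarith
  have h2 := Real.log_le_log (gcSum_pos b (x + y)) h
  rw [Real.log_mul (Real.exp_pos _).ne' (gcSum_pos b x).ne', Real.log_exp] at h2
  unfold gcSoft
  calc b⁻¹ * Real.log (gcSum b (x + y)) ≤ b⁻¹ * (b * ‖y‖ + Real.log (gcSum b x)) := by gcongr
    _ = _ := by field_simp; ring

theorem gcSoft_lip (b : ℝ) (hb : 0 < b) (x y : ι → ℝ) :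
    |gcSoft b (x + y) - gcSoft b x| ≤ ‖y‖ := by
  have h1 := gcSoft_le b hb x y
  have h2 := gcSoft_le b hb (x + y) (-y)
  rw [show x + y + -y = x by abel, norm_neg] at h2
  rw [abs_le]; constructor <;> linarith

theorem gcSoft_sec (b : ℝ) (hb : 0 < b) (x y : ι → ℝ) :
    |gcSoft b (x + y) - gcSoft b x - ∑ i, (Real.exp (b * x i) / gcSum b x) * y i|
      ≤ 2 * b * ‖y‖ ^ 2 := by
  set w : ι → ℝ := fun i => Real.exp (b * x i) / gcSum b x with hw
  have hS := gcSum_pos b x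
  have hw0 : ∀ i, 0 ≤ w i := fun i => by positivity
  have hw1 : ∑ i, w i = 1 := by
    simp only [hw]
    rw [← Finset.sum_div]
    exact div_self hS.ne'
  set Sy := ∑ i, w i * Real.exp (b * y i) with hSy
  have hratio : gcSum b (x + y) = gcSum b x * Sy := by
    rw [hSy, Finset.mul_sum]
    unfold gcSum
    apply Finset.sum_congr rfl
    intro i _
    simp only [hw, Pi.add_apply]
    rw [mul_add, Real.exp_add]
    have := hS.ne'
    field_simp
    rfl
  have hSypos : 0 < Sy := by
    have := gcSum_pos b (x + y)
    rw [hratio] at this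
    exact (pos_iff_pos_of_mul_pos this).mp hS
  have hdiff : gcSoft b (x + y) - gcSoft b x = b⁻¹ * Real.log Sy := by
    unfold gcSoft
    rw [hratio, Real.log_mul hS.ne' hSypos.ne']; ring
  have hlow : b * ∑ i, w i * y i ≤ Real.log Sy := by
    rw [Real.le_log_iff_exp_le hSypos]
    have h := convexOn_exp.map_sum_le (t := Finset.univ) (w := w) (p := fun i => b * y i)
      (fun i _ => hw0 i) hw1 (fun i _ => Set.mem_univ _)
    simp only [smul_eq_mul] at h
    refine le_trans (le_of_eq ?_) h
    congr 1
    rw [Finset.mul_sum]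
    exact Finset.sum_congr rfl fun i _ => by ring
  have hynn := norm_nonneg y
  by_cases hy : b * ‖y‖ ≤ 1
  · have hup : Real.log Sy ≤ b * (∑ i, w i * y i) + b ^ 2 * ‖y‖ ^ 2 := by
      have h1 : Sy ≤ 1 + b * (∑ i, w i * y i) + b ^ 2 * ‖y‖ ^ 2 := by
        calc Sy ≤ ∑ i, w i * (1 + b * y i + b ^ 2 * ‖y‖ ^ 2) := by
              apply Finset.sum_le_sum
              intro i _
              apply mul_le_mul_of_nonneg_left _ (hw0 i)
              have hyi : |y i| ≤ ‖y‖ := norm_le_pi_norm y i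
              have hz : |b * y i| ≤ 1 := by
                rw [abs_mul, abs_of_pos hb]
                exact (mul_le_mul_of_nonneg_left hyi hb.le).trans hy
              have := Real.abs_exp_sub_one_sub_id_le hz
              have h3 := (abs_le.mp this).2
              have h4 : (b * y i) ^ 2 ≤ b ^ 2 * ‖y‖ ^ 2 := by
                rw [mul_pow, ← sq_abs (y i)]; gcongr
              linarith
          _ = (∑ i, w i) * (1 + b ^ 2 * ‖y‖ ^ 2) + b * ∑ i, w i * y i := by
              rw [Finset.sum_mul, Finset.mul_sum, ← Finset.sum_add_distrib]
              exact Finset.sum_congr rfl fun i _ => by ring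
          _ = _ := by rw [hw1]; ring
      have h2 := Real.log_le_sub_one_of_pos hSypos
      linarith
    rw [hdiff, abs_le]
    have e1 : b⁻¹ * (b * ∑ i, w i * y i) = ∑ i, w i * y i := by field_simp
    constructor
    · have : b⁻¹ * (b * ∑ i, w i * y i) ≤ b⁻¹ * Real.log Sy := by gcongr
      have h5 : 0 ≤ 2 * b * ‖y‖ ^ 2 := by positivity
      linarith
    · have : b⁻¹ * Real.log Sy ≤ b⁻¹ * (b * (∑ i, w i * y i) + b ^ 2 * ‖y‖ ^ 2) := by gcongr
      have e2 : b⁻¹ * (b * (∑ i, w i * y i) + b ^ 2 * ‖y‖ ^ 2) =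
        (∑ i, w i * y i) + b * ‖y‖ ^ 2 := by field_simp
      have h5 : 0 ≤ b * ‖y‖ ^ 2 := by positivity
      linarith
  · push Not at hy
    have h1 := gcSoft_lip b hb x y
    have h2 := gc_lin_bound w hw0 hw1 y
    have h3 := abs_sub (gcSoft b (x + y) - gcSoft b x) (∑ i, w i * y i)
    nlinarith

theorem gc_max_le_soft (b : ℝ) (hb : 0 < b) (x : ι → ℝ) : ⨆ i, x i ≤ gcSoft b x := by
  apply ciSup_le
  intro i
  have h : Real.exp (b * x i) ≤ gcSum b x :=
    Finset.single_le_sum (f := fun i => Real.exp (b * x i)) (fun i _ => (Real.exp_pos _).le)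
      (Finset.mem_univ i)
  have := (Real.le_log_iff_exp_le (gcSum_pos b x)).mpr h
  unfold gcSoft
  calc x i = b⁻¹ * (b * x i) := by field_simp
    _ ≤ _ := by gcongr

theorem gc_soft_le_max (b : ℝ) (hb : 0 < b) (x : ι → ℝ) :
    gcSoft b x ≤ (⨆ i, x i) + b⁻¹ * Real.log (Fintype.card ι) := by
  have h : gcSum b x ≤ Fintype.card ι * Real.exp (b * ⨆ i, x i) := by
    unfold gcSum
    calc _ ≤ ∑ i : ι, Real.exp (b * ⨆ i, x i) := by
          apply Finset.sum_le_sum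
          intro i _
          gcongr
          exact le_ciSup (Set.finite_range x).bddAbove i
      _ = _ := by simp
  have h2 := Real.log_le_log (gcSum_pos b x) h
  rw [Real.log_mul (by simp) (Real.exp_pos _).ne', Real.log_exp] at h2
  unfold gcSoft
  calc _ ≤ b⁻¹ * (Real.log (Fintype.card ι) + b * ⨆ i, x i) := by gcongr
    _ = _ := by field_simp; ring

theorem gc_max_meas : Measurable (fun y : ι → ℝ => ⨆ i, y i) :=
  Measurable.iSup fun i => measurable_pi_apply i

theorem gc_max_lip (x y : ι → ℝ) : |(⨆ i, (x + y) i) - ⨆ i, x i| ≤ ‖y‖ := by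
  have key : ∀ x y : ι → ℝ, (⨆ i, (x + y) i) ≤ (⨆ i, x i) + ‖y‖ := by
    intro x y
    apply ciSup_le
    intro i
    have h1 := (le_abs_self (y i)).trans (norm_le_pi_norm y i)
    have h2 := le_ciSup (Set.finite_range x).bddAbove i
    simp only [Pi.add_apply]
    linarith
  have h1 := key x y
  have h2 := key (x + y) (-y)
  rw [show x + y + -y = x by abel, norm_neg] at h2
  rw [abs_le]; constructor <;> linarith

theorem gc_max_subG (ν : Measure (ι → ℝ)) [IsGaussian ν]
    (hν0 : ∀ i, ∫ y, y i ∂ν = 0) (hν1 : ∀ i, ∫ y, (y i) ^ 2 ∂ν ≤ 1) :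
    Integrable (fun y : ι → ℝ => ⨆ i, y i) ν ∧
    HasSubgaussianMGF (fun y : ι → ℝ => (⨆ i, y i) - ∫ z, (⨆ i, z i) ∂ν) 1 ν := by
  have hMint : Integrable (fun y : ι → ℝ => ⨆ i, y i) ν := by
    simpa using gc_lip_int ν _ gc_max_meas gc_max_lip 0 1
  have hMexp : ∀ l, Integrable (fun y : ι → ℝ => Real.exp (l * ⨆ i, y i)) ν := by
    intro l
    simpa using gc_lip_expint ν _ gc_max_meas gc_max_lip l 0 1
  refine ⟨hMint, ⟨?_, ?_⟩⟩
  · intro l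
    have := (hMexp l).mul_const (Real.exp (-(l * ∫ z, (⨆ i, z i) ∂ν)))
    refine this.congr ?_
    filter_upwards with y
    rw [← Real.exp_add]; ring_nf
  intro l
  set m := ∫ z : ι → ℝ, (⨆ i, z i) ∂ν with hm
  set g := Real.log (Fintype.card ι) with hg
  have hg0 : 0 ≤ g := Real.log_natCast_nonneg _
  have key : ∀ n : ℕ, 0 < n → mgf (fun y : ι → ℝ => (⨆ i, y i) - m) ν l ≤
      Real.exp (l ^ 2 / 2 + |l| * (2 * ((n : ℝ)⁻¹ * g))) := by
    intro n hn
    have hb : (0 : ℝ) < n := by exact_mod_cast hn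
    have hFm : Measurable (gcSoft (n : ℝ) : (ι → ℝ) → ℝ) := by
      unfold gcSoft
      exact ((Real.measurable_log.comp (gcSum_cont _).measurable).const_mul _)
    have hmgf := gc_smooth_mgf ν hν0 hν1 (gcSoft (n : ℝ)) hFm
      (fun x i => Real.exp (n * x i) / gcSum (n : ℝ) x)
      (by
        apply measurable_pi_lambda
        intro i
        apply Measurable.div
        · fun_prop
        · exact (gcSum_cont _).measurable)
      (fun x i => by have := gcSum_pos (n : ℝ) x; positivity)
      (fun x => by
        rw [← Finset.sum_div]
        exact div_self (gcSum_pos (n : ℝ) x).ne')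
      (gcSoft_lip _ hb) (2 * n) (by positivity) (gcSoft_sec _ hb) l
    have hFint : Integrable (gcSoft (n : ℝ) : (ι → ℝ) → ℝ) ν := by
      simpa using gc_lip_int ν _ hFm (gcSoft_lip _ hb) 0 1
    have hFexp : Integrable (fun y : ι → ℝ => Real.exp (l * gcSoft (n : ℝ) y)) ν := by
      simpa using gc_lip_expint ν _ hFm (gcSoft_lip _ hb) l 0 1
    set d := (n : ℝ)⁻¹ * g with hd
    have hd0 : 0 ≤ d := by positivity
    set mF := ∫ y : ι → ℝ, gcSoft (n : ℝ) y ∂ν with hmF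
    have h1 : m ≤ mF := integral_mono hMint hFint fun y => gc_max_le_soft _ hb y
    have h2 : mF ≤ m + d := by
      calc mF ≤ ∫ y : ι → ℝ, ((⨆ i, y i) + d) ∂ν :=
            integral_mono hFint (hMint.add (integrable_const _)) fun y => gc_soft_le_max _ hb y
        _ = m + d := by rw [integral_add hMint (integrable_const _)]; simp [hm]
    have hpt : ∀ y : ι → ℝ, Real.exp (l * ((⨆ i, y i) - m)) ≤
        Real.exp (l * gcSoft (n : ℝ) y) * Real.exp (-(l * mF) + |l| * (2 * d)) := by
      intro y
      rw [← Real.exp_add]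
      apply Real.exp_le_exp.mpr
      have h3 := gc_max_le_soft _ hb y
      have h4 := gc_soft_le_max _ hb y
      have h5 : l * (((⨆ i, y i) - m) - (gcSoft (n : ℝ) y - mF)) ≤ |l| * (2 * d) := by
        refine (le_abs_self _).trans ?_
        rw [abs_mul]
        gcongr
        rw [abs_le]; constructor <;> linarith
      linarith
    calc mgf (fun y : ι → ℝ => (⨆ i, y i) - m) ν l
        = ∫ y : ι → ℝ, Real.exp (l * ((⨆ i, y i) - m)) ∂ν := rfl
      _ ≤ ∫ y : ι → ℝ, Real.exp (l * gcSoft (n : ℝ) y) *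
            Real.exp (-(l * mF) + |l| * (2 * d)) ∂ν :=
          integral_mono_of_nonneg (by filter_upwards with y; positivity)
            (hFexp.mul_const _) (by filter_upwards with y using hpt y)
      _ = (∫ y : ι → ℝ, Real.exp (l * gcSoft (n : ℝ) y) ∂ν) *
            Real.exp (-(l * mF) + |l| * (2 * d)) := integral_mul_const _ _
      _ ≤ Real.exp (l * mF + l ^ 2 / 2) * Real.exp (-(l * mF) + |l| * (2 * d)) := by gcongr
      _ = _ := by rw [← Real.exp_add]; ring_nf
  have hlim : Filter.Tendsto (fun n : ℕ =>
      Real.exp (l ^ 2 / 2 + |l| * (2 * ((n : ℝ)⁻¹ * g)))) Filter.atTop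
      (nhds (Real.exp (l ^ 2 / 2))) := by
    have h1 : Filter.Tendsto (fun n : ℕ => (n : ℝ)⁻¹) Filter.atTop (nhds 0) :=
      tendsto_inv_atTop_nhds_zero_nat
    have h2 := (((h1.mul_const g).const_mul 2).const_mul |l|).const_add (l ^ 2 / 2)
    simp only [zero_mul, mul_zero, add_zero] at h2
    exact (Real.continuous_exp.tendsto _).comp h2
  simp only [NNReal.coe_one, one_mul]
  exact ge_of_tendsto hlim (Filter.eventually_atTop.mpr ⟨1, fun n hn => key n hn⟩)

end conc3

section conc4

theorem gc_fin_max {Ω' : Type*} [MeasurableSpace Ω'] (P : Measure Ω')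
    (W : ℕ → Ω' → ℝ) (hG : IsGaussianProcess W P)
    (h0 : ∀ i, ∫ ω, W i ω ∂P = 0) (h1 : ∀ i, ∫ ω, (W i ω) ^ 2 ∂P ≤ 1) (k : ℕ) :
    Integrable (fun ω => ⨆ i : Fin (k + 1), W i ω) P ∧
      HasSubgaussianMGF (fun ω => (⨆ i : Fin (k + 1), W i ω) -
        ∫ z, (⨆ i : Fin (k + 1), W i z) ∂P) 1 P := by
  have hL : HasGaussianLaw (fun ω (i : Fin (k + 1)) => W i ω) P :=
    (hG.hasGaussianLaw (Finset.range (k + 1))).map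
      (ContinuousLinearMap.pi fun i : Fin (k + 1) => ContinuousLinearMap.proj
        (R := ℝ) (φ := fun _ : Finset.range (k + 1) => ℝ) ⟨(i : ℕ), Finset.mem_range.mpr i.2⟩)
  have hA : AEMeasurable (fun ω (i : Fin (k + 1)) => W i ω) P := hL.aemeasurable
  set ν := P.map (fun ω (i : Fin (k + 1)) => W i ω) with hν
  have : IsGaussian ν := hL.isGaussian_map
  have key := gc_max_subG ν
    (fun i => by
      rw [hν, integral_map hA (by exact (measurable_pi_apply i).aestronglyMeasurable)]; exact h0 i)
    (fun i => by
      rw [hν, integral_map hA (by exact ((measurable_pi_apply i).pow_const 2).aestronglyMeasurable)]; exact h1 i)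
  have hsm : AEStronglyMeasurable (fun y : Fin (k + 1) → ℝ => ⨆ i, y i) ν := key.1.1
  have he : ∫ z, (⨆ i, z i) ∂ν = ∫ z, (⨆ i : Fin (k + 1), W i z) ∂P := by
    rw [hν, integral_map hA hsm]
  refine ⟨(integrable_map_measure hsm hA).mp key.1, ?_⟩
  have := HasSubgaussianMGF.of_map hA key.2
  rw [he] at this
  exact this

theorem gc_borell {Ω' : Type*} [MeasurableSpace Ω'] (P : Measure Ω') [IsProbabilityMeasure P]
    {ι : Type*} [Countable ι] [Nonempty ι] (V : ι → Ω' → ℝ) (hG : IsGaussianProcess V P)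
    (hVm : ∀ i, Measurable (V i))
    (h0 : ∀ i, ∫ ω, V i ω ∂P = 0) (h1 : ∀ i, ∫ ω, (V i ω) ^ 2 ∂P ≤ 1)
    (c : ℝ) (hc : ∫ ω, (⨆ i, V i ω) ∂P ≤ c) (t : ℝ) (ht : 0 < t) :
    P {ω | c + t < ⨆ i, V i ω} ≤ ENNReal.ofReal (Real.exp (-t ^ 2 / 2)) := by
  obtain ⟨f, hf⟩ := exists_surjective_nat ι
  have hre : ∀ ω, ⨆ i, V i ω = ⨆ n, V (f n) ω := fun ω =>
    (hf.iSup_comp (fun i => V i ω)).symm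
  simp only [hre] at hc ⊢
  set W : ℕ → Ω' → ℝ := fun n => V (f n) with hW
  have hWG : IsGaussianProcess W P := hG.comp_right f
  have hWm : ∀ n, Measurable (W n) := fun n => hVm _
  set M : ℕ → Ω' → ℝ := fun k ω => ⨆ i : Fin (k + 1), W i ω with hM
  set S : Ω' → ℝ := fun ω => ⨆ n, W n ω with hS
  have hfin : ∀ k, Integrable (M k) P ∧ HasSubgaussianMGF (fun ω => M k ω - ∫ z, M k z ∂P) 1 P :=
    fun k => gc_fin_max P W hWG (fun i => h0 _) (fun i => h1 _) k
  have hWM : ∀ k n ω, n ≤ k → W n ω ≤ M k ω := by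
    intro k n ω hn
    exact le_ciSup (f := fun i : Fin (k + 1) => W i ω) (Set.finite_range _).bddAbove
      ⟨n, Nat.lt_succ_of_le hn⟩
  have hMle : ∀ k ω b, (∀ n, n ≤ k → W n ω ≤ b) → M k ω ≤ b := fun k ω b h =>
    ciSup_le fun i => h i (Nat.le_of_lt_succ i.2)
  have hMmono : ∀ ω, Monotone fun k => M k ω := fun ω a b hab =>
    hMle a ω _ fun n hn => hWM b n ω (hn.trans hab)
  have hSm : Measurable S := Measurable.iSup hWm
  by_cases hB : ∃ B, ∀ k, ∫ ω, M k ω ∂P ≤ B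
  · obtain ⟨B, hB⟩ := hB
    have hlin : ∫⁻ ω, ⨆ k, ENNReal.ofReal (M k ω - M 0 ω) ∂P ≤ ENNReal.ofReal (B - ∫ ω, M 0 ω ∂P) := by
      rw [lintegral_iSup']
      · apply iSup_le
        intro k
        have hi : Integrable (fun ω => M k ω - M 0 ω) P := (hfin k).1.sub (hfin 0).1
        rw [← ofReal_integral_eq_lintegral_ofReal hi
          (by filter_upwards with ω using sub_nonneg.mpr (hMmono ω (Nat.zero_le k)))]
        apply ENNReal.ofReal_le_ofReal
        rw [integral_sub (hfin k).1 (hfin 0).1]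
        linarith [hB k]
      · intro k
        exact ((hfin k).1.sub (hfin 0).1).1.aemeasurable.ennreal_ofReal
      · filter_upwards with ω a b hab
        exact ENNReal.ofReal_le_ofReal (sub_le_sub_right (hMmono ω hab) _)
    have hltop : ∫⁻ ω, ⨆ k, ENNReal.ofReal (M k ω - M 0 ω) ∂P < ⊤ :=
      hlin.trans_lt ENNReal.ofReal_lt_top
    have hfinae : ∀ᵐ ω ∂P, ⨆ k, ENNReal.ofReal (M k ω - M 0 ω) < ⊤ := by
      apply ae_lt_top' _ hltop.ne
      exact AEMeasurable.iSup fun k => ((hfin k).1.sub (hfin 0).1).1.aemeasurable.ennreal_ofReal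
    have hbdd : ∀ᵐ ω ∂P, BddAbove (Set.range fun n => W n ω) ∧
        ENNReal.ofReal (S ω - M 0 ω) ≤ ⨆ k, ENNReal.ofReal (M k ω - M 0 ω) := by
      filter_upwards [hfinae] with ω hω
      set L := ⨆ k, ENNReal.ofReal (M k ω - M 0 ω) with hL
      have hk : ∀ k, M k ω ≤ M 0 ω + L.toReal := by
        intro k
        have := ENNReal.ofReal_le_iff_le_toReal hω.ne |>.mp
          (le_iSup (fun k => ENNReal.ofReal (M k ω - M 0 ω)) k)
        linarith
      refine ⟨⟨M 0 ω + L.toReal, ?_⟩, ?_⟩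
      · rintro _ ⟨n, rfl⟩
        exact (hWM n n ω le_rfl).trans (hk n)
      · rw [ENNReal.ofReal_le_iff_le_toReal hω.ne]
        have : S ω ≤ M 0 ω + L.toReal := ciSup_le fun n => (hWM n n ω le_rfl).trans (hk n)
        linarith
    have hMS : ∀ k, ∀ᵐ ω ∂P, M k ω ≤ S ω := by
      intro k
      filter_upwards [hbdd] with ω hω
      exact hMle k ω _ fun n _ => le_ciSup hω.1 n
    have hSint : Integrable S P := by
      have : Integrable (fun ω => S ω - M 0 ω) P := by
        refine ⟨(hSm.aestronglyMeasurable.sub (hfin 0).1.1), ?_⟩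
        refine lt_of_le_of_lt (lintegral_mono_ae ?_) hltop
        filter_upwards [hbdd, hMS 0] with ω hω h2
        refine le_trans (le_of_eq ?_) hω.2
        rw [Real.enorm_eq_ofReal (sub_nonneg.mpr h2)]
      refine (this.add (hfin 0).1).congr ?_
      filter_upwards with ω
      simp
    have hEM : ∀ k, ∫ ω, M k ω ∂P ≤ c := fun k =>
      (integral_mono_ae (hfin k).1 hSint (hMS k)).trans hc
    have hsub : {ω | c + t < S ω} ⊆ ⋃ k, {ω | c + t < M k ω} := by
      intro ω hω
      obtain ⟨n, hn⟩ := exists_lt_of_lt_ciSup (show c + t < ⨆ n, W n ω from hω)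
      exact Set.mem_iUnion.mpr ⟨n, hn.trans_le (hWM n n ω le_rfl)⟩
    refine (measure_mono hsub).trans ?_
    have hmo : Monotone fun k => {ω | c + t < M k ω} :=
      fun a b hab ω hω => lt_of_lt_of_le (show c + t < M a ω from hω) (hMmono ω hab)
    rw [hmo.measure_iUnion]
    apply iSup_le
    intro k
    have h2 := (hfin k).2.measure_ge_le ht.le
    rw [NNReal.coe_one, mul_one] at h2
    refine le_trans (measure_mono ?_) ((ENNReal.le_ofReal_iff_toReal_le (measure_ne_top _ _)
      (Real.exp_pos _).le).mpr h2)
    intro ω hω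
    have h3 : c + t < M k ω := hω
    show t ≤ M k ω - ∫ z, M k z ∂P
    linarith [hEM k]
  · push Not at hB
    have hnull : ∀ N : ℕ, P {ω | ∀ n, W n ω ≤ N} = 0 := by
      intro N
      have hle : ∀ s : ℕ, P.real {ω | ∀ n, W n ω ≤ N} ≤ Real.exp (-(s : ℝ) ^ 2 / 2) := by
        intro s
        obtain ⟨k, hk⟩ := hB (N + s)
        have h2 := (hfin k).2.neg.measure_ge_le (Nat.cast_nonneg s)
        rw [NNReal.coe_one, mul_one] at h2
        refine le_trans (measureReal_mono ?_ (measure_ne_top _ _)) h2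
        intro ω hω
        have := hMle k ω N fun n _ => hω n
        show (s : ℝ) ≤ -(M k ω - ∫ z, M k z ∂P)
        linarith
      have hlim : Filter.Tendsto (fun s : ℕ => Real.exp (-(s : ℝ) ^ 2 / 2)) Filter.atTop (nhds 0) := by
        apply Real.tendsto_exp_atBot.comp
        have h5 : Filter.Tendsto (fun s : ℕ => (s : ℝ) ^ 2 / 2) Filter.atTop Filter.atTop :=
          ((Filter.tendsto_pow_atTop two_ne_zero).comp
            tendsto_natCast_atTop_atTop).atTop_div_const (by norm_num)
        refine (Filter.tendsto_neg_atTop_atBot.comp h5).congr fun s => ?_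
        simp only [Function.comp]; ring
      have := ge_of_tendsto' hlim hle
      exact (measureReal_eq_zero_iff).mp (le_antisymm this measureReal_nonneg)
    have hS0 : ∀ᵐ ω ∂P, S ω = 0 := by
      have : ∀ᵐ ω ∂P, ∀ N : ℕ, ¬ ∀ n, W n ω ≤ N := by
        rw [ae_all_iff]
        intro N
        rw [ae_iff]
        simpa using hnull N
      filter_upwards [this] with ω hω
      apply Real.iSup_of_not_bddAbove
      rintro ⟨b, hb⟩
      obtain ⟨N, hN⟩ := exists_nat_ge b
      exact hω N fun n => (hb ⟨n, rfl⟩).trans hN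
    have hc0 : 0 ≤ c := by
      rw [integral_congr_ae hS0] at hc
      simpa using hc
    have : P {ω | c + t < S ω} = 0 := by
      rw [measure_eq_zero_iff_ae_notMem]
      filter_upwards [hS0] with ω hω h3
      have : c + t < S ω := h3
      linarith
    rw [this]; exact zero_le

end conc4

section kern5

theorem ker_spec {p : ℕ} {Ψ Ψt : EuclideanSpace ℝ (Fin p) → ℝ} (h : IsSpectralDensity Ψ Ψt) :
    Ψ 0 = 1 ∧ (∀ x, Ψ (-x) = Ψ x) ∧ Continuous Ψ ∧ ∀ x, |Ψ x| ≤ 1 := by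
  obtain ⟨h1, h2, h3, h4⟩ := h
  have hb : ∀ v ω, ‖Real.cos ⟪ω, v⟫ * Ψt ω‖ ≤ Ψt ω := by
    intro v ω
    rw [norm_mul, Real.norm_eq_abs, Real.norm_eq_abs, abs_of_nonneg (h1 ω)]
    calc _ ≤ 1 * Ψt ω := by gcongr; exacts [h1 ω, Real.abs_cos_le_one _]
      _ = _ := one_mul _
  refine ⟨?_, ?_, ?_, ?_⟩
  · rw [h4]; simpa using h3
  · intro x; rw [h4, h4]; simp
  · have : Ψ = fun v => ∫ ω, Real.cos ⟪ω, v⟫ * Ψt ω := funext h4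
    rw [this]
    apply continuous_of_dominated (bound := Ψt)
    · intro v
      apply AEStronglyMeasurable.mul _ h2.1
      exact Continuous.aestronglyMeasurable (by fun_prop)
    · intro v; filter_upwards with ω using hb v ω
    · exact h2
    · filter_upwards with ω; fun_prop
  · intro x
    rw [h4, ← h3, ← Real.norm_eq_abs]
    exact norm_integral_le_of_norm_le h2 (by filter_upwards with ω using hb x ω)

theorem gp_lin {Ω' T S : Type*} [MeasurableSpace Ω'] {P : Measure Ω'} {Z : T → Ω' → ℝ}
    (hZ : IsGaussianProcess Z P) (Y : S → Ω' → ℝ)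
    (h : ∀ s, ∃ (n : ℕ) (a : Fin n → ℝ) (x : Fin n → T), ∀ ω, Y s ω = ∑ k, a k * Z (x k) ω) :
    IsGaussianProcess Y P := by
  classical
  refine hZ.of_isGaussianProcess fun s => ?_
  obtain ⟨n, a, x, hx⟩ := h s
  refine ⟨Finset.univ.image x, ∑ k, a k • ContinuousLinearMap.proj
    (R := ℝ) (φ := fun _ : Finset.univ.image x => ℝ) ⟨x k, by simp⟩, fun ω => ?_⟩
  rw [hx]
  simp

section gc
variable {p : ℕ} {Ω' : Type*} [MeasurableSpace Ω'] {P : Measure Ω'} [IsProbabilityMeasure P]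
  {Z : EuclideanSpace ℝ (Fin p) → Ω' → ℝ} {σ : ℝ} {Ψ : EuclideanSpace ℝ (Fin p) → ℝ}

theorem gp_of_gauss (hZm : ∀ x, Measurable (Z x)) (hg : GaussCov P Z σ Ψ) :
    IsGaussianProcess Z P := by
  refine ⟨fun I => ⟨?_⟩⟩
  have hm : Measurable (fun ω => I.restrict (Z · ω)) :=
    measurable_pi_lambda _ fun i => hZm i
  apply isGaussian_of_map_eq_gaussianReal
  intro L
  let e := I.equivFin
  have hG := hg I.card (fun i => L (Pi.single (e.symm i) 1)) (fun i => (e.symm i : _))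
  refine ⟨0, _, Eq.trans ?_ hG⟩
  rw [Measure.map_map (by fun_prop) hm]
  congr 1
  ext ω
  simp only [Function.comp]
  rw [e.symm.sum_comp (fun i : I => L (Pi.single i 1) * Z i ω)]
  conv_lhs => rw [pi_eq_sum_univ' (I.restrict (Z · ω))]
  rw [map_sum]
  apply Finset.sum_congr rfl
  intro i _
  rw [map_smul, smul_eq_mul, mul_comm]
  congr 2

theorem gauss_mom {f : Ω' → ℝ} {v : NNReal} (hf : Measurable f)
    (h : P.map f = gaussianReal 0 v) :
    MemLp f 2 P ∧ ∫ ω, f ω ∂P = 0 ∧ ∫ ω, f ω ^ 2 ∂P = v := by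
  have hi : ∫ x, x ∂(gaussianReal 0 v) = 0 := by simp
  refine ⟨?_, ?_, ?_⟩
  · have : MemLp id 2 (P.map f) := by rw [h]; exact memLp_id_gaussianReal 2
    exact (memLp_map_measure_iff (by fun_prop) hf.aemeasurable).mp this
  · rw [← hi, ← h, integral_map hf.aemeasurable (by fun_prop)]
  · have h2 : ∫ x, x ^ 2 ∂(gaussianReal 0 v) = v := by
      have := variance_of_integral_eq_zero (X := fun x : ℝ => x) (μ := gaussianReal 0 v)
        (by fun_prop) hi
      rw [← this]; simp
    rw [← h2, ← h, integral_map hf.aemeasurable (by fun_prop)]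

theorem sq_expand {f g : Ω' → ℝ} (hf : MemLp f 2 P) (hg : MemLp g 2 P) :
    ∫ ω, (f ω + g ω) ^ 2 ∂P = ∫ ω, f ω ^ 2 ∂P + 2 * ∫ ω, f ω * g ω ∂P + ∫ ω, g ω ^ 2 ∂P := by
  have ix := hf.integrable_sq
  have iy := hg.integrable_sq
  have ixy : Integrable (fun ω => 2 * (f ω * g ω)) P := (hf.integrable_mul hg).const_mul 2
  have i2 : Integrable (fun ω => f ω ^ 2 + 2 * (f ω * g ω)) P := ix.add ixy
  rw [← integral_const_mul, ← integral_add ix ixy, ← integral_add i2 iy]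
  congr 1; ext ω; ring

theorem gauss_cov (hσ : 0 < σ) (hΨ0 : Ψ 0 = 1) (hΨs : ∀ x, Ψ (-x) = Ψ x) (hΨb : ∀ x, |Ψ x| ≤ 1)
    (hZm : ∀ x, Measurable (Z x)) (hg : GaussCov P Z σ Ψ) :
    (∀ x, MemLp (Z x) 2 P) ∧ (∀ x, ∫ ω, Z x ω ∂P = 0) ∧
      ∀ x y, ∫ ω, Z x ω * Z y ω ∂P = σ ^ 2 * Ψ (x - y) := by
  have h1 : ∀ x, MemLp (Z x) 2 P ∧ ∫ ω, Z x ω ∂P = 0 ∧ ∫ ω, Z x ω ^ 2 ∂P = σ ^ 2 := by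
    intro x
    have := hg 1 (fun _ => 1) (fun _ => x)
    simp [hΨ0] at this
    have h2 := gauss_mom (hZm x) this
    refine ⟨h2.1, h2.2.1, ?_⟩
    rw [h2.2.2, Real.coe_toNNReal _ (by positivity)]
  refine ⟨fun x => (h1 x).1, fun x => (h1 x).2.1, fun x y => ?_⟩
  have := hg 2 (fun _ => 1) ![x, y]
  simp [Fin.sum_univ_two, hΨ0] at this
  have h2 := (gauss_mom ((hZm x).add (hZm y)) this).2.2
  have h3 : Ψ (y - x) = Ψ (x - y) := by rw [← hΨs, neg_sub]
  rw [h3, Real.coe_toNNReal _ (by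
    have := (abs_le.mp (hΨb (x - y))).1
    nlinarith [sq_nonneg σ])] at h2
  have h4 : ∫ ω, (Z x ω + Z y ω) ^ 2 ∂P =
      ∫ ω, Z x ω ^ 2 ∂P + 2 * ∫ ω, Z x ω * Z y ω ∂P + ∫ ω, Z y ω ^ 2 ∂P := sq_expand (h1 x).1 (h1 y).1
  rw [(h1 x).2.2, (h1 y).2.2] at h4
  have h5 : ∫ ω, (Z x ω + Z y ω) ^ 2 ∂P = _ := h2
  rw [h4] at h5
  linarith

end gc

/-- kriging weights -/
noncomputable def kw {p n : ℕ} (Ψ : EuclideanSpace ℝ (Fin p) → ℝ)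
    (xs : Fin n → EuclideanSpace ℝ (Fin p)) (v : EuclideanSpace ℝ (Fin p)) (k : Fin n) : ℝ :=
  ∑ j, Ψ (v - xs j) * (kmat Ψ xs)⁻¹ j k

theorem kinterp_eq {p n : ℕ} (Ψ : EuclideanSpace ℝ (Fin p) → ℝ)
    (xs : Fin n → EuclideanSpace ℝ (Fin p)) (f : EuclideanSpace ℝ (Fin p) → ℝ)
    (v : EuclideanSpace ℝ (Fin p)) : kinterp Ψ xs f v = ∑ k, kw Ψ xs v k * f (xs k) := by
  unfold kinterp kw
  rw [Finset.sum_comm]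
  simp only [Finset.sum_mul]

theorem kw_mul {p n : ℕ} {Ψ : EuclideanSpace ℝ (Fin p) → ℝ}
    {xs : Fin n → EuclideanSpace ℝ (Fin p)} (h : IsUnit (kmat Ψ xs).det)
    (v : EuclideanSpace ℝ (Fin p)) (l : Fin n) :
    ∑ k, kw Ψ xs v k * Ψ (xs k - xs l) = Ψ (v - xs l) := by
  have h1 := Matrix.nonsing_inv_mul (kmat Ψ xs) h
  have h2 : ∀ j, ∑ k, (kmat Ψ xs)⁻¹ j k * Ψ (xs k - xs l) = (1 : Matrix (Fin n) (Fin n) ℝ) j l := by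
    intro j; rw [← h1]; rfl
  unfold kw
  simp only [Finset.sum_mul]
  rw [Finset.sum_comm]
  simp only [mul_assoc, ← Finset.mul_sum, h2]
  simp [Matrix.one_apply]

theorem kw_self {p n : ℕ} {Ψ : EuclideanSpace ℝ (Fin p) → ℝ}
    {xs : Fin n → EuclideanSpace ℝ (Fin p)} (h : IsUnit (kmat Ψ xs).det) (l k : Fin n) :
    kw Ψ xs (xs l) k = if l = k then 1 else 0 := by
  have h1 := Matrix.mul_nonsing_inv (kmat Ψ xs) h
  have : kw Ψ xs (xs l) k = (kmat Ψ xs * (kmat Ψ xs)⁻¹) l k := rfl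
  rw [this, h1, Matrix.one_apply]

theorem krigSd_eq {p n : ℕ} (Ψ : EuclideanSpace ℝ (Fin p) → ℝ)
    (xs : Fin n → EuclideanSpace ℝ (Fin p)) (σ : ℝ) (v : EuclideanSpace ℝ (Fin p)) :
    krigSd Ψ xs σ v = σ * Real.sqrt (1 - ∑ k, kw Ψ xs v k * Ψ (v - xs k)) := by
  unfold krigSd
  rw [← kinterp_eq Ψ xs (fun x => Ψ (v - x)) v]
  rfl

section fixed
variable {p : ℕ} {Ω' : Type*} [MeasurableSpace Ω'] {P : Measure Ω'} [IsProbabilityMeasure P]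
  {Z : EuclideanSpace ℝ (Fin p) → Ω' → ℝ} {σ : ℝ} {Ψ : EuclideanSpace ℝ (Fin p) → ℝ}
  {n : ℕ} {xs : Fin n → EuclideanSpace ℝ (Fin p)}

/-- residual -/
noncomputable def kres (Ψ : EuclideanSpace ℝ (Fin p) → ℝ)
    (xs : Fin n → EuclideanSpace ℝ (Fin p)) (f : EuclideanSpace ℝ (Fin p) → ℝ)
    (v : EuclideanSpace ℝ (Fin p)) : ℝ := f v - ∑ k, kw Ψ xs v k * f (xs k)

theorem kres_mom (hσ : 0 < σ) (hΨ0 : Ψ 0 = 1) (hΨs : ∀ x, Ψ (-x) = Ψ x) (hΨb : ∀ x, |Ψ x| ≤ 1)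
    (hZm : ∀ x, Measurable (Z x)) (hg : GaussCov P Z σ Ψ) (hK : IsUnit (kmat Ψ xs).det)
    (v : EuclideanSpace ℝ (Fin p)) :
    MemLp (fun ω => kres Ψ xs (Z · ω) v) 2 P ∧ ∫ ω, kres Ψ xs (Z · ω) v ∂P = 0 ∧
    (∀ l, ∫ ω, kres Ψ xs (Z · ω) v * Z (xs l) ω ∂P = 0) ∧
    ∫ ω, (kres Ψ xs (Z · ω) v) ^ 2 ∂P = (krigSd Ψ xs σ v) ^ 2 ∧
    0 ≤ krigSd Ψ xs σ v ∧ krigSd Ψ xs σ v ≤ σ := by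
  obtain ⟨hL, hE, hC⟩ := gauss_cov hσ hΨ0 hΨs hΨb hZm hg
  have hI : ∀ x, Integrable (Z x) P := fun x => (hL x).integrable (by norm_num)
  have hII : ∀ x y, Integrable (fun ω => Z x ω * Z y ω) P := fun x y =>
    (hL x).integrable_mul (hL y)
  have hLs : MemLp (fun ω => ∑ k, kw Ψ xs v k * Z (xs k) ω) 2 P :=
    memLp_finsetSum _ fun k _ => (hL (xs k)).const_mul _
  have hLr : MemLp (fun ω => kres Ψ xs (Z · ω) v) 2 P := (hL v).sub hLs
  have hcov : ∀ x, ∫ ω, kres Ψ xs (Z · ω) v * Z x ω ∂P =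
      σ ^ 2 * (Ψ (v - x) - ∑ k, kw Ψ xs v k * Ψ (xs k - x)) := by
    intro x
    have : ∀ ω, kres Ψ xs (Z · ω) v * Z x ω =
        Z v ω * Z x ω - ∑ k, kw Ψ xs v k * (Z (xs k) ω * Z x ω) := by
      intro ω; unfold kres; rw [sub_mul, Finset.sum_mul]; simp only [mul_assoc]
    simp only [this]
    rw [integral_sub (hII _ _) (integrable_finsetSum _ fun k _ => (hII _ _).const_mul _),
      integral_finsetSum _ fun k _ => (hII _ _).const_mul _]
    simp only [integral_const_mul, hC]
    rw [mul_sub, Finset.mul_sum]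
    congr 1
    exact Finset.sum_congr rfl fun k _ => by ring
  have hcov0 : ∀ l, ∫ ω, kres Ψ xs (Z · ω) v * Z (xs l) ω ∂P = 0 := by
    intro l; rw [hcov, kw_mul hK]; simp
  have hsum0 : ∫ ω, kres Ψ xs (Z · ω) v * (∑ k, kw Ψ xs v k * Z (xs k) ω) ∂P = 0 := by
    have : ∀ ω, kres Ψ xs (Z · ω) v * (∑ k, kw Ψ xs v k * Z (xs k) ω) =
        ∑ k, kw Ψ xs v k * (kres Ψ xs (Z · ω) v * Z (xs k) ω) := by
      intro ω; rw [Finset.mul_sum]; exact Finset.sum_congr rfl fun k _ => by ring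
    simp only [this]
    have hri : ∀ k, Integrable (fun ω => kres Ψ xs (Z · ω) v * Z (xs k) ω) P :=
      fun k => hLr.integrable_mul (hL _)
    rw [integral_finsetSum _ fun k _ => (hri k).const_mul _]
    simp [integral_const_mul, hcov0]
  have hrv : Integrable (fun ω => kres Ψ xs (Z · ω) v * Z v ω) P := hLr.integrable_mul (hL _)
  have hrs : Integrable (fun ω => kres Ψ xs (Z · ω) v * (∑ k, kw Ψ xs v k * Z (xs k) ω)) P :=
    hLr.integrable_mul hLs
  have hvar : ∫ ω, (kres Ψ xs (Z · ω) v) ^ 2 ∂P =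
      σ ^ 2 * (1 - ∑ k, kw Ψ xs v k * Ψ (v - xs k)) := by
    have h1 : ∀ ω, (kres Ψ xs (Z · ω) v) ^ 2 = kres Ψ xs (Z · ω) v * Z v ω -
        kres Ψ xs (Z · ω) v * (∑ k, kw Ψ xs v k * Z (xs k) ω) := by
      intro ω; rw [← mul_sub, sq]; rfl
    simp only [h1]
    rw [integral_sub hrv hrs, hsum0, hcov, sub_self, hΨ0, sub_zero]
    congr 2
    exact Finset.sum_congr rfl fun k _ => by rw [← hΨs, neg_sub]
  have hnn : 0 ≤ 1 - ∑ k, kw Ψ xs v k * Ψ (v - xs k) := by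
    have h1 : 0 ≤ ∫ ω, (kres Ψ xs (Z · ω) v) ^ 2 ∂P := integral_nonneg fun ω => sq_nonneg _
    rw [hvar] at h1
    exact nonneg_of_mul_nonneg_right h1 (by positivity)
  have hle : ∫ ω, (kres Ψ xs (Z · ω) v) ^ 2 ∂P ≤ σ ^ 2 := by
    have h2 : ∫ ω, Z v ω ^ 2 ∂P = σ ^ 2 := by
      have := hC v v
      simpa [sq, hΨ0] using this
    rw [← h2]
    have h3 : ∫ ω, Z v ω ^ 2 ∂P = ∫ ω, (kres Ψ xs (Z · ω) v) ^ 2 ∂P +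
       2 * (∫ ω, kres Ψ xs (Z · ω) v * (∑ k, kw Ψ xs v k * Z (xs k) ω) ∂P) +
       ∫ ω, (∑ k, kw Ψ xs v k * Z (xs k) ω) ^ 2 ∂P := by
      rw [← sq_expand hLr hLs]; simp [kres]
    rw [h3, hsum0]
    have : 0 ≤ ∫ ω, (∑ k, kw Ψ xs v k * Z (xs k) ω) ^ 2 ∂P := integral_nonneg fun ω => sq_nonneg _
    linarith
  refine ⟨hLr, ?_, hcov0, ?_, ?_, ?_⟩
  · unfold kres
    rw [integral_sub (hI v) (integrable_finsetSum _ fun k _ => (hI _).const_mul _),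
      integral_finsetSum _ fun k _ => (hI _).const_mul _]
    simp [integral_const_mul, hE]
  · rw [hvar, krigSd_eq, mul_pow, Real.sq_sqrt hnn]
  · rw [krigSd_eq]; positivity
  · rw [krigSd_eq]
    rw [hvar] at hle
    have : Real.sqrt (1 - ∑ k, kw Ψ xs v k * Ψ (v - xs k)) ≤ 1 := by
      rw [Real.sqrt_le_one]
      exact (mul_le_iff_le_one_right (by positivity)).mp hle
    nlinarith

/-- denominators -/
noncomputable def kden (Ψ : EuclideanSpace ℝ (Fin p) → ℝ)
    (xs : Fin n → EuclideanSpace ℝ (Fin p)) (σ : ℝ) (v : EuclideanSpace ℝ (Fin p)) : ℝ :=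
  krigSd Ψ xs σ v * Real.sqrt (Real.log (Real.exp 1 * σ / krigSd Ψ xs σ v))

theorem krigRatio_eq (f : EuclideanSpace ℝ (Fin p) → ℝ) (v : EuclideanSpace ℝ (Fin p)) :
    krigRatio Ψ xs σ f v = kres Ψ xs f v / kden Ψ xs σ v := by
  unfold krigRatio kden kres; rw [kinterp_eq]

theorem krig_log (hσ : 0 < σ) {s : ℝ} (hs0 : 0 < s) (hs : s ≤ σ) :
    1 ≤ Real.log (Real.exp 1 * σ / s) := by
  rw [Real.le_log_iff_exp_le (by positivity), mul_div_assoc]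
  have : 1 ≤ σ / s := (one_le_div hs0).mpr hs
  have := Real.exp_pos 1
  nlinarith

theorem kratio_mom (hσ : 0 < σ) (hΨ0 : Ψ 0 = 1) (hΨs : ∀ x, Ψ (-x) = Ψ x) (hΨb : ∀ x, |Ψ x| ≤ 1)
    (hZm : ∀ x, Measurable (Z x)) (hg : GaussCov P Z σ Ψ) (hK : IsUnit (kmat Ψ xs).det)
    (v : EuclideanSpace ℝ (Fin p)) :
    ∫ ω, krigRatio Ψ xs σ (Z · ω) v ∂P = 0 ∧ ∫ ω, (krigRatio Ψ xs σ (Z · ω) v) ^ 2 ∂P ≤ 1 := by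
  obtain ⟨_, h1, _, h2, h3, h4⟩ := kres_mom hσ hΨ0 hΨs hΨb hZm hg hK v
  simp only [krigRatio_eq]
  constructor
  · rw [integral_div, h1, zero_div]
  · simp only [div_pow]
    rw [integral_div, h2]
    rcases h3.eq_or_lt with h | h
    · rw [← h]; simp
    · have hl := krig_log hσ h h4
      unfold kden
      rw [mul_pow, Real.sq_sqrt (by linarith), div_le_one (by positivity)]
      nlinarith [sq_nonneg (krigSd Ψ xs σ v)]

theorem kratio_gp (hZm : ∀ x, Measurable (Z x)) (hg : GaussCov P Z σ Ψ) :
    IsGaussianProcess (fun (v : EuclideanSpace ℝ (Fin p)) ω => krigRatio Ψ xs σ (Z · ω) v) P := by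
  refine gp_lin (gp_of_gauss hZm hg) _ fun v => ?_
  refine ⟨n + 1, Fin.cons (kden Ψ xs σ v)⁻¹ fun k => - (kw Ψ xs v k / kden Ψ xs σ v),
    Fin.cons v xs, fun ω => ?_⟩
  rw [Fin.sum_univ_succ]
  simp only [Fin.cons_zero, Fin.cons_succ, krigRatio_eq, kres]
  rw [sub_div, Finset.sum_div, div_eq_inv_mul, sub_eq_add_neg, ← Finset.sum_neg_distrib]
  congr 1
  exact Finset.sum_congr rfl fun k _ => by ring

theorem kres_indep (hσ : 0 < σ) (hΨ0 : Ψ 0 = 1) (hΨs : ∀ x, Ψ (-x) = Ψ x) (hΨb : ∀ x, |Ψ x| ≤ 1)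
    (hZm : ∀ x, Measurable (Z x)) (hg : GaussCov P Z σ Ψ) (hK : IsUnit (kmat Ψ xs).det)
    {ι : Type*} (s : ι → EuclideanSpace ℝ (Fin p)) :
    IndepFun (fun ω i => kres Ψ xs (Z · ω) (s i)) (fun ω k => Z (xs k) ω) P := by
  have hrm : ∀ v, Measurable (fun ω => kres Ψ xs (Z · ω) v) := by
    intro v; unfold kres
    exact (hZm v).sub (Finset.measurable_fun_sum _ fun k _ => (hZm _).const_mul _)
  apply IsGaussianProcess.indepFun_of_covariance_eq_zero (X := fun i ω => kres Ψ xs (Z · ω) (s i))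
    (Y := fun k ω => Z (xs k) ω)
  · refine gp_lin (gp_of_gauss hZm hg) _ fun v => ?_
    rcases v with i | k
    · refine ⟨n + 1, Fin.cons 1 fun k => - (kw Ψ xs (s i) k), Fin.cons (s i) xs, fun ω => ?_⟩
      rw [Fin.sum_univ_succ]
      simp [kres, sub_eq_add_neg]
    · exact ⟨1, fun _ => 1, fun _ => xs k, fun ω => by simp⟩
  · intro i; exact (hrm _).aemeasurable
  · intro i; exact (hZm _).aemeasurable
  · intro i k
    obtain ⟨hL, hE, hC⟩ := gauss_cov hσ hΨ0 hΨs hΨb hZm hg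
    obtain ⟨h0, h1, h2, _⟩ := kres_mom hσ hΨ0 hΨs hΨb hZm hg hK (s i)
    rw [covariance_eq_sub h0 (hL _), h1, zero_mul, sub_zero]
    exact h2 k

end fixed

end kern5

section path6

theorem iSup_eq_of_bounds {ι κ : Type*} [Nonempty ι] [Nonempty κ] (f : ι → ℝ) (g : κ → ℝ)
    (h : ∀ B, (∀ i, f i ≤ B) ↔ (∀ j, g j ≤ B)) : ⨆ i, f i = ⨆ j, g j := by
  by_cases hf : BddAbove (Set.range f)
  · obtain ⟨B, hB⟩ := hf
    have hf : BddAbove (Set.range f) := ⟨B, hB⟩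
    have hg : BddAbove (Set.range g) := by
      refine ⟨B, ?_⟩
      rintro _ ⟨j, rfl⟩
      exact (h B).mp (fun i => hB ⟨i, rfl⟩) j
    apply le_antisymm
    · exact ciSup_le ((h _).mpr fun j => le_ciSup hg j)
    · exact ciSup_le ((h _).mp fun j => le_ciSup hf j)
  · have hg : ¬ BddAbove (Set.range g) := by
      rintro ⟨B, hB⟩
      apply hf
      refine ⟨B, ?_⟩
      rintro _ ⟨i, rfl⟩
      exact (h B).mpr (fun j => hB ⟨j, rfl⟩) i
    rw [Real.iSup_of_not_bddAbove hf, Real.iSup_of_not_bddAbove hg]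

section sup
variable {p : ℕ} {σ : ℝ} {Ψ : EuclideanSpace ℝ (Fin p) → ℝ}
  {n : ℕ} {xs : Fin n → EuclideanSpace ℝ (Fin p)}

theorem krigSd_self (hΨ0 : Ψ 0 = 1) (hK : IsUnit (kmat Ψ xs).det) (l : Fin n) :
    krigSd Ψ xs σ (xs l) = 0 := by
  rw [krigSd_eq]
  simp [kw_self hK, hΨ0]

theorem kratio_self (hΨ0 : Ψ 0 = 1) (hK : IsUnit (kmat Ψ xs).det)
    (f : EuclideanSpace ℝ (Fin p) → ℝ) (l : Fin n) :
    krigRatio Ψ xs σ f (xs l) = 0 := by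
  rw [krigRatio_eq, kden, krigSd_self hΨ0 hK]; simp

theorem kw_cont (hΨc : Continuous Ψ) (k : Fin n) : Continuous fun v => kw Ψ xs v k := by
  unfold kw; fun_prop

theorem krigSd_cont (hΨc : Continuous Ψ) : Continuous fun v => krigSd Ψ xs σ v := by
  unfold krigSd; fun_prop

theorem kratio_sup (hσ : 0 < σ) (hΨ0 : Ψ 0 = 1) (hΨc : Continuous Ψ)
    (hK : IsUnit (kmat Ψ xs).det)
    (hsd : ∀ v, 0 ≤ krigSd Ψ xs σ v ∧ krigSd Ψ xs σ v ≤ σ)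
    {Ω : Set (EuclideanSpace ℝ (Fin p))} (s : ℕ → Ω) (hs : DenseRange s)
    (hxs : ∀ i, xs i ∈ Ω) (f : EuclideanSpace ℝ (Fin p) → ℝ) (hf : ContinuousOn f Ω) :
    ⨆ v : Ω, krigRatio Ψ xs σ f v =
      ⨆ i : ℕ ⊕ Fin n, krigRatio Ψ xs σ f (Sum.elim (fun j => (s j : EuclideanSpace ℝ (Fin p))) xs i) := by
  have : Nonempty Ω := ⟨s 0⟩
  apply iSup_eq_of_bounds
  intro B
  constructor
  · intro h i
    rcases i with j | k
    · exact h (s j)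
    · exact h ⟨xs k, hxs k⟩
  · intro h v
    rcases (hsd v).1.eq_or_lt with h0 | h0
    · have hr : krigRatio Ψ xs σ f v = 0 := by
        rw [krigRatio_eq, kden, ← h0]; simp
      rw [hr]
      rcases Nat.eq_zero_or_pos n with hn | hn
      · subst hn
        rw [krigSd_eq] at h0
        simp at h0
        linarith
      · have := h (Sum.inr ⟨0, hn⟩)
        rwa [Sum.elim_inr, kratio_self hΨ0 hK] at this
    · have hfc : Continuous fun v : Ω => f v := continuousOn_iff_continuous_domRestrict.mp hf
      have hsc : Continuous fun v : Ω => krigSd Ψ xs σ v :=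
        (krigSd_cont hΨc).comp continuous_subtype_val
      have hrc : Continuous fun v : Ω => kres Ψ xs f v := by
        unfold kres
        refine hfc.sub (continuous_finsetSum _ fun k _ => ?_)
        exact ((kw_cont hΨc k).comp continuous_subtype_val).mul continuous_const
      have hl := krig_log hσ h0 (hsd v).2
      have hdc : ContinuousAt (fun v : Ω => kden Ψ xs σ v) v := by
        unfold kden
        apply ContinuousAt.mul hsc.continuousAt
        apply ContinuousAt.sqrt
        apply ContinuousAt.log
        · exact ContinuousAt.div continuousAt_const hsc.continuousAt h0.ne'
        · intro h5
          rw [h5] at hl; norm_num at hl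
      have hd : kden Ψ xs σ v ≠ 0 := by
        unfold kden
        have : 0 < Real.sqrt (Real.log (Real.exp 1 * σ / krigSd Ψ xs σ v)) :=
          Real.sqrt_pos.mpr (by linarith)
        positivity
      have hc : ContinuousAt (fun v : Ω => krigRatio Ψ xs σ f v) v := by
        simp only [krigRatio_eq]
        exact hrc.continuousAt.div hdc hd
      by_contra hlt
      push Not at hlt
      have hev := hc.eventually (lt_mem_nhds hlt)
      obtain ⟨w, ⟨j, rfl⟩, hw⟩ := hs.inter_nhds_nonempty hev
      exact absurd (h (Sum.inl j)) (not_le.mpr hw)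

end sup

/-- Borel structure on path space -/
noncomputable instance pathMS {p : ℕ} (Ω : Set (EuclideanSpace ℝ (Fin p))) :
    MeasurableSpace C(Ω, ℝ) := borel _

instance pathBorel {p : ℕ} (Ω : Set (EuclideanSpace ℝ (Fin p))) : BorelSpace C(Ω, ℝ) := ⟨rfl⟩

theorem path_inv {p : ℕ} {Ω : Set (EuclideanSpace ℝ (Fin p))} [CompactSpace Ω]
    (s : ℕ → Ω) (hs : DenseRange s) :
    ∃ Φ : (ℕ → ℝ) → C(Ω, ℝ), Measurable Φ ∧ ∀ θ : C(Ω, ℝ), Φ (fun j => θ (s j)) = θ := by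
  have hc : Continuous (fun (θ : C(Ω, ℝ)) (j : ℕ) => θ (s j)) := by fun_prop
  have hi : Function.Injective (fun (θ : C(Ω, ℝ)) (j : ℕ) => θ (s j)) := by
    intro θ η h
    ext v
    have := hs.equalizer θ.continuous η.continuous (by ext j; exact congrFun h j)
    exact congrFun this v
  obtain ⟨Φ, h1, h2⟩ := (hc.measurableEmbedding hi).exists_measurable_extend
    measurable_id (fun _ => ⟨0⟩)
  exact ⟨Φ, h1, fun θ => congrFun h2 θ⟩

section U
variable {p : ℕ} {Ω : Set (EuclideanSpace ℝ (Fin p))} {Ψ : EuclideanSpace ℝ (Fin p) → ℝ}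

theorem retr_exists (hΩ : MeasurableSet Ω) [Nonempty Ω] :
    ∃ ρ : EuclideanSpace ℝ (Fin p) → Ω, Measurable ρ ∧ ∀ v : Ω, ρ v = v := by
  obtain ⟨ρ, h1, h2⟩ := (MeasurableEmbedding.subtype_coe hΩ).exists_measurable_extend
    measurable_id (fun _ => inferInstance)
  exact ⟨ρ, h1, fun v => congrFun h2 v⟩

/-- the weight function as a path -/
noncomputable def phiC (Ω : Set (EuclideanSpace ℝ (Fin p))) (hΨc : Continuous Ψ) {n : ℕ}
    (D : Fin n → EuclideanSpace ℝ (Fin p)) (l : Fin n) :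
    C(Ω, ℝ) := ⟨fun v => kw Ψ D v l, (kw_cont hΨc l).comp continuous_subtype_val⟩

theorem kinv_meas (hΨc : Continuous Ψ) {n : ℕ} (j l : Fin n) :
    Measurable fun D : Fin n → EuclideanSpace ℝ (Fin p) => (kmat Ψ D)⁻¹ j l := by
  have h1 : Continuous fun D : Fin n → EuclideanSpace ℝ (Fin p) => kmat Ψ D := by
    unfold kmat
    refine continuous_matrix fun a b => ?_
    simp only [Matrix.of_apply]
    fun_prop
  have h2 : Measurable fun D : Fin n → EuclideanSpace ℝ (Fin p) => (kmat Ψ D).det :=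
    h1.matrix_det.measurable
  have h3 : Measurable fun D : Fin n → EuclideanSpace ℝ (Fin p) => (kmat Ψ D).adjugate j l :=
    (h1.matrix_adjugate.matrix_elem j l).measurable
  simp only [Matrix.inv_def, Ring.inverse_eq_inv', Matrix.smul_apply, smul_eq_mul]
  exact h2.inv.mul h3

theorem phiC_meas [CompactSpace Ω] (hΨc : Continuous Ψ) {n : ℕ} (l : Fin n) :
    Measurable fun D : Fin n → EuclideanSpace ℝ (Fin p) => phiC Ω hΨc D l := by
  let ψ : C(EuclideanSpace ℝ (Fin p), C(Ω, ℝ)) :=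
    ContinuousMap.curry ⟨fun q => Ψ ((q.2 : EuclideanSpace ℝ (Fin p)) - q.1), by fun_prop⟩
  have h : (fun D : Fin n → EuclideanSpace ℝ (Fin p) => phiC Ω hΨc D l) =
      fun D => ∑ j, (kmat Ψ D)⁻¹ j l • ψ (D j) := by
    ext D v
    simp only [phiC, kw, ContinuousMap.coe_mk, ContinuousMap.sum_apply, ContinuousMap.smul_apply,
      smul_eq_mul]
    exact Finset.sum_congr rfl fun j _ => by rw [mul_comm]; rfl
  rw [h]
  refine Finset.measurable_fun_sum _ fun j _ => ?_
  exact (kinv_meas hΨc j l).smul (ψ.continuous.measurable.comp (measurable_pi_apply j))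

/-- conditioned path -/
noncomputable def condP (hΨc : Continuous Ψ) (ρ : EuclideanSpace ℝ (Fin p) → Ω) {n : ℕ}
    (D : Fin n → EuclideanSpace ℝ (Fin p)) (Y : Fin n → ℝ) (θ : C(Ω, ℝ)) : C(Ω, ℝ) :=
  θ + ∑ l, (Y l - θ (ρ (D l))) • phiC Ω hΨc D l

theorem condP_apply (hΨc : Continuous Ψ) (ρ : EuclideanSpace ℝ (Fin p) → Ω) {n : ℕ}
    (D : Fin n → EuclideanSpace ℝ (Fin p)) (Y : Fin n → ℝ) (θ : C(Ω, ℝ)) (v : Ω) :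
    condP hΨc ρ D Y θ v = θ v + ∑ l, (Y l - θ (ρ (D l))) * kw Ψ D v l := by
  simp only [condP, ContinuousMap.add_apply, ContinuousMap.sum_apply, ContinuousMap.smul_apply,
    smul_eq_mul]
  rfl

theorem ev_meas [CompactSpace Ω] {ρ : EuclideanSpace ℝ (Fin p) → Ω} (hρ : Measurable ρ) :
    Measurable fun q : EuclideanSpace ℝ (Fin p) × C(Ω, ℝ) => q.2 (ρ q.1) := by
  have h1 : Measurable fun q : C(Ω, ℝ) × Ω => q.1 q.2 :=
    (ContinuousEval.continuous_eval (F := C(Ω, ℝ)) (X := Ω) (Y := ℝ)).measurable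
  exact h1.comp (measurable_snd.prodMk (hρ.comp measurable_fst))

theorem condP_meas [CompactSpace Ω] (hΨc : Continuous Ψ) {ρ : EuclideanSpace ℝ (Fin p) → Ω}
    (hρ : Measurable ρ) {n : ℕ} :
    Measurable fun q : ((Fin n → EuclideanSpace ℝ (Fin p)) × (Fin n → ℝ)) × C(Ω, ℝ) =>
      condP hΨc ρ q.1.1 q.1.2 q.2 := by
  unfold condP
  refine measurable_snd.add (Finset.measurable_fun_sum _ fun l _ => ?_)
  apply Measurable.fun_smul
  · apply Measurable.sub
    · fun_prop
    · have : Measurable fun q : ((Fin n → EuclideanSpace ℝ (Fin p)) × (Fin n → ℝ)) × C(Ω, ℝ) =>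
        (q.1.1 l, q.2) := by fun_prop
      exact (ev_meas hρ).comp this
  · exact (phiC_meas hΨc l).comp (by fun_prop)

/-- values of a path at the design -/
def obsP (ρ : EuclideanSpace ℝ (Fin p) → Ω) {n : ℕ}
    (D : Fin n → EuclideanSpace ℝ (Fin p)) (θ : C(Ω, ℝ)) : Fin n → ℝ := fun k => θ (ρ (D k))

theorem obsP_meas [CompactSpace Ω] {ρ : EuclideanSpace ℝ (Fin p) → Ω}
    (hρ : Measurable ρ) {n : ℕ} :
    Measurable fun q : (Fin n → EuclideanSpace ℝ (Fin p)) × C(Ω, ℝ) => obsP ρ q.1 q.2 := by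
  refine measurable_pi_lambda _ fun k => ?_
  have : Measurable fun q : (Fin n → EuclideanSpace ℝ (Fin p)) × C(Ω, ℝ) => (q.1 k, q.2) := by
    fun_prop
  exact (ev_meas hρ).comp this

theorem condP_self (hΨc : Continuous Ψ) (ρ : EuclideanSpace ℝ (Fin p) → Ω) {n : ℕ}
    (D : Fin n → EuclideanSpace ℝ (Fin p)) (θ : C(Ω, ℝ)) :
    condP hΨc ρ D (obsP ρ D θ) θ = θ := by
  ext v; rw [condP_apply]; simp [obsP]

theorem condP_add (hΨc : Continuous Ψ) (ρ : EuclideanSpace ℝ (Fin p) → Ω) {n : ℕ}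
    (D : Fin n → EuclideanSpace ℝ (Fin p)) (Y : Fin n → ℝ) (θ : C(Ω, ℝ)) :
    condP hΨc ρ D Y θ = condP hΨc ρ D 0 θ + ∑ l, Y l • phiC Ω hΨc D l := by
  ext v
  rw [ContinuousMap.add_apply, condP_apply, condP_apply]
  simp only [ContinuousMap.sum_apply, ContinuousMap.smul_apply, smul_eq_mul, Pi.zero_apply, zero_sub]
  have : ∀ l, (phiC Ω hΨc D l) v = kw Ψ D v l := fun _ => rfl
  simp only [this]
  rw [add_assoc, ← Finset.sum_add_distrib]
  congr 1
  exact Finset.sum_congr rfl fun l _ => by ring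

theorem condP_nested (hΨc : Continuous Ψ) {ρ : EuclideanSpace ℝ (Fin p) → Ω}
    (hρ : ∀ v : Ω, ρ v = v) {n n' : ℕ} {D : Fin n → EuclideanSpace ℝ (Fin p)}
    {D' : Fin n' → EuclideanSpace ℝ (Fin p)} (hD' : ∀ i, D' i ∈ Ω)
    (ι : Fin n → Fin n') (hι : ∀ i, D i = D' (ι i)) (hK : IsUnit (kmat Ψ D').det)
    (Y : Fin n → ℝ) (θ : C(Ω, ℝ)) :
    condP hΨc ρ D' 0 (condP hΨc ρ D Y θ) = condP hΨc ρ D' 0 θ := by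
  ext v
  have hv : ∀ i, ((ρ (D' i) : Ω) : EuclideanSpace ℝ (Fin p)) = D' i := fun i => by
    rw [show D' i = ((⟨D' i, hD' i⟩ : Ω) : EuclideanSpace ℝ (Fin p)) from rfl, hρ]
  simp only [condP_apply, Pi.zero_apply, zero_sub, hv]
  have key : ∀ j, ∑ k, kw Ψ D (D' k) j * kw Ψ D' v k = kw Ψ D v j := by
    intro j
    unfold kw
    simp only [Finset.sum_mul]
    rw [Finset.sum_comm]
    apply Finset.sum_congr rfl
    intro i _
    rw [hι i, ← kw_mul hK v (ι i), Finset.sum_mul]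
    apply Finset.sum_congr rfl
    intro k _
    unfold kw
    rw [Finset.sum_mul, Finset.mul_sum, Finset.sum_mul]
    exact Finset.sum_congr rfl fun k _ => by ring
  simp only [neg_add, add_mul, Finset.sum_add_distrib, neg_mul, Finset.sum_neg_distrib]
  have h2 : ∑ k, (∑ l, (Y l - θ (ρ (D l))) * kw Ψ D (D' k) l) * kw Ψ D' v k =
      ∑ l, (Y l - θ (ρ (D l))) * kw Ψ D v l := by
    simp only [Finset.sum_mul]
    rw [Finset.sum_comm]
    apply Finset.sum_congr rfl
    intro l _
    rw [← key l, Finset.mul_sum]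
    exact Finset.sum_congr rfl fun k _ => by ring
  rw [h2]; ring

/-- update of the observations -/
noncomputable def updP (Ψ : EuclideanSpace ℝ (Fin p) → ℝ) {n n' : ℕ} (ι : Fin n → Fin n')
    (D : Fin n → EuclideanSpace ℝ (Fin p)) (Y : Fin n → ℝ)
    (D' : Fin n' → EuclideanSpace ℝ (Fin p)) (c : Fin n' → ℝ) : Fin n' → ℝ :=
  fun k => c k + ∑ l, (Y l - c (ι l)) * kw Ψ D (D' k) l

theorem updP_eq (hΨc : Continuous Ψ) {ρ : EuclideanSpace ℝ (Fin p) → Ω}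
    (hρ : ∀ v : Ω, ρ v = v) {n n' : ℕ} {D : Fin n → EuclideanSpace ℝ (Fin p)}
    {D' : Fin n' → EuclideanSpace ℝ (Fin p)} (hD' : ∀ i, D' i ∈ Ω)
    (ι : Fin n → Fin n') (hι : ∀ i, D i = D' (ι i))
    (Y : Fin n → ℝ) (θ : C(Ω, ℝ)) :
    obsP ρ D' (condP hΨc ρ D Y θ) = updP Ψ ι D Y D' (obsP ρ D' θ) := by
  have hv : ∀ i, ((ρ (D' i) : Ω) : EuclideanSpace ℝ (Fin p)) = D' i := fun i => by
    rw [show D' i = ((⟨D' i, hD' i⟩ : Ω) : EuclideanSpace ℝ (Fin p)) from rfl, hρ]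
  ext k
  simp only [obsP, updP, condP_apply, hv, hι]

theorem condP_zero_eq (hΨc : Continuous Ψ) {ρ : EuclideanSpace ℝ (Fin p) → Ω}
    (hρ : ∀ v : Ω, ρ v = v) {n : ℕ} {D : Fin n → EuclideanSpace ℝ (Fin p)} (hD : ∀ i, D i ∈ Ω)
    (θ : C(Ω, ℝ)) (f : EuclideanSpace ℝ (Fin p) → ℝ) (hf : ∀ v : Ω, θ v = f v) (v : Ω) :
    condP hΨc ρ D 0 θ v = kres Ψ D f v := by
  have hv : ∀ i, ((ρ (D i) : Ω) : EuclideanSpace ℝ (Fin p)) = D i := fun i => by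
    rw [show D i = ((⟨D i, hD i⟩ : Ω) : EuclideanSpace ℝ (Fin p)) from rfl, hρ]
  rw [condP_apply, kres]
  simp only [hf, hv, Pi.zero_apply, zero_sub, neg_mul, Finset.sum_neg_distrib, ← sub_eq_add_neg]
  congr 1
  exact Finset.sum_congr rfl fun l _ => by ring

/-- the statistic as a countable supremum -/
noncomputable def statP (Ψ : EuclideanSpace ℝ (Fin p) → ℝ) (σ : ℝ) (s : ℕ → Ω) {n : ℕ}
    (D : Fin n → EuclideanSpace ℝ (Fin p)) (u : C(Ω, ℝ)) : ℝ :=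
  ⨆ i : ℕ ⊕ Fin n, Sum.elim (fun j => u (s j) / kden Ψ D σ (s j)) (fun _ => 0) i

theorem statP_meas [CompactSpace Ω] (hΨc : Continuous Ψ) (σ : ℝ) (s : ℕ → Ω) {n : ℕ} :
    Measurable fun q : (Fin n → EuclideanSpace ℝ (Fin p)) × C(Ω, ℝ) => statP Ψ σ s q.1 q.2 := by
  unfold statP
  refine Measurable.iSup fun i => ?_
  rcases i with j | k
  · simp only [Sum.elim_inl]
    apply Measurable.div
    · have : Continuous fun u : C(Ω, ℝ) => u (s j) := by fun_prop
      exact this.measurable.comp measurable_snd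
    · have hsd : Measurable fun D : Fin n → EuclideanSpace ℝ (Fin p) => krigSd Ψ D σ (s j) := by
        unfold krigSd
        refine Measurable.const_mul (Measurable.sqrt (Measurable.const_sub ?_ _)) _
        refine Finset.measurable_fun_sum _ fun a _ => Finset.measurable_fun_sum _ fun b _ => ?_
        refine (Measurable.mul ?_ (kinv_meas hΨc a b)).mul ?_
        · exact Continuous.measurable (by fun_prop)
        · exact Continuous.measurable (by fun_prop)
      have : Measurable fun D : Fin n → EuclideanSpace ℝ (Fin p) => kden Ψ D σ (s j) := by
        unfold kden
        exact hsd.mul ((hsd.const_div _).log.sqrt)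
      exact this.comp measurable_fst
  · exact measurable_const

theorem statP_eq (hΨc : Continuous Ψ) {ρ : EuclideanSpace ℝ (Fin p) → Ω}
    (hρ : ∀ v : Ω, ρ v = v) {σ : ℝ} (s : ℕ → Ω) {n : ℕ} {D : Fin n → EuclideanSpace ℝ (Fin p)}
    (hD : ∀ i, D i ∈ Ω) (hΨ0 : Ψ 0 = 1) (hK : IsUnit (kmat Ψ D).det)
    (θ : C(Ω, ℝ)) (f : EuclideanSpace ℝ (Fin p) → ℝ) (hf : ∀ v : Ω, θ v = f v) :
    statP Ψ σ s D (condP hΨc ρ D 0 θ) = ⨆ i : ℕ ⊕ Fin n,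
      krigRatio Ψ D σ f (Sum.elim (fun j => (s j : EuclideanSpace ℝ (Fin p))) D i) := by
  unfold statP
  congr 1
  ext i
  rcases i with j | k
  · simp only [Sum.elim_inl]
    rw [condP_zero_eq hΨc hρ hD θ f hf, krigRatio_eq]
  · simp only [Sum.elim_inr]
    rw [kratio_self hΨ0 hK]

end U

end path6

section seq7

section abstr
variable {Ω' A B C' X X' : Type*} [MeasurableSpace Ω'] [StandardBorelSpace Ω']
  [mA : MeasurableSpace A] [MeasurableSpace B] [MeasurableSpace C'] [MeasurableSpace X]
  [MeasurableSpace X'] [StandardBorelSpace B] [Nonempty B] [StandardBorelSpace X] [Nonempty X]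
  {P : Measure Ω'} [IsProbabilityMeasure P]
  {α : Ω' → A} {β : Ω' → B} {ζ : Ω' → X} {r : A × X → X}

theorem seq_step1 (hα : Measurable α) (hβ : Measurable β) (hζ : Measurable ζ)
    (hci : CondIndepFun (mA.comap α) hα.comap_le β ζ P) (hr : Measurable r)
    (IH : ∀ G : A × X → ENNReal, Measurable G →
      ∫⁻ ω, G (α ω, ζ ω) ∂P = ∫⁻ ω, ∫⁻ ω', G (α ω, r (α ω, ζ ω')) ∂P ∂P)
    (G : (A × B) × X → ENNReal) (hG : Measurable G) :
    ∫⁻ ω, G ((α ω, β ω), ζ ω) ∂P = ∫⁻ ω, ∫⁻ ω', G ((α ω, β ω), r (α ω, ζ ω')) ∂P ∂P := by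
  have hrm : Measurable fun q : A × Ω' => r (q.1, ζ q.2) :=
    hr.comp (measurable_fst.prodMk (hζ.comp measurable_snd))
  let κ : Kernel A X := (Kernel.id ×ₖ Kernel.const A P).map (fun q => r (q.1, ζ q.2))
  have : IsMarkovKernel κ := Kernel.IsMarkovKernel.map _ hrm
  have hκ : ∀ a (g : X → ENNReal), Measurable g →
      ∫⁻ x, g x ∂(κ a) = ∫⁻ ω', g (r (a, ζ ω')) ∂P := by
    intro a g hg
    have hgr : Measurable fun q : A × Ω' => g (r (q.1, ζ q.2)) := hg.comp hrm
    simp only [κ]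
    rw [Kernel.map_apply _ hrm, lintegral_map hg hrm, Kernel.prod_apply, Kernel.id_apply,
      Kernel.const_apply, lintegral_prod _ hgr.aemeasurable,
      lintegral_dirac' _ (Measurable.lintegral_prod_right' hgr)]
  have hmap : P.map (fun ω => (α ω, ζ ω)) = P.map α ⊗ₘ κ := by
    apply Measure.ext_of_lintegral
    intro f hf
    rw [lintegral_map hf (hα.prodMk hζ), Measure.lintegral_compProd hf, lintegral_map _ hα, IH f hf]
    · congr 1; ext ω
      rw [hκ _ _ (by fun_prop)]
    · exact Measurable.lintegral_kernel_prod_right' hf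
  have h1 := condDistrib_ae_eq_of_measure_eq_compProd α hζ.aemeasurable hmap
  have h2 := (condIndepFun_iff_condDistrib_prod_ae_eq_prodMkRight hζ hβ hα).mp hci
  have h3 : condDistrib ζ (fun ω => (α ω, β ω)) P =ᵐ[P.map (fun ω => (α ω, β ω))]
      κ.prodMkRight B := by
    refine h2.trans ?_
    have h4 : ∀ᵐ q ∂(P.map (fun ω => (α ω, β ω))), condDistrib ζ α P q.1 = κ q.1 := by
      have h5 : P.map α = (P.map (fun ω => (α ω, β ω))).map Prod.fst := by
        rw [Measure.map_map measurable_fst (hα.prodMk hβ)]; rfl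
      rw [h5] at h1
      exact ae_of_ae_map measurable_fst.aemeasurable h1
    filter_upwards [h4] with q hq
    simp only [Kernel.prodMkRight_apply]
    exact hq
  have h6 : P.map (fun ω => ((α ω, β ω), ζ ω)) = P.map (fun ω => (α ω, β ω)) ⊗ₘ κ.prodMkRight B :=
    (condDistrib_ae_eq_iff_measure_eq_compProd _ hζ.aemeasurable _).mp h3
  calc ∫⁻ ω, G ((α ω, β ω), ζ ω) ∂P
      = ∫⁻ q, G q ∂(P.map (fun ω => ((α ω, β ω), ζ ω))) :=
        (lintegral_map hG ((hα.prodMk hβ).prodMk hζ)).symm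
    _ = ∫⁻ q, ∫⁻ x, G (q, x) ∂(κ.prodMkRight B q) ∂(P.map (fun ω => (α ω, β ω))) := by
        rw [h6, Measure.lintegral_compProd hG]
    _ = ∫⁻ ω, ∫⁻ x, G ((α ω, β ω), x) ∂(κ.prodMkRight B (α ω, β ω)) ∂P := by
        rw [lintegral_map _ (hα.prodMk hβ)]
        exact Measurable.lintegral_kernel_prod_right' hG
    _ = _ := by
        congr 1; ext ω
        rw [Kernel.prodMkRight_apply, hκ _ _ (by fun_prop)]

theorem seq_step2 (hα : Measurable α) (hβ : Measurable β) (hζ : Measurable ζ) (hr : Measurable r)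
    (h1 : ∀ (G : (A × B) × X → ENNReal), Measurable G →
      ∫⁻ ω, G ((α ω, β ω), ζ ω) ∂P = ∫⁻ ω, ∫⁻ ω', G ((α ω, β ω), r (α ω, ζ ω')) ∂P ∂P)
    {o : B × X → C'} (ho : Measurable o) {u : B × X → X'} (hu : Measurable u)
    {h : (A × B) × C' → C'} (hh : Measurable h)
    (hur : ∀ᵐ ω ∂P, ∀ θ, u (β ω, r (α ω, θ)) = u (β ω, θ))
    (hor : ∀ᵐ ω ∂P, ∀ θ, o (β ω, r (α ω, θ)) = h ((α ω, β ω), o (β ω, θ)))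
    (hind : ∀ᵐ ω ∂P, IndepFun (fun ω' => o (β ω, ζ ω')) (fun ω' => u (β ω, ζ ω')) P)
    (G : (B × C') × X' → ENNReal) (hG : Measurable G) :
    ∫⁻ ω, G ((β ω, o (β ω, ζ ω)), u (β ω, ζ ω)) ∂P =
      ∫⁻ ω, ∫⁻ ω', G ((β ω, o (β ω, ζ ω)), u (β ω, ζ ω')) ∂P ∂P := by
  let G1 : (A × B) × X → ENNReal := fun q => G ((q.1.2, o (q.1.2, q.2)), u (q.1.2, q.2))
  have hG1 : Measurable G1 := by fun_prop
  let G2 : (A × B) × X → ENNReal := fun q =>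
    ∫⁻ ω', G ((q.1.2, o (q.1.2, q.2)), u (q.1.2, ζ ω')) ∂P
  have hG2 : Measurable G2 := by
    apply Measurable.lintegral_prod_right'
      (f := fun q : ((A × B) × X) × Ω' => G ((q.1.1.2, o (q.1.1.2, q.1.2)), u (q.1.1.2, ζ q.2)))
    fun_prop
  have e1 := h1 G1 hG1
  have e2 := h1 G2 hG2
  refine e1.trans (Eq.trans ?_ e2.symm)
  apply lintegral_congr_ae
  filter_upwards [hur, hor, hind] with ω a1 a2 a3
  simp only [G1, G2, a1, a2]
  have mo : Measurable fun ω' => o (β ω, ζ ω') := by fun_prop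
  have mu : Measurable fun ω' => u (β ω, ζ ω') := by fun_prop
  have hp := (indepFun_iff_map_prod_eq_prod_map_map mo.aemeasurable mu.aemeasurable).mp a3
  let H : C' × X' → ENNReal := fun q => G ((β ω, h ((α ω, β ω), q.1)), q.2)
  have hH : Measurable H := by fun_prop
  have hH1 : ∀ c, Measurable fun x => H (c, x) := fun c => by fun_prop
  have := Measure.isProbabilityMeasure_map mo.aemeasurable (μ := P)
  have := Measure.isProbabilityMeasure_map mu.aemeasurable (μ := P)
  calc ∫⁻ ω', H (o (β ω, ζ ω'), u (β ω, ζ ω')) ∂P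
      = ∫⁻ q, H q ∂(P.map (fun ω' => (o (β ω, ζ ω'), u (β ω, ζ ω')))) :=
        (lintegral_map hH (mo.prodMk mu)).symm
    _ = ∫⁻ c, ∫⁻ x, H (c, x) ∂(P.map fun ω' => u (β ω, ζ ω')) ∂(P.map fun ω' => o (β ω, ζ ω')) := by
        rw [hp, lintegral_prod _ hH.aemeasurable]
    _ = ∫⁻ ω', ∫⁻ x, H (o (β ω, ζ ω'), x) ∂(P.map fun ω' => u (β ω, ζ ω')) ∂P := by
        rw [lintegral_map _ mo]
        exact Measurable.lintegral_prod_right' hH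
    _ = _ := by
        congr 1; ext ω'
        rw [lintegral_map (hH1 _) mu]

end abstr

end seq7

section fin8
variable {p : ℕ} {Ω : Set (EuclideanSpace ℝ (Fin p))} {Ψ : EuclideanSpace ℝ (Fin p) → ℝ}

theorem updP_meas (hΨc : Continuous Ψ) {n n' : ℕ} (ι : Fin n → Fin n') :
    Measurable fun q : ((Fin n → EuclideanSpace ℝ (Fin p)) × (Fin n → ℝ)) ×
      ((Fin n' → EuclideanSpace ℝ (Fin p)) × (Fin n' → ℝ)) =>
      updP Ψ ι q.1.1 q.1.2 q.2.1 q.2.2 := by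
  refine measurable_pi_lambda _ fun k => ?_
  unfold updP kw
  refine Measurable.add (by fun_prop) (Finset.measurable_fun_sum _ fun l _ => ?_)
  refine Measurable.mul (by fun_prop) (Finset.measurable_fun_sum _ fun j _ => ?_)
  refine Measurable.mul ?_ ((kinv_meas hΨc j l).comp (by fun_prop))
  exact hΨc.measurable.comp (by fun_prop)

variable {Ω' : Type} [MeasurableSpace Ω'] {P : Measure Ω'} [IsProbabilityMeasure P]
  {Z : EuclideanSpace ℝ (Fin p) → Ω' → ℝ} {σ : ℝ} {ζ : Ω' → C(Ω, ℝ)}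
  {ρ : EuclideanSpace ℝ (Fin p) → Ω} {s : ℕ → Ω}

theorem fix_tail (hσ : 0 < σ) (hΨ0 : Ψ 0 = 1) (hΨs : ∀ x, Ψ (-x) = Ψ x) (hΨc : Continuous Ψ)
    (hΨb : ∀ x, |Ψ x| ≤ 1) (hZm : ∀ x, Measurable (Z x)) (hg : GaussCov P Z σ Ψ)
    (hZcont : ∀ᵐ ω' ∂P, ContinuousOn (fun x => Z x ω') Ω)
    (hs : DenseRange s) (hρ : ∀ v : Ω, ρ v = v)
    (hζ : ∀ᵐ ω ∂P, ∀ v : Ω, ζ ω v = Z v ω) {n : ℕ} {D : Fin n → EuclideanSpace ℝ (Fin p)}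
    (hD : ∀ i, D i ∈ Ω) (hK : IsUnit (kmat Ψ D).det) (c : ℝ)
    (hc : ∫ ω', (⨆ v : Ω, krigRatio Ψ D σ (fun x => Z x ω') v) ∂P ≤ c) (t : ℝ) (ht : 0 < t) :
    P {ω | c + t < statP Ψ σ s D (condP hΨc ρ D 0 (ζ ω))} ≤
      ENNReal.ofReal (Real.exp (-t ^ 2 / 2)) := by
  have hsd : ∀ v, 0 ≤ krigSd Ψ D σ v ∧ krigSd Ψ D σ v ≤ σ := fun v =>
    (kres_mom hσ hΨ0 hΨs hΨb hZm hg hK v).2.2.2.2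
  let e : ℕ ⊕ Fin n → EuclideanSpace ℝ (Fin p) :=
    Sum.elim (fun j => (s j : EuclideanSpace ℝ (Fin p))) D
  have hmeas : ∀ v, Measurable fun ω => krigRatio Ψ D σ (fun x => Z x ω) v := by
    intro v
    simp only [krigRatio_eq, kres]
    exact ((hZm v).sub (Finset.measurable_fun_sum _ fun k _ => (hZm _).const_mul _)).div_const _
  have key := gc_borell P (fun (i : ℕ ⊕ Fin n) ω => krigRatio Ψ D σ (fun x => Z x ω) (e i))
    ((kratio_gp hZm hg (xs := D)).comp_right e) (fun i => hmeas _)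
    (fun i => (kratio_mom hσ hΨ0 hΨs hΨb hZm hg hK (e i)).1)
    (fun i => (kratio_mom hσ hΨ0 hΨs hΨb hZm hg hK (e i)).2) c ?_ t ht
  · refine le_trans (le_of_eq (measure_congr ?_)) key
    filter_upwards [hζ] with ω h1
    apply propext
    show (c + t < _) ↔ (c + t < _)
    rw [statP_eq hΨc hρ s hD hΨ0 hK (ζ ω) (fun x => Z x ω) h1]
  · refine le_trans (le_of_eq (integral_congr_ae ?_)) hc
    filter_upwards [hZcont] with ω h1
    exact (kratio_sup hσ hΨ0 hΨc hK hsd s hs hD _ h1).symm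

theorem fix_indep [CompactSpace Ω]
    (hσ : 0 < σ) (hΨ0 : Ψ 0 = 1) (hΨs : ∀ x, Ψ (-x) = Ψ x) (hΨc : Continuous Ψ)
    (hΨb : ∀ x, |Ψ x| ≤ 1) (hZm : ∀ x, Measurable (Z x)) (hg : GaussCov P Z σ Ψ)
    (hs : DenseRange s) (hρ : ∀ v : Ω, ρ v = v)
    (hζ : ∀ᵐ ω ∂P, ∀ v : Ω, ζ ω v = Z v ω) {n : ℕ} {D : Fin n → EuclideanSpace ℝ (Fin p)}
    (hD : ∀ i, D i ∈ Ω) (hK : IsUnit (kmat Ψ D).det) :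
    IndepFun (fun ω => obsP ρ D (ζ ω)) (fun ω => condP hΨc ρ D 0 (ζ ω)) P := by
  obtain ⟨Φ, hΦm, hΦ⟩ := path_inv s hs
  have h := (kres_indep hσ hΨ0 hΨs hΨb hZm hg hK
    (fun j => (s j : EuclideanSpace ℝ (Fin p)))).symm.comp measurable_id hΦm
  refine h.congr ?_ ?_
  · filter_upwards [hζ] with ω h1
    ext k
    have hv : ρ (D k) = ⟨D k, hD k⟩ := hρ ⟨D k, hD k⟩
    simp only [obsP, hv, h1, Function.comp, id]
  · filter_upwards [hζ] with ω h1
    rw [← hΦ (condP hΨc ρ D 0 (ζ ω))]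
    simp only [Function.comp]
    congr 1
    ext j
    exact (condP_zero_eq hΨc hρ hD (ζ ω) (fun x => Z x ω) h1 (s j)).symm

/-- conditioned path from the data vector -/
noncomputable def condD (hΨc : Continuous Ψ) (ρ : EuclideanSpace ℝ (Fin p) → Ω) {n : ℕ}
    (q : (Fin n → EuclideanSpace ℝ (Fin p) × ℝ) × C(Ω, ℝ)) : C(Ω, ℝ) :=
  condP hΨc ρ (fun i => (q.1 i).1) (fun i => (q.1 i).2) q.2

theorem condD_meas [CompactSpace Ω] (hΨc : Continuous Ψ) (hρ : Measurable ρ) {n : ℕ} :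
    Measurable (condD hΨc ρ (n := n)) := by
  have : Measurable fun q : (Fin n → EuclideanSpace ℝ (Fin p) × ℝ) × C(Ω, ℝ) =>
      (((fun i => (q.1 i).1), (fun i => (q.1 i).2)), q.2) := by fun_prop
  exact (condP_meas hΨc hρ).comp this

theorem claim_step [StandardBorelSpace Ω'] [CompactSpace Ω] [Nonempty Ω]
    (hσ : 0 < σ) (hΨ0 : Ψ 0 = 1) (hΨs : ∀ x, Ψ (-x) = Ψ x) (hΨc : Continuous Ψ)
    (hΨb : ∀ x, |Ψ x| ≤ 1) (hZm : ∀ x, Measurable (Z x)) (hg : GaussCov P Z σ Ψ)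
    (hs : DenseRange s) (hρm : Measurable ρ) (hρ : ∀ v : Ω, ρ v = v) (hζm : Measurable ζ)
    (hζ : ∀ᵐ ω ∂P, ∀ v : Ω, ζ ω v = Z v ω)
    {pts : ℕ → Ω' → EuclideanSpace ℝ (Fin p)} (hptsΩ : ∀ i ω', pts i ω' ∈ Ω)
    {n n' : ℕ} (hnn : n ≤ n')
    (hα : Measurable (seqInfo pts Z n)) (hα' : Measurable (seqInfo pts Z n'))
    (hci : CondIndepFun (MeasurableSpace.comap (seqInfo pts Z n) inferInstance) hα.comap_le
      (fun ω' => fun i : Fin n' => pts i ω') ζ P)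
    (hK : ∀ᵐ ω ∂P, IsUnit (kmat Ψ (fun i : Fin n' => pts i ω)).det)
    (IH : ∀ G : (Fin n → EuclideanSpace ℝ (Fin p) × ℝ) × C(Ω, ℝ) → ENNReal, Measurable G →
      ∫⁻ ω, G (seqInfo pts Z n ω, ζ ω) ∂P =
        ∫⁻ ω, ∫⁻ ω', G (seqInfo pts Z n ω, condD hΨc ρ (seqInfo pts Z n ω, ζ ω')) ∂P ∂P)
    (G : (Fin n' → EuclideanSpace ℝ (Fin p) × ℝ) × C(Ω, ℝ) → ENNReal) (hG : Measurable G) :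
      ∫⁻ ω, G (seqInfo pts Z n' ω, ζ ω) ∂P =
        ∫⁻ ω, ∫⁻ ω', G (seqInfo pts Z n' ω, condD hΨc ρ (seqInfo pts Z n' ω, ζ ω')) ∂P ∂P := by
  have hβ : Measurable (fun ω' => fun i : Fin n' => pts i ω') := by
    have : Measurable fun d : Fin n' → EuclideanSpace ℝ (Fin p) × ℝ => fun i => (d i).1 := by
      fun_prop
    exact this.comp hα'
  have s1 := seq_step1 hα hβ hζm hci (condD_meas hΨc hρm) IH
  have hu : Measurable fun q : (Fin n' → EuclideanSpace ℝ (Fin p)) × C(Ω, ℝ) =>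
      condP hΨc ρ q.1 0 q.2 := by
    have : Measurable fun q : (Fin n' → EuclideanSpace ℝ (Fin p)) × C(Ω, ℝ) =>
      ((q.1, (0 : Fin n' → ℝ)), q.2) := by fun_prop
    exact (condP_meas hΨc hρm).comp this
  have hh : Measurable fun q : ((Fin n → EuclideanSpace ℝ (Fin p) × ℝ) ×
      (Fin n' → EuclideanSpace ℝ (Fin p))) × (Fin n' → ℝ) =>
      updP Ψ (Fin.castLE hnn) (fun i => (q.1.1 i).1) (fun i => (q.1.1 i).2) q.1.2 q.2 := by
    have : Measurable fun q : ((Fin n → EuclideanSpace ℝ (Fin p) × ℝ) ×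
      (Fin n' → EuclideanSpace ℝ (Fin p))) × (Fin n' → ℝ) =>
      (((fun i => (q.1.1 i).1), (fun i => (q.1.1 i).2)), (q.1.2, q.2)) := by fun_prop
    exact (updP_meas hΨc (Fin.castLE hnn)).comp this
  let G3 : ((Fin n' → EuclideanSpace ℝ (Fin p)) × (Fin n' → ℝ)) × C(Ω, ℝ) → ENNReal :=
    fun q => G (fun i => (q.1.1 i, q.1.2 i), q.2 + ∑ l, q.1.2 l • phiC Ω hΨc q.1.1 l)
  have hG3 : Measurable G3 := by
    apply hG.comp
    refine Measurable.prodMk (by fun_prop) (measurable_snd.add ?_)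
    refine Finset.measurable_fun_sum _ fun l _ => ?_
    exact Measurable.fun_smul (by fun_prop) ((phiC_meas hΨc l).comp (by fun_prop))
  have s2 := seq_step2 hα hβ hζm (condD_meas hΨc hρm) s1 (obsP_meas hρm) hu hh
    (by
      filter_upwards [hK] with ω h1 θ
      exact condP_nested hΨc hρ (fun i => hptsΩ i ω) (Fin.castLE hnn) (fun i => rfl) h1 _ θ)
    (by
      refine ae_of_all _ fun ω θ => ?_
      exact updP_eq hΨc hρ (fun i => hptsΩ i ω) (Fin.castLE hnn) (fun i => rfl) _ θ)
    (by
      filter_upwards [hK] with ω h1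
      exact fix_indep hσ hΨ0 hΨs hΨc hΨb hZm hg hs hρ hζ (fun i => hptsΩ i ω) h1)
    G3 hG3
  have hobs : ∀ᵐ ω ∂P, (fun i : Fin n' => (pts i ω,
      obsP ρ (fun i : Fin n' => pts i ω) (ζ ω) i)) = seqInfo pts Z n' ω := by
    filter_upwards [hζ] with ω h1
    ext1 i
    have hv : ρ (pts i ω) = ⟨pts i ω, hptsΩ i ω⟩ := hρ ⟨pts i ω, hptsΩ i ω⟩
    simp only [obsP, hv, h1, seqInfo]
  refine Eq.trans (lintegral_congr_ae ?_) (s2.trans (lintegral_congr_ae ?_))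
  · filter_upwards [hobs] with ω h1
    simp only [G3]
    rw [h1, ← condP_add, condP_self]
  · filter_upwards [hobs] with ω h1
    simp only [G3]
    congr 1
    ext ω'
    rw [h1, ← condP_add, ← h1]
    rfl

end fin8

set_option maxHeartbeats 1000000

/-- Theorem 2 of the paper: for any instance algorithm of abstract Bayesian optimization
(any sampling policy whose new batch is conditionally independent of the process given the
current information, and any stopping time T with 1 ≤ T < ∞ a.s.), if the constant C
satisfies the fixed-design bound `E[M] ≤ C√(p(1 ∨ log(A₀D_Ω)))` for every fixed design,
then for every t > 0, `P(M_T − C√(p(1 ∨ log(A₀D_Ω))) > t) ≤ e^{−t²/2}`, where `M_n` is the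
uniform kriging-error statistic of the design sampled through iteration n. -/
theorem stmt4 (p : ℕ) (hp : 0 < p)
    (Ω : Set (EuclideanSpace ℝ (Fin p))) (hΩc : IsCompact Ω) (hΩne : Ω.Nonempty)
    (hΩd : 0 < Metric.diam Ω)
    (Ψ Ψt : EuclideanSpace ℝ (Fin p) → ℝ) (hspec : IsSpectralDensity Ψ Ψt)
    (hA0 : Integrable (fun ω => (∑ i, |ω i|) * Ψt ω))
    (σ : ℝ) (hσ : 0 < σ)
    (Ω' : Type) [MeasurableSpace Ω'] [StandardBorelSpace Ω'] [Nonempty Ω']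
    (P : Measure Ω') [IsProbabilityMeasure P]
    (Z : EuclideanSpace ℝ (Fin p) → Ω' → ℝ) (hZmeas : ∀ x, Measurable (Z x))
    (hZcont : ∀ᵐ ω' ∂P, ContinuousOn (fun x => Z x ω') Ω)
    (hgauss : GaussCov P Z σ Ψ)
    -- the sequentially sampled points: `m n` points have been sampled after iteration n
    (m : ℕ → ℕ) (hm0 : m 0 = 0) (hmono : Monotone m)
    (pts : ℕ → Ω' → EuclideanSpace ℝ (Fin p)) (hptsΩ : ∀ i ω', pts i ω' ∈ Ω)
    (hFle : ∀ k, seqFilt pts Z m k ≤ (inferInstance : MeasurableSpace Ω'))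
    -- the policy: conditional on `F_n`, the next batch of points is independent of Z
    (hpolicy : ∀ k : ℕ, CondIndepFun (seqFilt pts Z m k) (hFle k)
      (fun ω' => fun i : Fin (m (k + 1)) => pts i ω')
      (fun ω' => fun x : EuclideanSpace ℝ (Fin p) => Z x ω') P)
    -- the stopping time
    (T : Ω' → ℕ) (hT1 : ∀ ω', 1 ≤ T ω')
    (hTstop : ∀ k, MeasurableSet[seqFilt pts Z m k] {ω' | T ω' = k})
    -- the kernel matrices of the sampled designs are a.s. invertible
    (hKinv : ∀ᵐ ω' ∂P, ∀ k, IsUnit (kmat Ψ (fun i : Fin (m k) => pts i ω')).det)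
    -- C satisfies the fixed-design bound for every fixed design
    (C : ℝ)
    (hC : ∀ (n : ℕ) (xs : Fin n → EuclideanSpace ℝ (Fin p)),
      (∀ i, xs i ∈ Ω) → IsUnit (kmat Ψ xs).det →
      (∫ ω', (⨆ v : Ω, krigRatio Ψ xs σ (fun x => Z x ω') v) ∂P) ≤
        C * Real.sqrt (p * max 1 (Real.log (A0 Ψt * Metric.diam Ω))))
    (t : ℝ) (ht : 0 < t) :
    P {ω' | C * Real.sqrt (p * max 1 (Real.log (A0 Ψt * Metric.diam Ω))) + t <
        ⨆ v : Ω, krigRatio Ψ (fun i : Fin (m (T ω')) => pts i ω') σ (fun x => Z x ω') v} ≤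
      ENNReal.ofReal (Real.exp (-t ^ 2 / 2)) := by
  obtain ⟨hΨ0, hΨs, hΨc, hΨb⟩ := ker_spec hspec
  have : CompactSpace Ω := isCompact_iff_compactSpace.mp hΩc
  have : Nonempty Ω := hΩne.to_subtype
  have hs : DenseRange (TopologicalSpace.denseSeq Ω) := TopologicalSpace.denseRange_denseSeq Ω
  generalize TopologicalSpace.denseSeq Ω = s at hs
  obtain ⟨Φ, hΦm, hΦ⟩ := path_inv s hs
  obtain ⟨ρ, hρm, hρ⟩ := retr_exists hΩc.measurableSet
  let ζ : Ω' → C(Ω, ℝ) := fun ω => Φ (fun j => Z (s j) ω)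
  have hζm : Measurable ζ := hΦm.comp (measurable_pi_lambda _ fun j => hZmeas _)
  have hζ : ∀ᵐ ω ∂P, ∀ v : Ω, ζ ω v = Z v ω := by
    filter_upwards [hZcont] with ω h1 v
    let θ : C(Ω, ℝ) := ⟨fun v => Z v ω, h1.domRestrict⟩
    have : ζ ω = θ := hΦ θ
    rw [this]; rfl
  have hαm : ∀ k, Measurable (seqInfo pts Z (m k)) := fun k =>
    measurable_iff_comap_le.mpr (hFle k)
  have claim : ∀ k, ∀ G : (Fin (m k) → EuclideanSpace ℝ (Fin p) × ℝ) × C(Ω, ℝ) → ENNReal,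
      Measurable G → ∫⁻ ω, G (seqInfo pts Z (m k) ω, ζ ω) ∂P =
        ∫⁻ ω, ∫⁻ ω', G (seqInfo pts Z (m k) ω,
          condD hΨc ρ (seqInfo pts Z (m k) ω, ζ ω')) ∂P ∂P := by
    intro k
    induction k with
    | zero =>
      intro G hG
      have : IsEmpty (Fin (m 0)) := by rw [hm0]; infer_instance
      have h1 : ∀ ω ω', condD hΨc ρ (seqInfo pts Z (m 0) ω, ζ ω') = ζ ω' := by
        intro ω ω'
        simp [condD, condP]
      have h2 : ∀ ω ω', seqInfo pts Z (m 0) ω = seqInfo pts Z (m 0) ω' :=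
        fun ω ω' => Subsingleton.elim _ _
      simp only [h1]
      have h3 : ∀ ω, ∫⁻ ω', G (seqInfo pts Z (m 0) ω, ζ ω') ∂P =
          ∫⁻ ω', G (seqInfo pts Z (m 0) ω', ζ ω') ∂P := by
        intro ω
        congr 1; ext ω'
        rw [h2 ω ω']
      simp only [h3]
      simp
    | succ k ih =>
      intro G hG
      have hci : CondIndepFun (seqFilt pts Z m k) (hFle k)
          (fun ω' => fun i : Fin (m (k + 1)) => pts i ω') ζ P := by
        have hψ : Measurable fun f : EuclideanSpace ℝ (Fin p) → ℝ =>
            Φ (fun j => f (s j)) := hΦm.comp (by fun_prop)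
        exact (hpolicy k).comp measurable_id hψ
      exact claim_step hσ hΨ0 hΨs hΨc hΨb hZmeas hgauss hs hρm hρ hζm hζ hptsΩ
        (hmono (Nat.le_succ k)) (hαm k) (hαm (k + 1)) hci
        (hKinv.mono fun ω h => h (k + 1)) ih G hG
  set c : ℝ := C * Real.sqrt (p * max 1 (Real.log (A0 Ψt * Metric.diam Ω))) with hcdef
  have each : ∀ k, P {ω' | T ω' = k ∧ c + t < ⨆ v : Ω,
      krigRatio Ψ (fun i : Fin (m (T ω')) => pts i ω') σ (fun x => Z x ω') v} ≤
      ENNReal.ofReal (Real.exp (-t ^ 2 / 2)) * P {ω' | T ω' = k} := by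
    intro k
    obtain ⟨A, hA, hAT⟩ := hTstop k
    have hTm : MeasurableSet {ω' | T ω' = k} := hFle k _ (hTstop k)
    have hdm : Measurable fun d : Fin (m k) → EuclideanSpace ℝ (Fin p) × ℝ => fun i => (d i).1 := by
      fun_prop
    let S : (Fin (m k) → EuclideanSpace ℝ (Fin p) × ℝ) × C(Ω, ℝ) → ℝ := fun q =>
      statP Ψ σ s (fun i => (q.1 i).1) (condP hΨc ρ (fun i => (q.1 i).1) 0 q.2)
    have hS : Measurable S := by
      have h0 : Measurable fun q : (Fin (m k) → EuclideanSpace ℝ (Fin p) × ℝ) × C(Ω, ℝ) =>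
          (((fun i => (q.1 i).1), (0 : Fin (m k) → ℝ)), q.2) := by fun_prop
      have h1 := (condP_meas hΨc hρm).comp h0
      exact (statP_meas hΨc σ s).comp ((hdm.comp measurable_fst).prodMk h1)
    let B : Set ((Fin (m k) → EuclideanSpace ℝ (Fin p) × ℝ) × C(Ω, ℝ)) :=
      {q | q.1 ∈ A ∧ c + t < S q}
    have hB : MeasurableSet B :=
      (measurable_fst hA).inter (measurableSet_lt measurable_const hS)
    have hgoodsd : ∀ ω, IsUnit (kmat Ψ (fun i : Fin (m k) => pts i ω)).det → ∀ v,
        0 ≤ krigSd Ψ (fun i : Fin (m k) => pts i ω) σ v ∧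
        krigSd Ψ (fun i : Fin (m k) => pts i ω) σ v ≤ σ := fun ω hK v =>
      (kres_mom hσ hΨ0 hΨs hΨb hZmeas hgauss hK v).2.2.2.2
    have e1 : P {ω' | T ω' = k ∧ c + t < ⨆ v : Ω,
        krigRatio Ψ (fun i : Fin (m (T ω')) => pts i ω') σ (fun x => Z x ω') v} =
        ∫⁻ ω, B.indicator 1 (seqInfo pts Z (m k) ω, ζ ω) ∂P := by
      have hpm : Measurable fun ω => (seqInfo pts Z (m k) ω, ζ ω) := (hαm k).prodMk hζm
      have : ∀ ω, B.indicator (1 : (Fin (m k) → EuclideanSpace ℝ (Fin p) × ℝ) × C(Ω, ℝ) → ENNReal) (seqInfo pts Z (m k) ω, ζ ω) =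
          ((fun ω => (seqInfo pts Z (m k) ω, ζ ω)) ⁻¹' B).indicator 1 ω := fun ω => rfl
      simp only [this]
      rw [lintegral_indicator_one (hpm hB)]
      apply measure_congr
      filter_upwards [hζ, hZcont, hKinv] with ω h1 h2 h3
      apply propext
      show (T ω = k ∧ _) ↔ (seqInfo pts Z (m k) ω ∈ A ∧ _)
      have hTA : seqInfo pts Z (m k) ω ∈ A ↔ T ω = k := by
        change ω ∈ (seqInfo pts Z (m k)) ⁻¹' A ↔ ω ∈ {ω' | T ω' = k}
        rw [hAT]
      rw [hTA]
      refine and_congr_right fun hTk => ?_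
      have hS1 : S (seqInfo pts Z (m k) ω, ζ ω) =
          ⨆ v : Ω, krigRatio Ψ (fun i : Fin (m k) => pts i ω) σ (fun x => Z x ω) v := by
        rw [kratio_sup hσ hΨ0 hΨc (h3 k) (hgoodsd ω (h3 k)) s hs (fun i => hptsΩ i ω) _ h2]
        exact statP_eq hΨc hρ s (fun i => hptsΩ i ω) hΨ0 (h3 k) (ζ ω) (fun x => Z x ω) h1
      show _ ↔ c + t < S (seqInfo pts Z (m k) ω, ζ ω)
      rw [hS1, hTk]
    rw [e1, claim k _ (measurable_one.indicator hB)]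
    calc ∫⁻ ω, ∫⁻ ω', B.indicator 1 (seqInfo pts Z (m k) ω,
          condD hΨc ρ (seqInfo pts Z (m k) ω, ζ ω')) ∂P ∂P
        ≤ ∫⁻ ω, ({ω' | T ω' = k}).indicator
            (fun _ => ENNReal.ofReal (Real.exp (-t ^ 2 / 2))) ω ∂P := by
          apply lintegral_mono_ae
          filter_upwards [hKinv] with ω h3
          have hTA : seqInfo pts Z (m k) ω ∈ A ↔ T ω = k := by
            change ω ∈ (seqInfo pts Z (m k)) ⁻¹' A ↔ ω ∈ {ω' | T ω' = k}
            rw [hAT]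
          by_cases hT : T ω = k
          · rw [Set.indicator_of_mem (show ω ∈ {ω' | T ω' = k} from hT)]
            have hnest : ∀ ω', S (seqInfo pts Z (m k) ω,
                condD hΨc ρ (seqInfo pts Z (m k) ω, ζ ω')) =
                statP Ψ σ s (fun i : Fin (m k) => pts i ω)
                  (condP hΨc ρ (fun i : Fin (m k) => pts i ω) 0 (ζ ω')) := by
              intro ω'
              show statP _ _ _ _ (condP hΨc ρ (fun i : Fin (m k) => pts i ω) 0 _) = _
              congr 1
              exact condP_nested hΨc hρ (fun i => hptsΩ i ω) id (fun i => rfl) (h3 k) _ _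
            have ftm : Measurable fun ω' => statP Ψ σ s (fun i : Fin (m k) => pts i ω)
                  (condP hΨc ρ (fun i : Fin (m k) => pts i ω) 0 (ζ ω')) := by
              have h0 : Measurable fun ω' : Ω' => (seqInfo pts Z (m k) ω, ζ ω') :=
                measurable_const.prodMk hζm
              exact hS.comp h0
            have hm1 : MeasurableSet {ω' | c + t < statP Ψ σ s (fun i : Fin (m k) => pts i ω)
                  (condP hΨc ρ (fun i : Fin (m k) => pts i ω) 0 (ζ ω'))} :=
              measurableSet_lt measurable_const ftm
            have hin : ∀ ω', B.indicator (1 : (Fin (m k) → EuclideanSpace ℝ (Fin p) × ℝ) × C(Ω, ℝ) → ENNReal) (seqInfo pts Z (m k) ω,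
                condD hΨc ρ (seqInfo pts Z (m k) ω, ζ ω')) =
                ({ω' | c + t < statP Ψ σ s (fun i : Fin (m k) => pts i ω)
                  (condP hΨc ρ (fun i : Fin (m k) => pts i ω) 0 (ζ ω'))}).indicator 1 ω' := by
              intro ω'
              apply Set.indicator_eq_indicator
              · show (seqInfo pts Z (m k) ω ∈ A ∧ c + t < S _) ↔ _
                rw [hnest ω', hTA]
                simp [hT]
              · rfl
            simp only [hin]
            rw [lintegral_indicator_one hm1]
            exact fix_tail hσ hΨ0 hΨs hΨc hΨb hZmeas hgauss hZcont hs hρ hζ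
              (fun i => hptsΩ i ω) (h3 k) c (hC _ _ (fun i => hptsΩ i ω) (h3 k)) t ht
          · rw [Set.indicator_of_notMem (show ω ∉ {ω' | T ω' = k} from hT)]
            have hz : ∀ ω', B.indicator (1 : (Fin (m k) → EuclideanSpace ℝ (Fin p) × ℝ) × C(Ω, ℝ) → ENNReal) (seqInfo pts Z (m k) ω,
                condD hΨc ρ (seqInfo pts Z (m k) ω, ζ ω')) = 0 := fun ω' =>
              Set.indicator_of_notMem (fun h => hT (hTA.mp h.1)) _
            simp only [hz]
            simp
      _ = _ := by
          rw [lintegral_indicator hTm]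
          simp
  have hU : {ω' | c + t < ⨆ v : Ω,
      krigRatio Ψ (fun i : Fin (m (T ω')) => pts i ω') σ (fun x => Z x ω') v} =
      ⋃ k, {ω' | T ω' = k ∧ c + t < ⨆ v : Ω,
      krigRatio Ψ (fun i : Fin (m (T ω')) => pts i ω') σ (fun x => Z x ω') v} := by
    ext ω; simp
  rw [hU]
  refine (measure_iUnion_le _).trans ((ENNReal.tsum_le_tsum each).trans ?_)
  rw [ENNReal.tsum_mul_left]
  have hsum : ∑' k, P {ω' | T ω' = k} = 1 := by
    rw [← measure_iUnion]
    · rw [show (⋃ k, {ω' | T ω' = k}) = Set.univ by ext ω; simp]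
      exact measure_univ
    · intro i j hij
      refine Set.disjoint_left.mpr fun ω h1 h2 => hij ?_
      exact (show T ω = i from h1).symm.trans h2
    · intro k
      exact hFle k _ (hTstop k)
  rw [hsum, mul_one]
end

section
/- There exists a universal constant η₁ such that the following holds. For any closed deterministic subset A ⊆ Ω with σ_A := sup_{x∈A} σ(x) > 0, and any u > 0, with probability at least 1 − exp(−u²/(2σ_A²)): sup_{x∈A} (Z(x) − μ(x)) ≤ η₁ σ_A √(p (1 ∨ log(A₀ D_Ω))) √(log(eσ/σ_A)) + u. -/
open MeasureTheory ProbabilityTheory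
open scoped RealInnerProductSpace

lemma net_exists {p : ℕ} (Ω A : Set (EuclideanSpace ℝ (Fin p))) (hΩ : IsCompact Ω)
    (hD : 0 < Metric.diam Ω) (hA : A ⊆ Ω) (m : ℕ) (hm : 0 < m) :
    ∃ S : Finset (EuclideanSpace ℝ (Fin p)), (∀ x ∈ S, x ∈ A) ∧
      S.card ≤ (2 * m + 1) ^ p ∧
      ∀ x ∈ A, ∃ y ∈ S, ∀ i, |x i - y i| ≤ Metric.diam Ω / m := by
  classical
  rcases A.eq_empty_or_nonempty with rfl | ⟨x0, hx0⟩
  · exact ⟨∅, by simp, by simp, by simp⟩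
  have hmR : (0 : ℝ) < m := by exact_mod_cast hm
  set D := Metric.diam Ω with hDdef
  let c : EuclideanSpace ℝ (Fin p) → (Fin p → ℤ) := fun x i => ⌊(m : ℝ) * (x i - x0 i) / D⌋
  let F : Finset (Fin p → ℤ) := Fintype.piFinset fun _ => Finset.Icc (-(m : ℤ)) m
  have hcF : ∀ x ∈ A, c x ∈ F := by
    intro x hx
    simp only [F, Fintype.mem_piFinset, Finset.mem_Icc, c]
    intro i
    have h1 : |x i - x0 i| ≤ D := by
      have := Metric.dist_le_diam_of_mem hΩ.isBounded (hA hx) (hA hx0)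
      rw [dist_eq_norm] at this
      have h2 := PiLp.norm_apply_le (x - x0) i
      simp only [PiLp.sub_apply, Real.norm_eq_abs] at h2
      exact h2.trans this
    rw [abs_le] at h1
    constructor
    · rw [Int.le_floor, le_div_iff₀ hD]
      push_cast
      nlinarith
    · have : ((⌊(m : ℝ) * (x i - x0 i) / D⌋ : ℤ) : ℝ) ≤ (m : ℤ) := by
        refine (Int.floor_le _).trans ?_
        rw [div_le_iff₀ hD]
        push_cast
        nlinarith
      exact_mod_cast this
  obtain ⟨s, hsA, hbij⟩ := Set.exists_subset_bijOn A c
  have hsfin : s.Finite := by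
    refine Set.Finite.of_finite_image ?_ hbij.injOn
    refine (F.finite_toSet).subset ?_
    rintro _ ⟨x, hx, rfl⟩
    exact hcF x (hsA hx)
  refine ⟨hsfin.toFinset, ?_, ?_, ?_⟩
  · intro x hx
    exact hsA (by simpa using hx)
  · have h1 : hsfin.toFinset.card ≤ F.card := by
      refine Finset.card_le_card_of_injOn c ?_ ?_
      · intro x hx
        exact hcF x (hsA (by simpa using hx))
      · simpa using hbij.injOn
    refine h1.trans ?_
    simp only [F, Fintype.card_piFinset, Int.card_Icc, Finset.prod_const, Finset.card_univ,
      Fintype.card_fin]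
    apply Nat.pow_le_pow_left
    omega
  · intro x hx
    obtain ⟨y, hy, hyx⟩ := hbij.surjOn (Set.mem_image_of_mem c hx)
    refine ⟨y, by simpa using hy, fun i => ?_⟩
    have h := congrFun hyx i
    have h2 := Int.abs_sub_lt_one_of_floor_eq_floor h
    have h3 : (m : ℝ) * (y i - x0 i) / D - (m : ℝ) * (x i - x0 i) / D
      = (y i - x i) * (m / D) := by ring
    rw [h3, abs_mul, abs_of_pos (div_pos hmR hD), ← lt_div_iff₀ (div_pos hmR hD)] at h2
    rw [abs_sub_comm]
    refine h2.le.trans (le_of_eq ?_)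
    field_simp

lemma gauss_tail {Ω' : Type} [MeasurableSpace Ω'] (P : Measure Ω') [IsProbabilityMeasure P]
    (X : Ω' → ℝ) (hX : Measurable X) (v : ℝ) (h : P.map X = gaussianReal 0 v.toNNReal)
    (s t : ℝ) (hs : 0 < s) (hv : v ≤ s ^ 2) (ht : 0 ≤ t) :
    P {ω | t ≤ X ω} ≤ ENNReal.ofReal (Real.exp (-t ^ 2 / (2 * s ^ 2))) := by
  have hlam : 0 ≤ t / s ^ 2 := by positivity
  have hint : Integrable (fun ω => Real.exp (t / s ^ 2 * X ω)) P := by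
    have h1 := integrable_exp_mul_gaussianReal (μ := 0) (v := v.toNNReal) (t / s ^ 2)
    rw [← h] at h1
    exact h1.comp_measurable hX
  have h1 := measure_ge_le_exp_mul_mgf (μ := P) (X := X) t hlam hint
  rw [mgf_gaussianReal h] at h1
  rw [← ENNReal.ofReal_toReal (measure_ne_top P {ω | t ≤ X ω})]
  apply ENNReal.ofReal_le_ofReal
  refine h1.trans ?_
  rw [← Real.exp_add, Real.exp_le_exp]
  have hv' : ((v.toNNReal : NNReal) : ℝ) ≤ s ^ 2 := by
    rw [Real.coe_toNNReal']
    exact max_le hv (by positivity)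
  have : ((v.toNNReal : NNReal) : ℝ) * (t / s ^ 2) ^ 2 / 2 ≤ s ^ 2 * (t / s ^ 2) ^ 2 / 2 := by
    gcongr
  have e : -(t / s ^ 2) * t + s ^ 2 * (t / s ^ 2) ^ 2 / 2 = -t ^ 2 / (2 * s ^ 2) := by
    field_simp; ring
  linarith

section spec
variable {p : ℕ} {Ψ Ψt : EuclideanSpace ℝ (Fin p) → ℝ}

lemma spec_int (h : IsSpectralDensity Ψ Ψt) (f : EuclideanSpace ℝ (Fin p) → ℝ)
    (hf : Continuous f) (C : ℝ) (hC : ∀ x, |f x| ≤ C) : Integrable (fun ω => f ω * Ψt ω) :=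
  h.2.1.bdd_mul hf.aestronglyMeasurable (Filter.Eventually.of_forall fun x => by simpa using hC x)

lemma spec_int_cos (h : IsSpectralDensity Ψ Ψt) (v : EuclideanSpace ℝ (Fin p)) :
    Integrable (fun ω => Real.cos ⟪ω, v⟫ * Ψt ω) :=
  spec_int h _ (by fun_prop) 1 (fun x => Real.abs_cos_le_one _)

lemma spec_zero (h : IsSpectralDensity Ψ Ψt) : Ψ 0 = 1 := by
  rw [h.2.2.2]; simpa using h.2.2.1

lemma spec_neg (h : IsSpectralDensity Ψ Ψt) (v : EuclideanSpace ℝ (Fin p)) : Ψ (-v) = Ψ v := by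
  rw [h.2.2.2, h.2.2.2]; simp

lemma spec_cont (h : IsSpectralDensity Ψ Ψt) : Continuous Ψ := by
  have : Ψ = fun v => ∫ ω, Real.cos ⟪ω, v⟫ * Ψt ω := funext h.2.2.2
  rw [this]
  refine continuous_of_dominated (bound := fun ω => |Ψt ω|) ?_ ?_ ?_ ?_
  · intro v; exact (spec_int_cos h v).aestronglyMeasurable
  · intro v
    refine Filter.Eventually.of_forall fun ω => ?_
    rw [Real.norm_eq_abs, abs_mul]
    exact mul_le_of_le_one_left (abs_nonneg _) (Real.abs_cos_le_one _)
  · exact h.2.1.abs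
  · refine Filter.Eventually.of_forall fun ω => ?_
    fun_prop

lemma spec_lip (h : IsSpectralDensity Ψ Ψt)
    (hI : Integrable (fun ω => (∑ i, |ω i|) * Ψt ω)) (v : EuclideanSpace ℝ (Fin p)) (r : ℝ)
    (hr : ∀ i, |v i| ≤ r) : 1 - Ψ v ≤ A0 Ψt * r := by
  rw [h.2.2.2, ← h.2.2.1, ← integral_sub h.2.1 (spec_int_cos h v), A0, ← integral_mul_const]
  refine integral_mono (h.2.1.sub (spec_int_cos h v)) (hI.mul_const r) ?_
  intro ω
  have h1 : 1 - Real.cos ⟪ω, v⟫ ≤ (∑ i, |ω i|) * r := by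
    have h2 : |⟪ω, v⟫| ≤ (∑ i, |ω i|) * r := by
      rw [PiLp.inner_apply, Finset.sum_mul]
      refine (Finset.abs_sum_le_sum_abs _ _).trans (Finset.sum_le_sum fun i _ => ?_)
      simp only [RCLike.inner_apply, conj_trivial, abs_mul]
      rw [mul_comm]
      exact mul_le_mul_of_nonneg_left (hr i) (abs_nonneg _)
    refine le_trans ?_ h2
    have a1 := Real.one_sub_sq_div_two_le_cos (x := ⟪ω, v⟫)
    have a2 := Real.neg_one_le_cos ⟪ω, v⟫
    rcases le_or_gt |⟪ω, v⟫| 2 with h3 | h3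
    · rw [← sq_abs] at a1
      nlinarith [abs_nonneg ⟪ω, v⟫]
    · linarith
  have := mul_le_mul_of_nonneg_right h1 (h.1 ω)
  simp only
  linarith

lemma spec_psd (h : IsSpectralDensity Ψ Ψt) {n : ℕ} (c : Fin n → ℝ)
    (y : Fin n → EuclideanSpace ℝ (Fin p)) : 0 ≤ ∑ i, ∑ j, c i * c j * Ψ (y i - y j) := by
  have : ∑ i, ∑ j, c i * c j * Ψ (y i - y j) =
      ∫ ω, ((∑ i, c i * Real.cos ⟪ω, y i⟫) ^ 2 + (∑ i, c i * Real.sin ⟪ω, y i⟫) ^ 2) * Ψt ω := by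
    have e : ∀ ω : EuclideanSpace ℝ (Fin p),
        ((∑ i, c i * Real.cos ⟪ω, y i⟫) ^ 2 + (∑ i, c i * Real.sin ⟪ω, y i⟫) ^ 2) * Ψt ω
        = ∑ i, ∑ j, c i * c j * (Real.cos ⟪ω, y i - y j⟫ * Ψt ω) := by
      intro ω
      rw [sq, sq, Finset.sum_mul_sum, Finset.sum_mul_sum, ← Finset.sum_add_distrib,
        Finset.sum_mul]
      refine Finset.sum_congr rfl fun i _ => ?_
      rw [← Finset.sum_add_distrib, Finset.sum_mul]
      refine Finset.sum_congr rfl fun j _ => ?_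
      rw [inner_sub_right, Real.cos_sub]
      ring
    simp_rw [e]
    rw [integral_finsetSum _ (fun i _ =>
      integrable_finsetSum _ fun j _ => (spec_int_cos h _).const_mul _)]
    refine Finset.sum_congr rfl fun i _ => ?_
    rw [integral_finsetSum _ (fun j _ => (spec_int_cos h _).const_mul _)]
    refine Finset.sum_congr rfl fun j _ => ?_
    rw [integral_const_mul, h.2.2.2]
  rw [this]
  exact integral_nonneg fun ω => mul_nonneg (by positivity) (h.1 ω)
end spec

section kr
variable {p n : ℕ} {Ψ Ψt : EuclideanSpace ℝ (Fin p) → ℝ}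

noncomputable def krQ (Ψ : EuclideanSpace ℝ (Fin p) → ℝ)
    (xs : Fin n → EuclideanSpace ℝ (Fin p)) (ρ : Fin n → ℝ) : ℝ :=
  ∑ j, ∑ k, ρ j * (kmat Ψ xs)⁻¹ j k * ρ k

lemma kr_key (xs : Fin n → EuclideanSpace ℝ (Fin p)) (hdet : IsUnit (kmat Ψ xs).det)
    (ρ w : Fin n → ℝ) (hw : ∀ k, w k = ∑ j, ρ j * (kmat Ψ xs)⁻¹ j k) (l : Fin n) :
    ∑ k, w k * Ψ (xs k - xs l) = ρ l := by
  have hw' : w = Matrix.vecMul ρ (kmat Ψ xs)⁻¹ := by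
    ext k; rw [hw]; rfl
  have h1 : Matrix.vecMul w (kmat Ψ xs) = ρ := by
    rw [hw', Matrix.vecMul_vecMul, Matrix.nonsing_inv_mul _ hdet, Matrix.vecMul_one]
  exact congrFun h1 l

lemma kr_Qw (xs : Fin n → EuclideanSpace ℝ (Fin p))
    (ρ w : Fin n → ℝ) (hw : ∀ k, w k = ∑ j, ρ j * (kmat Ψ xs)⁻¹ j k) :
    krQ Ψ xs ρ = ∑ k, w k * ρ k := by
  rw [krQ, Finset.sum_comm]
  refine Finset.sum_congr rfl fun k _ => ?_
  rw [hw, Finset.sum_mul]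

lemma kr_Qww (xs : Fin n → EuclideanSpace ℝ (Fin p)) (hdet : IsUnit (kmat Ψ xs).det)
    (ρ w : Fin n → ℝ) (hw : ∀ k, w k = ∑ j, ρ j * (kmat Ψ xs)⁻¹ j k) :
    ∑ k, ∑ l, w k * w l * Ψ (xs k - xs l) = krQ Ψ xs ρ := by
  rw [kr_Qw xs ρ w hw, Finset.sum_comm]
  refine Finset.sum_congr rfl fun l _ => ?_
  rw [← kr_key xs hdet ρ w hw l, Finset.mul_sum]
  refine Finset.sum_congr rfl fun k _ => ?_
  ring

lemma kr_Q_nonneg (h : IsSpectralDensity Ψ Ψt) (xs : Fin n → EuclideanSpace ℝ (Fin p))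
    (hdet : IsUnit (kmat Ψ xs).det) (ρ : Fin n → ℝ) : 0 ≤ krQ Ψ xs ρ := by
  rw [← kr_Qww xs hdet ρ _ (fun k => rfl)]
  exact spec_psd h _ _

lemma kr_law (h : IsSpectralDensity Ψ Ψt) (xs : Fin n → EuclideanSpace ℝ (Fin p))
    (hdet : IsUnit (kmat Ψ xs).det) {Ω' : Type} [MeasurableSpace Ω'] (P : Measure Ω')
    (Z : EuclideanSpace ℝ (Fin p) → Ω' → ℝ) (σ : ℝ) (hG : GaussCov P Z σ Ψ)
    (x y : EuclideanSpace ℝ (Fin p)) (α β : ℝ) :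
    P.map (fun ω => α * (Z x ω - kinterp Ψ xs (fun x => Z x ω) x)
      + β * (Z y ω - kinterp Ψ xs (fun x => Z x ω) y)) =
    gaussianReal 0 (σ ^ 2 * (α ^ 2 + β ^ 2 + 2 * α * β * Ψ (x - y)
      - krQ Ψ xs (fun j => α * Ψ (x - xs j) + β * Ψ (y - xs j)))).toNNReal := by
  set ρ : Fin n → ℝ := fun j => α * Ψ (x - xs j) + β * Ψ (y - xs j) with hρ
  obtain ⟨w, hw⟩ : ∃ w : Fin n → ℝ, ∀ k, w k = ∑ j, ρ j * (kmat Ψ xs)⁻¹ j k := ⟨_, fun k => rfl⟩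
  have hh := hG (n + 2) (Fin.cons α (Fin.cons β (fun k => - w k)))
    (Fin.cons x (Fin.cons y xs))
  have e1 : ∀ ω, ∑ i, (Fin.cons α (Fin.cons β (fun k => - w k)) : Fin (n + 2) → ℝ) i
      * Z ((Fin.cons x (Fin.cons y xs) : Fin (n + 2) → EuclideanSpace ℝ (Fin p)) i) ω
      = α * (Z x ω - kinterp Ψ xs (fun x => Z x ω) x)
      + β * (Z y ω - kinterp Ψ xs (fun x => Z x ω) y) := by
    intro ω
    simp only [Fin.sum_univ_succ, Fin.cons_zero, Fin.cons_succ]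
    have : ∑ k, - w k * Z (xs k) ω = - (α * kinterp Ψ xs (fun x => Z x ω) x
        + β * kinterp Ψ xs (fun x => Z x ω) y) := by
      simp only [kinterp]
      rw [Finset.sum_comm (f := fun j k => Ψ (x - xs j) * (kmat Ψ xs)⁻¹ j k * Z (xs k) ω),
        Finset.sum_comm (f := fun j k => Ψ (y - xs j) * (kmat Ψ xs)⁻¹ j k * Z (xs k) ω),
        Finset.mul_sum, Finset.mul_sum, ← Finset.sum_add_distrib, ← Finset.sum_neg_distrib]
      refine Finset.sum_congr rfl fun k _ => ?_
      rw [hw, Finset.mul_sum, Finset.mul_sum, ← Finset.sum_add_distrib, neg_mul, Finset.sum_mul]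
      congr 1
      refine Finset.sum_congr rfl fun j _ => ?_
      simp only [hρ]; ring
    rw [this]; ring
  simp only [e1] at hh
  rw [hh]
  congr 2
  simp only [Fin.sum_univ_succ, Fin.cons_zero, Fin.cons_succ, sub_self, spec_zero h]
  have e2 : krQ Ψ xs ρ = α * ∑ k, w k * Ψ (x - xs k) + β * ∑ k, w k * Ψ (y - xs k) := by
    rw [kr_Qw xs ρ w hw, Finset.mul_sum, Finset.mul_sum, ← Finset.sum_add_distrib]
    refine Finset.sum_congr rfl fun k _ => ?_
    simp only [hρ]; ring
  have e3 : ∀ (γ : ℝ) (z : EuclideanSpace ℝ (Fin p)),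
      ∑ k, γ * - w k * (σ ^ 2 * Ψ (z - xs k)) = - (γ * σ ^ 2 * ∑ k, w k * Ψ (z - xs k)) := by
    intro γ z
    rw [Finset.mul_sum, ← Finset.sum_neg_distrib]
    refine Finset.sum_congr rfl fun k _ => ?_
    ring
  have e4 : ∑ k, (- w k * α * (σ ^ 2 * Ψ (xs k - x)) + (- w k * β * (σ ^ 2 * Ψ (xs k - y))
      + ∑ l, - w k * - w l * (σ ^ 2 * Ψ (xs k - xs l)))) =
      - (α * σ ^ 2 * ∑ k, w k * Ψ (x - xs k)) - (β * σ ^ 2 * ∑ k, w k * Ψ (y - xs k))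
      + σ ^ 2 * krQ Ψ xs ρ := by
    rw [← kr_Qww xs hdet ρ w hw]
    simp only [Finset.mul_sum]
    rw [← Finset.sum_neg_distrib, ← Finset.sum_sub_distrib, ← Finset.sum_add_distrib]
    refine Finset.sum_congr rfl fun k _ => ?_
    rw [← spec_neg h (xs k - x), ← spec_neg h (xs k - y), neg_sub, neg_sub]
    have : ∑ l, - w k * - w l * (σ ^ 2 * Ψ (xs k - xs l))
      = ∑ l, σ ^ 2 * (w k * w l * Ψ (xs k - xs l)) :=
      Finset.sum_congr rfl fun l _ => by ring
    rw [this]; ring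
  rw [e3, e3, e4, ← spec_neg h (y - x), neg_sub, e2]
  ring

lemma kr_tail1 (h : IsSpectralDensity Ψ Ψt) (xs : Fin n → EuclideanSpace ℝ (Fin p))
    (hdet : IsUnit (kmat Ψ xs).det) {Ω' : Type} [MeasurableSpace Ω'] (P : Measure Ω')
    [IsProbabilityMeasure P]
    (Z : EuclideanSpace ℝ (Fin p) → Ω' → ℝ) (hZ : ∀ x, Measurable (Z x))
    (σ : ℝ) (hσ : 0 < σ) (hG : GaussCov P Z σ Ψ)
    (x : EuclideanSpace ℝ (Fin p)) (s t : ℝ) (hs : 0 < s) (ht : 0 ≤ t)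
    (hx : krigSd Ψ xs σ x ≤ s) :
    P {ω | t ≤ Z x ω - kinterp Ψ xs (fun x => Z x ω) x} ≤
      ENNReal.ofReal (Real.exp (-t ^ 2 / (2 * s ^ 2))) := by
  have hl := kr_law h xs hdet P Z σ hG x x 1 0
  simp only [one_mul, zero_mul, add_zero] at hl
  refine gauss_tail P _ ?_ _ hl s t hs ?_ ht
  · unfold kinterp; fun_prop
  · have h0 : 0 ≤ krigSd Ψ xs σ x := mul_nonneg hσ.le (Real.sqrt_nonneg _)
    have h1 : krigSd Ψ xs σ x ^ 2 ≤ s ^ 2 := by gcongr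
    refine le_trans ?_ h1
    rw [krigSd, mul_pow]
    refine mul_le_mul_of_nonneg_left ?_ (by positivity)
    rw [Real.sq_sqrt']
    refine le_trans (le_of_eq ?_) (le_max_left _ _)
    simp [krQ]

lemma kr_tail2 (h : IsSpectralDensity Ψ Ψt)
    (hI : Integrable (fun ω => (∑ i, |ω i|) * Ψt ω)) (xs : Fin n → EuclideanSpace ℝ (Fin p))
    (hdet : IsUnit (kmat Ψ xs).det) {Ω' : Type} [MeasurableSpace Ω'] (P : Measure Ω')
    [IsProbabilityMeasure P]
    (Z : EuclideanSpace ℝ (Fin p) → Ω' → ℝ) (hZ : ∀ x, Measurable (Z x))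
    (σ : ℝ) (hG : GaussCov P Z σ Ψ)
    (x y : EuclideanSpace ℝ (Fin p)) (s t r : ℝ) (hs : 0 < s) (ht : 0 ≤ t)
    (hr : ∀ i, |x i - y i| ≤ r) (hrs : 2 * σ ^ 2 * (A0 Ψt * r) ≤ s ^ 2) :
    P {ω | t ≤ (Z x ω - kinterp Ψ xs (fun x => Z x ω) x)
        - (Z y ω - kinterp Ψ xs (fun x => Z x ω) y)} ≤
      ENNReal.ofReal (Real.exp (-t ^ 2 / (2 * s ^ 2))) := by
  have hl := kr_law h xs hdet P Z σ hG x y 1 (-1)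
  have e : ∀ a b : ℝ, 1 * a + (-1) * b = a - b := fun a b => by ring
  simp only [e] at hl
  refine gauss_tail P _ ?_ _ hl s t hs ?_ ht
  · unfold kinterp; fun_prop
  · have h1 := spec_lip h hI (x - y) r (by simpa using hr)
    have h2 := kr_Q_nonneg h xs hdet (fun j => 1 * Ψ (x - xs j) + (-1) * Ψ (y - xs j))
    simp only [e] at h2
    nlinarith [sq_nonneg σ, mul_le_mul_of_nonneg_left h1 (sq_nonneg σ),
      mul_nonneg (sq_nonneg σ) h2]

lemma kr_sd_le (h : IsSpectralDensity Ψ Ψt) (xs : Fin n → EuclideanSpace ℝ (Fin p))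
    (hdet : IsUnit (kmat Ψ xs).det) (σ : ℝ) (hσ : 0 < σ) (x : EuclideanSpace ℝ (Fin p)) :
    krigSd Ψ xs σ x ≤ σ := by
  rw [krigSd]
  refine mul_le_of_le_one_right hσ.le ?_
  refine Real.sqrt_le_iff.2 ⟨zero_le_one, ?_⟩
  have := kr_Q_nonneg h xs hdet (fun j => Ψ (x - xs j))
  rw [krQ] at this
  linarith
end kr

lemma sum_aux (K : ℕ) : ∑ k ∈ Finset.range K, ((k : ℝ) + 1) / 2 ^ k ≤ 4 := by
  have : ∑ k ∈ Finset.range K, ((k : ℝ) + 1) / 2 ^ k = 4 - 2 * ((K : ℝ) + 2) / 2 ^ K := by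
    induction K with
    | zero => norm_num
    | succ K ih =>
      rw [Finset.sum_range_succ, ih]
      push_cast
      field_simp
      ring
  rw [this]
  have : 0 ≤ 2 * ((K : ℝ) + 2) / 2 ^ K := by positivity
  linarith

/-- Chaining with union bounds. -/
lemma chain {E : Type*} [TopologicalSpace E] {Ω' : Type} [MeasurableSpace Ω'] (P : Measure Ω')
    [IsProbabilityMeasure P] (W : E → Ω' → ℝ) (A : Set E) (hA : A.Nonempty)
    (hcont : ∀ᵐ ω ∂P, ContinuousOn (fun x => W x ω) A)
    (S : ℕ → Finset E) (hSA : ∀ k, ∀ x ∈ S k, x ∈ A)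
    (R : ℕ → E → E → Prop)
    (hR : ∀ x ∈ A, ∃ y : ℕ → E, (∀ k, y k ∈ S k) ∧ (∀ k, R k (y (k + 1)) (y k)) ∧
      Filter.Tendsto y Filter.atTop (nhds x))
    (t0 : ℝ) (t : ℕ → ℝ) (T q : ℝ) (hq : 0 ≤ q)
    (hT : ∀ K, t0 + ∑ k ∈ Finset.range K, t k ≤ T)
    (h0 : ∀ x ∈ S 0, (S 0).card * P {ω | t0 ≤ W x ω} ≤ ENNReal.ofReal (q / 2))
    (hk : ∀ k, ∀ x ∈ S (k + 1), ∀ y ∈ S k, R k x y →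
      ((S (k + 1)).card * (S k).card : ℕ) * P {ω | t k ≤ W x ω - W y ω}
        ≤ ENNReal.ofReal (q / 4 * (1 / 2) ^ k)) :
    ENNReal.ofReal (1 - q) ≤ P {ω | (⨆ v : A, W v ω) ≤ T} := by
  classical
  have hbound : ∀ {ι : Type _} (I : Finset ι) (B : ι → Set Ω') (b : ENNReal),
      (∀ i ∈ I, (I.card : ENNReal) * P (B i) ≤ b) → P (⋃ i ∈ I, B i) ≤ b := by
    intro ι I B b hb
    rcases I.eq_empty_or_nonempty with rfl | hI
    · simp
    refine (measure_biUnion_finset_le _ _).trans ?_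
    have hc : (I.card : ENNReal) ≠ 0 := by simpa using hI.ne_empty
    have : ∀ i ∈ I, P (B i) ≤ b / I.card := fun i hi => by
      rw [ENNReal.le_div_iff_mul_le (Or.inl hc) (Or.inl (by simp)), mul_comm]
      exact hb i hi
    refine (Finset.sum_le_sum this).trans ?_
    rw [Finset.sum_const, nsmul_eq_mul]
    exact ENNReal.mul_div_le
  set B0 : Set Ω' := ⋃ x ∈ S 0, {ω | t0 ≤ W x ω}
  set B : ℕ → Set Ω' := fun k => ⋃ z ∈ S (k + 1) ×ˢ S k,
    {ω | R k z.1 z.2 ∧ t k ≤ W z.1 ω - W z.2 ω}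
  have hB0 : P B0 ≤ ENNReal.ofReal (q / 2) := hbound _ _ _ h0
  have hB : ∀ k, P (B k) ≤ ENNReal.ofReal (q / 4 * (1 / 2) ^ k) := by
    intro k
    apply hbound
    rintro ⟨x, y⟩ hz
    rw [Finset.mem_product] at hz
    by_cases hxy : R k x y
    · simp only [hxy, true_and, Finset.card_product]
      exact hk k x hz.1 y hz.2 hxy
    · simp [hxy]
  have hBU : P (⋃ k, B k) ≤ ENNReal.ofReal (q / 2) := by
    refine (measure_iUnion_le _).trans ((ENNReal.tsum_le_tsum hB).trans ?_)
    rw [← ENNReal.ofReal_tsum_of_nonneg (fun k => by positivity)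
      (summable_geometric_two.mul_left _), tsum_mul_left, tsum_geometric_two]
    apply ENNReal.ofReal_le_ofReal
    linarith
  set N : Set Ω' := {ω | ¬ ContinuousOn (fun x => W x ω) A}
  have hN : P N = 0 := hcont
  have hbad : P (B0 ∪ (⋃ k, B k) ∪ N) ≤ ENNReal.ofReal q := by
    refine (measure_union_le _ _).trans ?_
    rw [hN, add_zero]
    refine (measure_union_le _ _).trans ((add_le_add hB0 hBU).trans ?_)
    rw [← ENNReal.ofReal_add (by positivity) (by positivity)]
    apply ENNReal.ofReal_le_ofReal
    linarith
  have hsub : (B0 ∪ (⋃ k, B k) ∪ N)ᶜ ⊆ {ω | (⨆ v : A, W v ω) ≤ T} := by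
    intro ω hω
    simp only [Set.mem_compl_iff, Set.mem_union, not_or] at hω
    obtain ⟨⟨g0, g1⟩, g2⟩ := hω
    have hc : ContinuousOn (fun x => W x ω) A := by simpa [N] using g2
    have : Nonempty A := hA.to_subtype
    change (⨆ v : A, W v ω) ≤ T
    refine ciSup_le ?_
    rintro ⟨x, hx⟩
    obtain ⟨y, hyS, hyR, hyx⟩ := hR x hx
    have hlim : Filter.Tendsto (fun k => W (y k) ω) Filter.atTop (nhds (W x ω)) :=
      (hc x hx).tendsto.comp (tendsto_nhdsWithin_iff.2
        ⟨hyx, Filter.Eventually.of_forall fun k => hSA k _ (hyS k)⟩)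
    refine le_of_tendsto' hlim fun K => ?_
    refine le_trans ?_ (hT K)
    induction K with
    | zero =>
      simp only [B0, Set.mem_iUnion, not_exists] at g0
      have := g0 (y 0) (hyS 0)
      simp only [Set.mem_ofPred_eq, not_le] at this
      simpa using this.le
    | succ K ih =>
      rw [Finset.sum_range_succ]
      simp only [B, Set.mem_iUnion, not_exists] at g1
      have := g1 K (y (K + 1), y K) (Finset.mem_product.2 ⟨hyS _, hyS _⟩)
      simp only [Set.mem_ofPred_eq, not_and, not_le] at this
      have := this (hyR K)
      linarith
  refine le_trans ?_ (measure_mono hsub)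
  have h1 : 1 ≤ P (B0 ∪ (⋃ k, B k) ∪ N) + P (B0 ∪ (⋃ k, B k) ∪ N)ᶜ := by
    have := measure_union_le (μ := P) (B0 ∪ (⋃ k, B k) ∪ N) (B0 ∪ (⋃ k, B k) ∪ N)ᶜ
    rwa [Set.union_compl_self, measure_univ] at this
  rw [ENNReal.ofReal_sub _ hq, ENNReal.ofReal_one]
  rw [tsub_le_iff_left]
  exact h1.trans (add_le_add_left hbad _)

lemma four_le_exp_two : (4 : ℝ) ≤ Real.exp 2 := by
  have h := Real.exp_one_gt_d9
  have : Real.exp 2 = Real.exp 1 * Real.exp 1 := by rw [← Real.exp_add]; norm_num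
  rw [this]; nlinarith

lemma count_aux (p : ℕ) (L l b v : ℝ) (hL : 1 ≤ L) (hl : 1 ≤ l)
    (hb : b ^ 2 = p * l * L) (hb1 : 1 ≤ b) (hv : 0 ≤ v) (k N : ℕ)
    (hN : N ≤ (2 * (⌈Real.exp (2 + 2 * L + l + 2 * v / b)⌉₊ * 4 ^ k) + 1) ^ p) :
    (N : ℝ) ≤ Real.exp (6 * b ^ 2 + 2 * b * v + 2 * k * b ^ 2) := by
  obtain ⟨X, hX⟩ : ∃ X, X = 2 + 2 * L + l + 2 * v / b := ⟨_, rfl⟩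
  rw [← hX] at hN
  have hX5 : 5 ≤ X := by
    have : 0 ≤ 2 * v / b := by positivity
    linarith
  have h1 : (⌈Real.exp X⌉₊ : ℝ) ≤ Real.exp X + 1 := (Nat.ceil_lt_add_one (Real.exp_pos _).le).le
  have h2 : 6 ≤ Real.exp X := by linarith [Real.add_one_le_exp X]
  have h3 : 2 * (⌈Real.exp X⌉₊ : ℝ) + 1 ≤ Real.exp (X + 1) := by
    rw [Real.exp_add]
    nlinarith [Real.exp_one_gt_d9]
  have h4 : (4 : ℝ) ^ k ≤ Real.exp (2 * k) := by
    rw [mul_comm, Real.exp_nat_mul]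
    gcongr
    exact four_le_exp_two
  have h5 : (1 : ℝ) ≤ 4 ^ k := one_le_pow₀ (by norm_num)
  have h6 : 2 * ((⌈Real.exp X⌉₊ : ℝ) * 4 ^ k) + 1 ≤ Real.exp (2 * k + (X + 1)) := by
    rw [Real.exp_add]
    calc 2 * ((⌈Real.exp X⌉₊ : ℝ) * 4 ^ k) + 1 ≤ 4 ^ k * (2 * (⌈Real.exp X⌉₊ : ℝ) + 1) := by
          linarith
      _ ≤ _ := by gcongr
  have h7 : (N : ℝ) ≤ (2 * ((⌈Real.exp X⌉₊ : ℝ) * 4 ^ k) + 1) ^ p := by exact_mod_cast hN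
  refine h7.trans ((pow_le_pow_left₀ (by positivity) h6 p).trans ?_)
  rw [← Real.exp_nat_mul, Real.exp_le_exp]
  have hp0 : (0 : ℝ) ≤ p := Nat.cast_nonneg p
  have hpb : (p : ℝ) ≤ b ^ 2 := by
    rw [hb, mul_assoc]
    exact le_mul_of_one_le_right hp0 (by nlinarith)
  have a1 : (p : ℝ) * (3 + 2 * L + l) ≤ 6 * b ^ 2 := by
    rw [hb]
    have : 3 + 2 * L + l ≤ 6 * (l * L) := by nlinarith
    nlinarith
  have a2 : (p : ℝ) * (2 * v / b) ≤ 2 * b * v := by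
    rw [mul_div_assoc', div_le_iff₀ (by linarith)]
    nlinarith
  have a3 : (p : ℝ) * (2 * k) ≤ 2 * k * b ^ 2 := by
    have : (0 : ℝ) ≤ k := Nat.cast_nonneg k
    nlinarith
  have : (p : ℝ) * (2 * k + (X + 1)) = p * (3 + 2 * L + l) + p * (2 * v / b) + p * (2 * k) := by
    rw [hX]; ring
  linarith

lemma num_aux (k b v : ℝ) (hk0 : 0 ≤ k) (hb1 : 1 ≤ b) (hv0 : 0 ≤ v) :
    12 * b ^ 2 + 4 * b * v + 4 * (k + 1) * b ^ 2 + v ^ 2 / 2 + (k + 2)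
      ≤ 32 * (k + 1) ^ 2 * (b + v) ^ 2 := by
  have hb0 : 0 ≤ b := by linarith
  have f0 : k + 1 ≤ (k + 1) ^ 2 := by nlinarith
  have f1 : 32 * (k + 1) * (b + v) ^ 2 ≤ 32 * (k + 1) ^ 2 * (b + v) ^ 2 := by
    gcongr
  have f2 : 1 ≤ b ^ 2 := by nlinarith
  have f3 : k + 2 ≤ (k + 2) * b ^ 2 := le_mul_of_one_le_right (by positivity) f2
  have f4 : 0 ≤ b * v := by positivity
  have f5 : 0 ≤ k * (b * v) := by positivity
  have f6 : 0 ≤ k * v ^ 2 := by positivity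
  have f7 : 0 ≤ k * b ^ 2 := by positivity
  have f8 : 0 ≤ v ^ 2 := by positivity
  have e : 32 * (k + 1) * (b + v) ^ 2 = 32 * (k * b ^ 2) + 64 * (k * (b * v)) + 32 * (k * v ^ 2)
      + 32 * b ^ 2 + 64 * (b * v) + 32 * v ^ 2 := by ring
  linarith

theorem stmt6 :
    ∃ η₁ : ℝ,
      ∀ (p : ℕ), 0 < p →
      ∀ (Ω : Set (EuclideanSpace ℝ (Fin p))), IsCompact Ω → Ω.Nonempty →
        0 < Metric.diam Ω →
      ∀ (Ψ Ψt : EuclideanSpace ℝ (Fin p) → ℝ), IsSpectralDensity Ψ Ψt →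
        Integrable (fun ω => (∑ i, |ω i|) * Ψt ω) →
      ∀ (σ : ℝ), 0 < σ →
      ∀ (Ω' : Type) [MeasurableSpace Ω'] (P : Measure Ω') [IsProbabilityMeasure P],
      ∀ (Z : EuclideanSpace ℝ (Fin p) → Ω' → ℝ),
        (∀ x, Measurable (Z x)) →
        (∀ᵐ ω' ∂P, ContinuousOn (fun x => Z x ω') Ω) →
        GaussCov P Z σ Ψ →
      ∀ (n : ℕ) (xs : Fin n → EuclideanSpace ℝ (Fin p)),
        (∀ i, xs i ∈ Ω) → IsUnit (kmat Ψ xs).det →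
      ∀ (A : Set (EuclideanSpace ℝ (Fin p))), IsClosed A → A ⊆ Ω →
      ∀ (σA : ℝ), σA = (⨆ v : A, krigSd Ψ xs σ v) → 0 < σA →
      ∀ (u : ℝ), 0 < u →
        ENNReal.ofReal (1 - Real.exp (-u ^ 2 / (2 * σA ^ 2))) ≤
          P {ω' | (⨆ v : A, (Z v ω' - kinterp Ψ xs (fun x => Z x ω') v)) ≤
              η₁ * σA * Real.sqrt (p * max 1 (Real.log (A0 Ψt * Metric.diam Ω))) *
                Real.sqrt (Real.log (Real.exp 1 * σ / σA)) + u} := by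
  refine ⟨36, ?_⟩
  intro p hp Ω hΩ hΩne hD Ψ Ψt hΨ hI σ hσ Ω' _ P _ Z hZ hZc hG n xs hxs hdet A hAc hAΩ σA hσA
    hσA0 u hu
  have hAne : A.Nonempty := by
    by_contra hne
    rw [Set.not_nonempty_iff_eq_empty] at hne
    subst hne
    rw [Real.iSup_of_isEmpty] at hσA
    linarith
  have : Nonempty A := hAne.to_subtype
  have hσAσ : σA ≤ σ := by
    rw [hσA]
    exact ciSup_le fun v => kr_sd_le hΨ xs hdet σ hσ v
  have hsd : ∀ x ∈ A, krigSd Ψ xs σ x ≤ σA := by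
    intro x hx
    rw [hσA]
    refine le_ciSup (f := fun v : A => krigSd Ψ xs σ v) ⟨σ, ?_⟩ ⟨x, hx⟩
    rintro _ ⟨v, rfl⟩
    exact kr_sd_le hΨ xs hdet σ hσ v
  set D := Metric.diam Ω with hDdef
  set L := Real.log (Real.exp 1 * σ / σA) with hL
  set l := max 1 (Real.log (A0 Ψt * D)) with hl
  have hexpL : Real.exp L = Real.exp 1 * σ / σA := Real.exp_log (by positivity)
  have hL1 : 1 ≤ L := by
    rw [← Real.exp_le_exp, hexpL, mul_div_assoc]
    exact le_mul_of_one_le_right (Real.exp_pos _).le ((one_le_div hσA0).2 hσAσ)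
  have hl1 : 1 ≤ l := le_max_left _ _
  have hp1 : (1 : ℝ) ≤ p := by exact_mod_cast hp
  obtain ⟨b, hbdef⟩ : ∃ b, b = Real.sqrt (p * l) * Real.sqrt L := ⟨_, rfl⟩
  have hb2 : b ^ 2 = p * l * L := by
    rw [hbdef, mul_pow, Real.sq_sqrt (by positivity), Real.sq_sqrt (by positivity)]
  have hb0 : 0 ≤ b := by rw [hbdef]; positivity
  have hb1 : 1 ≤ b := by
    have : 1 ≤ b ^ 2 := by
      rw [hb2]
      exact one_le_mul_of_one_le_of_one_le (one_le_mul_of_one_le_of_one_le hp1 hl1) hL1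
    nlinarith
  obtain ⟨v, hv⟩ : ∃ v, v = u / σA := ⟨_, rfl⟩
  have hv0 : 0 ≤ v := by rw [hv]; positivity
  have huv : u = σA * v := by rw [hv]; field_simp
  have hA0D : A0 Ψt * D ≤ Real.exp l := by
    rcases le_or_gt (A0 Ψt * D) 0 with h | h
    · exact h.trans (Real.exp_pos _).le
    · calc A0 Ψt * D = Real.exp (Real.log (A0 Ψt * D)) := (Real.exp_log h).symm
        _ ≤ _ := Real.exp_le_exp.2 (le_max_right _ _)
  obtain ⟨m0, hm0⟩ : ∃ m0 : ℕ, m0 = ⌈Real.exp (2 + 2 * L + l + 2 * v / b)⌉₊ := ⟨_, rfl⟩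
  have hm0X : Real.exp (2 + 2 * L + l + 2 * v / b) ≤ m0 := by rw [hm0]; exact Nat.le_ceil _
  have hm0pos : (0 : ℝ) < m0 := (Real.exp_pos _).trans_le hm0X
  have hm0pos' : 0 < m0 := by exact_mod_cast hm0pos
  choose S hSA hScard hSnet using fun k : ℕ =>
    net_exists Ω A hΩ hD hAΩ (m0 * 4 ^ k) (by positivity)
  have hcount : ∀ k, ((S k).card : ℝ) ≤ Real.exp (6 * b ^ 2 + 2 * b * v + 2 * k * b ^ 2) := by
    intro k
    refine count_aux p L l b v hL1 hl1 hb2 hb1 hv0 k _ ?_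
    rw [← hm0]; exact hScard k
  have hq : Real.exp (-u ^ 2 / (2 * σA ^ 2)) = Real.exp (-v ^ 2 / 2) := by
    congr 1
    rw [huv]; field_simp
  have hinv : Real.exp (-1) ≤ 1 / 2 := by
    rw [Real.exp_neg, one_div]
    exact inv_anti₀ (by norm_num) (by linarith [Real.exp_one_gt_d9])
  refine chain P (fun x ω => Z x ω - kinterp Ψ xs (fun x => Z x ω) x) A hAne ?_ S hSA
    (fun k x y => ∀ i, |x i - y i| ≤ 2 * D / (m0 * 4 ^ k)) ?_ (σA * (4 * b + v))
    (fun k => σA * (8 * b) * (((k : ℝ) + 1) / 2 ^ k)) _ _ (Real.exp_pos _).le ?_ ?_ ?_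
  · filter_upwards [hZc] with ω hω
    refine (hω.mono hAΩ).sub ?_
    have hc := spec_cont hΨ
    unfold kinterp
    fun_prop
  · intro x hx
    choose y hyS hy using fun k => hSnet k x hx
    push_cast at hy
    rw [← hDdef] at hy
    refine ⟨y, hyS, ?_, ?_⟩
    · intro k i
      have h1 := hy k i
      have h2 := hy (k + 1) i
      have h3 : D / (m0 * 4 ^ (k + 1)) ≤ D / (m0 * 4 ^ k) := by
        gcongr
        · norm_num
        · omega
      rw [abs_sub_comm] at h2
      calc |y (k + 1) i - y k i| ≤ |y (k + 1) i - x i| + |x i - y k i| := abs_sub_le _ _ _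
        _ ≤ D / (m0 * 4 ^ k) + D / (m0 * 4 ^ k) := by linarith
        _ = _ := by ring
    · rw [(PiLp.homeomorph 2 (fun _ : Fin p => ℝ)).isInducing.tendsto_nhds_iff, tendsto_pi_nhds]
      intro i
      rw [tendsto_iff_dist_tendsto_zero]
      refine squeeze_zero (g := fun k : ℕ => D / m0 * (1 / 4) ^ k) (fun _ => dist_nonneg) ?_ ?_
      · intro k
        have := hy k i
        rw [dist_comm, Real.dist_eq]
        refine this.trans (le_of_eq ?_)
        rw [one_div_pow]; field_simp
      · have := (tendsto_pow_atTop_nhds_zero_of_lt_one (r := (1 / 4 : ℝ)) (by norm_num)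
          (by norm_num)).const_mul (D / m0)
        simpa using this
  · intro K
    rw [← Finset.mul_sum]
    have h1 := mul_le_mul_of_nonneg_left (sum_aux K) (show 0 ≤ σA * (8 * b) by positivity)
    have h2 : 36 * σA * Real.sqrt (p * l) * Real.sqrt L + u = 36 * σA * b + σA * v := by
      rw [hbdef, huv]; ring
    rw [h2]
    linarith
  · intro x hx
    have h1 := kr_tail1 hΨ xs hdet P Z hZ σ hσ hG x σA (σA * (4 * b + v)) hσA0 (by positivity)
      (hsd x (hSA 0 x hx))
    refine (mul_le_mul_right h1 _).trans ?_
    rw [← ENNReal.ofReal_natCast, ← ENNReal.ofReal_mul (Nat.cast_nonneg _)]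
    apply ENNReal.ofReal_le_ofReal
    refine (mul_le_mul_of_nonneg_right (hcount 0) (Real.exp_pos _).le).trans ?_
    have e1 : -(σA * (4 * b + v)) ^ 2 / (2 * σA ^ 2) = - (4 * b + v) ^ 2 / 2 := by field_simp
    rw [hq, e1, ← Real.exp_add]
    calc _ ≤ Real.exp (-v ^ 2 / 2 + -1) := by
          rw [Real.exp_le_exp]
          push_cast
          nlinarith
      _ = Real.exp (-v ^ 2 / 2) * Real.exp (-1) := Real.exp_add _ _
      _ ≤ Real.exp (-v ^ 2 / 2) * (1 / 2) := by gcongr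
      _ = _ := by ring
  · intro k x hx y hy hxy
    have hE : (0 : ℝ) < Real.exp (-(v / b)) := Real.exp_pos _
    have h1 := kr_tail2 hΨ hI xs hdet P Z hZ σ hG x y (σA * Real.exp (-(v / b)) / 2 ^ k)
      (σA * (8 * b) * (((k : ℝ) + 1) / 2 ^ k)) (2 * D / (m0 * 4 ^ k)) (by positivity)
      (by positivity) hxy ?_
    · refine (mul_le_mul_right h1 _).trans ?_
      rw [← ENNReal.ofReal_natCast, ← ENNReal.ofReal_mul (Nat.cast_nonneg _)]
      apply ENNReal.ofReal_le_ofReal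
      have hk0 : (0 : ℝ) ≤ k := Nat.cast_nonneg k
      have hbv : b + v ≤ b * Real.exp (v / b) := by
        have := mul_le_mul_of_nonneg_left (Real.add_one_le_exp (v / b)) hb0
        have e : b * (v / b + 1) = b + v := by field_simp; ring
        linarith
      have e1 : -(σA * (8 * b) * (((k : ℝ) + 1) / 2 ^ k)) ^ 2 /
          (2 * (σA * Real.exp (-(v / b)) / 2 ^ k) ^ 2)
          = - (32 * ((k : ℝ) + 1) ^ 2 * (b * Real.exp (v / b)) ^ 2) := by
        rw [Real.exp_neg]; field_simp; ring
      have e2 : (b + v) ^ 2 ≤ (b * Real.exp (v / b)) ^ 2 := by gcongr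
      have e3 : 32 * ((k : ℝ) + 1) ^ 2 * (b + v) ^ 2
          ≤ 32 * ((k : ℝ) + 1) ^ 2 * (b * Real.exp (v / b)) ^ 2 := by gcongr
      have e4 : 12 * b ^ 2 + 4 * b * v + 4 * (k + 1) * b ^ 2 + v ^ 2 / 2 + (k + 2)
          ≤ 32 * ((k : ℝ) + 1) ^ 2 * (b + v) ^ 2 :=
        num_aux k b v hk0 hb1 hv0
      rw [e1, hq]
      push_cast
      have c1 := hcount k
      have c2 := hcount (k + 1)
      push_cast at c2
      have c3 := mul_le_mul c2 c1 (Nat.cast_nonneg _) (Real.exp_pos _).le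
      refine (mul_le_mul_of_nonneg_right c3 (Real.exp_pos _).le).trans ?_
      rw [← Real.exp_add, ← Real.exp_add]
      have hkb : 0 ≤ b ^ 2 := by positivity
      calc _ ≤ Real.exp (-v ^ 2 / 2 + ((k + 2 : ℕ) : ℝ) * (-1)) := by
            rw [Real.exp_le_exp]
            push_cast
            linarith
        _ = Real.exp (-v ^ 2 / 2) * Real.exp (-1) ^ (k + 2) := by
            rw [Real.exp_add, Real.exp_nat_mul]
        _ ≤ Real.exp (-v ^ 2 / 2) * (1 / 2) ^ (k + 2) := by gcongr
        _ = _ := by ring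
    · have e1 : (σA * Real.exp (-(v / b)) / 2 ^ k) ^ 2
          = σA ^ 2 * Real.exp (-(2 * v / b)) / 4 ^ k := by
        have g1 : Real.exp (-(v / b)) ^ 2 = Real.exp (-(2 * v / b)) := by
          rw [← Real.exp_nat_mul]; congr 1; push_cast; ring
        have g2 : ((2 : ℝ) ^ k) ^ 2 = 4 ^ k := by
          rw [← pow_mul, mul_comm k 2, pow_mul]; norm_num
        rw [div_pow, mul_pow, g1, g2]
      have e2 : 2 * σ ^ 2 * (A0 Ψt * (2 * D / (m0 * 4 ^ k)))
          = (4 * σ ^ 2 * (A0 Ψt * D) / m0) / 4 ^ k := by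
        field_simp; ring
      rw [e1, e2]
      refine div_le_div_of_nonneg_right ?_ (by positivity)
      rw [div_le_iff₀ hm0pos]
      have e3 : σ ≤ σA * Real.exp L := by
        rw [hexpL]
        have : σA * (Real.exp 1 * σ / σA) = Real.exp 1 * σ := by field_simp
        rw [this]
        nlinarith [Real.exp_one_gt_d9]
      calc 4 * σ ^ 2 * (A0 Ψt * D) ≤ 4 * σ ^ 2 * Real.exp l := by gcongr
        _ ≤ Real.exp 2 * (σA * Real.exp L) ^ 2 * Real.exp l := by
            gcongr
            exact four_le_exp_two
        _ = σA ^ 2 * Real.exp (-(2 * v / b)) * Real.exp (2 + 2 * L + l + 2 * v / b) := by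
            have : Real.exp (2 + 2 * L + l + 2 * v / b)
              = Real.exp 2 * (Real.exp L) ^ 2 * Real.exp l * Real.exp (2 * v / b) := by
              rw [← Real.exp_nat_mul, ← Real.exp_add, ← Real.exp_add, ← Real.exp_add]
              norm_num
            rw [this, Real.exp_neg]
            field_simp
        _ ≤ _ := by gcongr
end
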